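/- Let n ≥ 1 and let N : C^∞_c(ℝ^{2n}) → ℝ be a norm on the real vector space of smooth compactly supported functions on ℝ^{2n} (i.e. N(f) ≥ 0 with N(f) = 0 iff f = 0, N(a·f) = |a|·N(f) for a ∈ ℝ, and N(f + g) ≤ N(f) + N(g)) which is invariant under composition with compactly supported volume-preserving diffeomorphisms, i.e. N(f ∘ Φ) = N(f) for every f ∈ C^∞_c(ℝ^{2n}) and every smooth diffeomorphism Φ of ℝ^{2n} that equals the identity outside some compact set and preserves Lebesgue measure. Then there exists a constant C > 0 such that N(f) ≤ C · (‖f‖_∞ + ‖f‖_{L¹}) for every f ∈ C^∞_c(ℝ^{2n}). -/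

import Mathlib

open MeasureTheory

/-- A compactly supported volume-preserving diffeomorphism of `ℝ^d`: a smooth
diffeomorphism that preserves Lebesgue measure and equals the identity outside
some compact set. -/
def IsCompSuppVolDiffeo (d : ℕ)
    (Φ : EuclideanSpace ℝ (Fin d) → EuclideanSpace ℝ (Fin d)) : Prop :=
  ContDiff ℝ (⊤ : ℕ∞) Φ ∧
  (∃ Ψ : EuclideanSpace ℝ (Fin d) → EuclideanSpace ℝ (Fin d),
    ContDiff ℝ (⊤ : ℕ∞) Ψ ∧ Function.LeftInverse Ψ Φ ∧ Function.RightInverse Ψ Φ) ∧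
  MeasurePreserving Φ volume volume ∧
  (∃ K : Set (EuclideanSpace ℝ (Fin d)), IsCompact K ∧ ∀ x ∉ K, Φ x = x)

open Set Filter Topology

section TestFunctions

variable {d : ℕ}

/-- Smooth functions with compact support on `ℝ^d`. -/
def IsTest (f : EuclideanSpace ℝ (Fin d) → ℝ) : Prop :=
  ContDiff ℝ (⊤ : ℕ∞) f ∧ HasCompactSupport f

/-- The translate `x ↦ f (x - v)`. -/
def shift (v : EuclideanSpace ℝ (Fin d)) (f : EuclideanSpace ℝ (Fin d) → ℝ) :
    EuclideanSpace ℝ (Fin d) → ℝ := fun x => f (x - v)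

/-- The derivative of `f` in the direction `e`. -/
noncomputable def dirDeriv (e : EuclideanSpace ℝ (Fin d)) (f : EuclideanSpace ℝ (Fin d) → ℝ) :
    EuclideanSpace ℝ (Fin d) → ℝ := fun x => fderiv ℝ f x e

namespace IsTest

variable {f g : EuclideanSpace ℝ (Fin d) → ℝ}

theorem zero : IsTest (0 : EuclideanSpace ℝ (Fin d) → ℝ) :=
  ⟨contDiff_const, HasCompactSupport.zero⟩

theorem add (hf : IsTest f) (hg : IsTest g) : IsTest (f + g) :=
  ⟨hf.1.add hg.1, hf.2.add hg.2⟩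

theorem const_smul (hf : IsTest f) (a : ℝ) : IsTest (a • f) :=
  ⟨contDiff_const.smul hf.1, hf.2.smul_left (f := fun _ => a)⟩

theorem neg (hf : IsTest f) : IsTest (-f) := by
  simpa using hf.const_smul (-1)

theorem sub (hf : IsTest f) (hg : IsTest g) : IsTest (f - g) := by
  simpa [sub_eq_add_neg] using hf.add hg.neg

theorem mul_left (hf : IsTest f) (hg : ContDiff ℝ (⊤ : ℕ∞) g) : IsTest (g * f) :=
  ⟨hg.mul hf.1, hf.2.mul_left⟩

theorem sum {ι : Type*} {s : Finset ι} {F : ι → EuclideanSpace ℝ (Fin d) → ℝ}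
    (h : ∀ i ∈ s, IsTest (F i)) : IsTest (∑ i ∈ s, F i) := by
  classical
  induction s using Finset.induction_on with
  | empty => simpa using zero
  | insert a s ha ih =>
    rw [Finset.sum_insert ha]
    exact (h a (by simp)).add (ih fun i hi => h i (by simp [hi]))

theorem shift (hf : IsTest f) (v : EuclideanSpace ℝ (Fin d)) : IsTest (shift v f) :=
  ⟨hf.1.comp (contDiff_id.sub contDiff_const),
    hf.2.comp_homeomorph (Homeomorph.subRight v)⟩

theorem dirDeriv (hf : IsTest f) (e : EuclideanSpace ℝ (Fin d)) : IsTest (dirDeriv e f) := by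
  refine ⟨(hf.1.fderiv_right (m := (⊤ : ℕ∞)) (by simp)).clm_apply contDiff_const, ?_⟩
  exact hf.2.fderiv_apply ℝ e

theorem differentiable (hf : IsTest f) : Differentiable ℝ f :=
  hf.1.differentiable (by simp)

theorem continuous (hf : IsTest f) : Continuous f := hf.1.continuous

theorem exists_bound (hf : IsTest f) : ∃ C : ℝ, 0 ≤ C ∧ ∀ x, |f x| ≤ C := by
  obtain ⟨C, hC⟩ := hf.2.exists_bound_of_continuous hf.continuous
  exact ⟨C, (norm_nonneg _).trans (hC 0), hC⟩

theorem exists_radius (hf : IsTest f) : ∃ R : ℝ, 0 ≤ R ∧ ∀ x, f x ≠ 0 → ‖x‖ ≤ R := by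
  obtain ⟨R, hR⟩ := hf.2.isBounded.exists_norm_le
  exact ⟨max R 0, le_max_right _ _, fun x hx =>
    (hR x (subset_tsupport _ hx)).trans (le_max_left _ _)⟩

theorem of_radius (hf : ContDiff ℝ (⊤ : ℕ∞) f) {R : ℝ} (hR : ∀ x, f x ≠ 0 → ‖x‖ ≤ R) :
    IsTest f :=
  ⟨hf, HasCompactSupport.intro (isCompact_closedBall (0 : EuclideanSpace ℝ (Fin d)) R)
    fun x hx => by_contra fun h => hx (by simpa using hR x h)⟩

theorem hasDerivAt_line (hf : IsTest f) (x e : EuclideanSpace ℝ (Fin d)) (t : ℝ) :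
    HasDerivAt (fun t : ℝ => f (x + t • e)) (_root_.dirDeriv e f (x + t • e)) t := by
  have h1 : HasDerivAt (fun t : ℝ => x + t • e) e t := by
    simpa using ((hasDerivAt_id t).smul_const e).const_add x
  exact (hf.differentiable (x + t • e)).hasFDerivAt.comp_hasDerivAt t h1

theorem hasDerivAt_line_sub (hf : IsTest f) (x e : EuclideanSpace ℝ (Fin d)) (t : ℝ) :
    HasDerivAt (fun t : ℝ => f (x - t • e)) (-_root_.dirDeriv e f (x - t • e)) t := by
  have h1 : HasDerivAt (fun t : ℝ => x - t • e) (-e) t := by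
    simpa using ((hasDerivAt_id t).smul_const e).const_sub x
  have h2 := (hf.differentiable (x - t • e)).hasFDerivAt.comp_hasDerivAt t h1
  rw [ContinuousLinearMap.map_neg] at h2
  exact h2

end IsTest

theorem dirDeriv_shift (e v : EuclideanSpace ℝ (Fin d)) (f : EuclideanSpace ℝ (Fin d) → ℝ) :
    dirDeriv e (shift v f) = shift v (dirDeriv e f) := by
  funext x
  simp only [dirDeriv, shift]
  exact congrArg (fun L : EuclideanSpace ℝ (Fin d) →L[ℝ] ℝ => L e) (fderiv_comp_sub (x := x) v)

/-- A seminorm on test functions, invariant under compactly supported volume-preserving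
diffeomorphisms. -/
structure IsInvariantSeminorm (N : (EuclideanSpace ℝ (Fin d) → ℝ) → ℝ) : Prop where
  nonneg : ∀ {f}, IsTest f → 0 ≤ N f
  smul : ∀ (a : ℝ) {f}, IsTest f → N (a • f) = |a| * N f
  add_le : ∀ {f g}, IsTest f → IsTest g → N (f + g) ≤ N f + N g
  comp : ∀ {f Φ}, IsTest f → IsCompSuppVolDiffeo d Φ → N (f ∘ Φ) = N f

namespace IsInvariantSeminorm

variable {N : (EuclideanSpace ℝ (Fin d) → ℝ) → ℝ} {f g : EuclideanSpace ℝ (Fin d) → ℝ}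

theorem map_zero (hN : IsInvariantSeminorm N) : N 0 = 0 := by
  simpa using hN.smul 0 (f := 0) IsTest.zero

theorem map_neg (hN : IsInvariantSeminorm N) (hf : IsTest f) : N (-f) = N f := by
  simpa using hN.smul (-1) hf

theorem sub_le (hN : IsInvariantSeminorm N) (hf : IsTest f) (hg : IsTest g) :
    N (f - g) ≤ N f + N g := by
  rw [sub_eq_add_neg, ← hN.map_neg hg]
  exact hN.add_le hf hg.neg

theorem le_add_sub (hN : IsInvariantSeminorm N) (hf : IsTest f) (hg : IsTest g) :
    N f ≤ N g + N (f - g) := by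
  simpa using hN.add_le hg (hf.sub hg)

theorem sum_le (hN : IsInvariantSeminorm N) {ι : Type*} {s : Finset ι}
    {F : ι → EuclideanSpace ℝ (Fin d) → ℝ} (h : ∀ i ∈ s, IsTest (F i)) :
    N (∑ i ∈ s, F i) ≤ ∑ i ∈ s, N (F i) := by
  classical
  induction s using Finset.induction_on with
  | empty => simp [hN.map_zero]
  | insert a s ha ih =>
    rw [Finset.sum_insert ha, Finset.sum_insert ha]
    have h' : ∀ i ∈ s, IsTest (F i) := fun i hi => h i (by simp [hi])
    exact (hN.add_le (h a (by simp)) (IsTest.sum h')).trans (by gcongr; exact ih h')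

end IsInvariantSeminorm

end TestFunctions

section Diffeomorphisms

variable {d : ℕ}

theorem det_id_add_smulRight (φ : EuclideanSpace ℝ (Fin d) →L[ℝ] ℝ)
    (e : EuclideanSpace ℝ (Fin d)) :
    (ContinuousLinearMap.id ℝ (EuclideanSpace ℝ (Fin d)) + φ.smulRight e).det = 1 + φ e := by
  exact LinearMap.transvection.det (φ : EuclideanSpace ℝ (Fin d) →ₗ[ℝ] ℝ) e

theorem exists_smooth_inverse
    {A : EuclideanSpace ℝ (Fin d) → EuclideanSpace ℝ (Fin d)}
    (hA : ContDiff ℝ (⊤ : ℕ∞) A) (hbij : Function.Bijective A)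
    (hdet : ∀ x, (fderiv ℝ A x).det ≠ 0) :
    ∃ B : EuclideanSpace ℝ (Fin d) → EuclideanSpace ℝ (Fin d), ContDiff ℝ (⊤ : ℕ∞) B ∧
      Function.LeftInverse B A ∧ Function.RightInverse B A := by
  let A' : EuclideanSpace ℝ (Fin d) →
      EuclideanSpace ℝ (Fin d) ≃L[ℝ] EuclideanSpace ℝ (Fin d) := fun x =>
    (fderiv ℝ A x).toContinuousLinearEquivOfDetNeZero (hdet x)
  have hA' : ∀ x, ((A' x : EuclideanSpace ℝ (Fin d) ≃L[ℝ] EuclideanSpace ℝ (Fin d)) :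
      EuclideanSpace ℝ (Fin d) →L[ℝ] EuclideanSpace ℝ (Fin d)) = fderiv ℝ A x := fun x =>
    ContinuousLinearMap.coe_toContinuousLinearEquivOfDetNeZero _ _
  have hopen : IsOpenMap A := isOpenMap_of_hasStrictFDerivAt_equiv (f' := A') fun x => by
    rw [hA']
    exact hA.contDiffAt.hasStrictFDerivAt (by simp)
  let h : EuclideanSpace ℝ (Fin d) ≃ₜ EuclideanSpace ℝ (Fin d) :=
    (Equiv.ofBijective A hbij).toHomeomorphOfContinuousOpen hA.continuous hopen
  have hh : ∀ x, h x = A x := fun x => rfl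
  refine ⟨h.symm, ?_, fun x => h.symm_apply_apply x, fun x => h.apply_symm_apply x⟩
  refine Homeomorph.contDiff_symm h (f₀' := A') (fun x => ?_) hA
  rw [hA']
  exact (hA.differentiable (by simp) x).hasFDerivAt

theorem addHaar_image_eq_of_abs_det_eq
    {A B : EuclideanSpace ℝ (Fin d) → EuclideanSpace ℝ (Fin d)}
    (hA : Differentiable ℝ A) (hB : Differentiable ℝ B)
    (hAi : Function.Injective A) (hBi : Function.Injective B)
    (hdet : ∀ x, |(fderiv ℝ A x).det| = |(fderiv ℝ B x).det|)
    {s : Set (EuclideanSpace ℝ (Fin d))} (hs : MeasurableSet s) :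
    volume (A '' s) = volume (B '' s) := by
  rw [← lintegral_abs_det_fderiv_eq_addHaar_image volume hs
      (fun x _ => (hA x).hasFDerivAt.hasFDerivWithinAt) hAi.injOn,
    ← lintegral_abs_det_fderiv_eq_addHaar_image volume hs
      (fun x _ => (hB x).hasFDerivAt.hasFDerivWithinAt) hBi.injOn]
  simp only [hdet]

/-- Two compactly supported diffeomorphisms with the same Jacobian differ by a volume-preserving
diffeomorphism. -/
theorem exists_volDiffeo_of_abs_det_eq
    {A B : EuclideanSpace ℝ (Fin d) → EuclideanSpace ℝ (Fin d)}
    (hA : ContDiff ℝ (⊤ : ℕ∞) A) (hB : ContDiff ℝ (⊤ : ℕ∞) B)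
    (hAb : Function.Bijective A) (hBb : Function.Bijective B)
    (hdet : ∀ x, |(fderiv ℝ A x).det| = |(fderiv ℝ B x).det|)
    (hdet0 : ∀ x, (fderiv ℝ A x).det ≠ 0)
    {K : Set (EuclideanSpace ℝ (Fin d))} (hK : IsCompact K)
    (hAK : ∀ x ∉ K, A x = x) (hBK : ∀ x ∉ K, B x = x) :
    ∃ Φ, IsCompSuppVolDiffeo d Φ ∧ ∀ x, Φ (A x) = B x := by
  obtain ⟨A', hA', hAl, hAr⟩ := exists_smooth_inverse hA hAb hdet0
  obtain ⟨B', hB', hBl, hBr⟩ := exists_smooth_inverse hB hBb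
    (fun x h => hdet0 x (abs_eq_zero.1 (by rw [hdet, h, abs_zero])))
  refine ⟨B ∘ A', ⟨hB.comp hA', ⟨A ∘ B', hA.comp hB', fun x => ?_, fun x => ?_⟩,
    ⟨(hB.comp hA').continuous.measurable, ?_⟩, A '' K, hK.image hA.continuous, fun y hy => ?_⟩,
    fun x => by simp [hAl x]⟩
  · simp [hBl (A' x), hAr x]
  · simp [hAl (B' x), hBr x]
  · ext s hs
    rw [Measure.map_apply (hB.comp hA').continuous.measurable hs, preimage_comp,
      ← image_eq_preimage_of_inverse hAl hAr,
      addHaar_image_eq_of_abs_det_eq (hA.differentiable (by simp))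
        (hB.differentiable (by simp)) hAb.1 hBb.1 hdet (hB.continuous.measurable hs),
      image_preimage_eq _ hBb.2]
  · have h1 : A' y ∉ K := fun h => hy ⟨A' y, h, hAr y⟩
    have h2 := hAK _ h1
    rw [hAr] at h2
    simp only [Function.comp]
    rw [hBK _ h1, ← h2]

variable {w v : EuclideanSpace ℝ (Fin d) → ℝ} {e ℓ : EuclideanSpace ℝ (Fin d)}

theorem hasFDerivAt_graph (hw : IsTest w) (e x : EuclideanSpace ℝ (Fin d)) :
    HasFDerivAt (fun x => x + w x • e)
      (ContinuousLinearMap.id ℝ _ + (fderiv ℝ w x).smulRight e) x :=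
  (hasFDerivAt_id x).add ((hw.differentiable x).hasFDerivAt.smul_const e)

theorem det_fderiv_graph (hw : IsTest w) (e x : EuclideanSpace ℝ (Fin d)) :
    (fderiv ℝ (fun x => x + w x • e) x).det = 1 + dirDeriv e w x := by
  rw [(hasFDerivAt_graph hw e x).fderiv, det_id_add_smulRight]
  rfl

theorem contDiff_graph (hw : IsTest w) (e : EuclideanSpace ℝ (Fin d)) :
    ContDiff ℝ (⊤ : ℕ∞) (fun x => x + w x • e) :=
  contDiff_id.add (hw.1.smul contDiff_const)

theorem bijective_add_of_deriv {φ φ' : ℝ → ℝ} (hφ : ∀ t, HasDerivAt φ (φ' t) t)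
    (hφ' : ∀ t, |φ' t| ≤ 1 / 2) {C : ℝ} (hC : ∀ t, |φ t| ≤ C) :
    Function.Bijective (fun t => t + φ t) := by
  have hd : ∀ t, HasDerivAt (fun t => t + φ t) (1 + φ' t) t := fun t =>
    (hasDerivAt_id t).add (hφ t)
  have hc : Continuous (fun t => t + φ t) :=
    continuous_iff_continuousAt.2 fun t => (hd t).continuousAt
  refine ⟨(strictMono_of_deriv_pos fun t => ?_).injective, hc.surjective ?_ ?_⟩
  · rw [(hd t).deriv]
    linarith [(abs_le.1 (hφ' t)).1]
  · refine tendsto_atTop_mono (fun t => ?_) (tendsto_atTop_add_const_right _ (-C) tendsto_id)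
    have := (abs_le.1 (hC t)).1
    simp only [id]
    linarith
  · refine tendsto_atBot_mono (fun t => ?_) (tendsto_atBot_add_const_right _ C tendsto_id)
    have := (abs_le.1 (hC t)).2
    simp only [id]
    linarith

theorem bijective_graph (hw : IsTest w) (hw' : ∀ x, |dirDeriv e w x| ≤ 1 / 2) :
    Function.Bijective (fun x => x + w x • e) := by
  obtain ⟨C, -, hC⟩ := hw.exists_bound
  have key : ∀ x, Function.Bijective (fun t : ℝ => t + w (x + t • e)) := fun x =>
    bijective_add_of_deriv (fun t => hw.hasDerivAt_line x e t) (fun t => hw' _) (fun t => hC _)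
  constructor
  · intro x y hxy
    have hy : y = x + (w x - w y) • e := by
      simp only at hxy
      rw [sub_smul, ← add_sub_assoc, hxy, add_sub_cancel_right]
    have h0 := (key x).1 (a₁ := 0) (a₂ := w x - w y) (by
      simp only [← hy]
      simp)
    rw [hy, ← h0, zero_smul, add_zero]
  · intro y
    obtain ⟨t, ht⟩ := (key y).2 0
    refine ⟨y + t • e, ?_⟩
    simp only at ht ⊢
    rw [add_assoc, ← add_smul, ht, zero_smul, add_zero]

/-- The shears `x ↦ x + w x • e` and `x ↦ x + v x • ℓ` differ by a volume-preserving
diffeomorphism as soon as `∂_e w = ∂_ℓ v`. -/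
theorem exists_volDiffeo_of_dirDeriv_eq (hw : IsTest w) (hv : IsTest v)
    (hw' : ∀ x, |dirDeriv e w x| ≤ 1 / 2) (h : dirDeriv e w = dirDeriv ℓ v) :
    ∃ Φ, IsCompSuppVolDiffeo d Φ ∧ ∀ x, Φ (x + w x • e) = x + v x • ℓ := by
  refine exists_volDiffeo_of_abs_det_eq (contDiff_graph hw e) (contDiff_graph hv ℓ)
    (bijective_graph hw hw') (bijective_graph hv (h ▸ hw')) (fun x => ?_) (fun x => ?_)
    (hw.2.isCompact.union hv.2.isCompact) (fun x hx => ?_) (fun x hx => ?_)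
  · rw [det_fderiv_graph hw, det_fderiv_graph hv, h]
  · rw [det_fderiv_graph hw]
    have := (abs_le.1 (hw' x)).1
    intro h
    linarith
  · simp [image_eq_zero_of_notMem_tsupport fun h' => hx (Or.inl h')]
  · simp [image_eq_zero_of_notMem_tsupport fun h' => hx (Or.inr h')]

/-- `x ↦ x + k x • e` and `y ↦ y + w y • e` are inverse to each other. -/
def ShearInverse (e : EuclideanSpace ℝ (Fin d)) (k w : EuclideanSpace ℝ (Fin d) → ℝ) : Prop :=
  (∀ x, w (x + k x • e) = -k x) ∧ ∀ y, k (y + w y • e) = -w y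

theorem ShearInverse.shift {k w : EuclideanSpace ℝ (Fin d) → ℝ} (h : ShearInverse e k w)
    (u : EuclideanSpace ℝ (Fin d)) : ShearInverse e (shift u k) (shift u w) := by
  refine ⟨fun x => ?_, fun x => ?_⟩ <;> simp only [_root_.shift]
  · rw [← h.1, add_sub_right_comm]
  · rw [← h.2, add_sub_right_comm]

theorem exists_shearInverse {k : EuclideanSpace ℝ (Fin d) → ℝ} {e : EuclideanSpace ℝ (Fin d)}
    (hk : IsTest k) (hk' : ∀ x, |dirDeriv e k x| ≤ 1 / 2) :
    ∃ w, IsTest w ∧ ShearInverse e k w := by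
  obtain ⟨B, hB, hBl, hBr⟩ := exists_smooth_inverse (contDiff_graph hk e) (bijective_graph hk hk')
    (fun x => by
      rw [det_fderiv_graph hk]
      have := (abs_le.1 (hk' x)).1
      intro h
      linarith)
  have hBy : ∀ y, B y + k (B y) • e = y := hBr
  have hBx : ∀ x, B (x + k x • e) = x := hBl
  refine ⟨fun y => -k (B y), ⟨(hk.1.comp hB).neg, ?_⟩, fun x => ?_, fun y => ?_⟩
  · refine HasCompactSupport.intro (hk.2.isCompact.image (contDiff_graph hk e).continuous)
      fun y hy => ?_
    have : B y ∉ tsupport k := fun h => hy ⟨B y, h, hBy y⟩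
    simp [image_eq_zero_of_notMem_tsupport this]
  · simp only [hBx]
  · have h1 : y + (-k (B y)) • e = B y := by
      rw [neg_smul, ← sub_eq_add_neg]
      exact (eq_sub_of_add_eq (hBy y)).symm
    simp only [h1, neg_neg]

theorem ShearInverse.dirDeriv_le {k w : EuclideanSpace ℝ (Fin d) → ℝ} (h : ShearInverse e k w)
    (hk : IsTest k) (hw : IsTest w) (hk' : ∀ x, |dirDeriv e k x| ≤ 1 / 3) (y) :
    |dirDeriv e w y| ≤ 1 / 2 := by
  have h1 := (hk.differentiable (y + w y • e)).hasFDerivAt.comp y (hasFDerivAt_graph hw e y)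
  have h2 : HasFDerivAt (k ∘ fun y => y + w y • e) (-fderiv ℝ w y) y := by
    have : (k ∘ fun y => y + w y • e) = -w := funext h.2
    rw [this]
    exact (hw.differentiable y).hasFDerivAt.neg
  have h3 := congrArg (fun L : EuclideanSpace ℝ (Fin d) →L[ℝ] ℝ => L e) (h1.unique h2)
  simp only [ContinuousLinearMap.comp_apply, add_apply,
    ContinuousLinearMap.id_apply, ContinuousLinearMap.smulRight_apply, map_add, map_smul,
    neg_apply, smul_eq_mul] at h3
  have h4 := abs_le.1 (hk' (y + w y • e))
  simp only [dirDeriv] at h4 ⊢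
  set p := fderiv ℝ k (y + w y • e) e
  set q := fderiv ℝ w y e
  have h5 : p = -(q * (1 + p)) := by linarith
  rw [abs_le]
  constructor <;> nlinarith

end Diffeomorphisms

section Rotations

variable {d : ℕ}

/-- The orthogonal projection onto the plane of the coordinates `i` and `j`. -/
noncomputable def planeProj (i j : Fin d) :
    EuclideanSpace ℝ (Fin d) →L[ℝ] EuclideanSpace ℝ (Fin d) :=
  (EuclideanSpace.proj i).smulRight (EuclideanSpace.single i (1 : ℝ)) +
    (EuclideanSpace.proj j).smulRight (EuclideanSpace.single j (1 : ℝ))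

/-- The quarter turn in the plane of the coordinates `i` and `j`, zero on its complement. -/
noncomputable def planeTurn (i j : Fin d) :
    EuclideanSpace ℝ (Fin d) →L[ℝ] EuclideanSpace ℝ (Fin d) :=
  (EuclideanSpace.proj i).smulRight (EuclideanSpace.single j (1 : ℝ)) -
    (EuclideanSpace.proj j).smulRight (EuclideanSpace.single i (1 : ℝ))

/-- The rotation by the angle `t` in the plane of the coordinates `i` and `j`. -/
noncomputable def planeRot (i j : Fin d) (t : ℝ) :
    EuclideanSpace ℝ (Fin d) →L[ℝ] EuclideanSpace ℝ (Fin d) :=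
  ContinuousLinearMap.id ℝ _ + (Real.cos t - 1) • planeProj i j + Real.sin t • planeTurn i j

variable {i j : Fin d}

theorem planeProj_apply (x : EuclideanSpace ℝ (Fin d)) :
    planeProj i j x = x i • EuclideanSpace.single i (1 : ℝ) +
      x j • EuclideanSpace.single j (1 : ℝ) := rfl

theorem planeTurn_apply (x : EuclideanSpace ℝ (Fin d)) :
    planeTurn i j x = x i • EuclideanSpace.single j (1 : ℝ) -
      x j • EuclideanSpace.single i (1 : ℝ) := rfl

theorem planeRot_apply (t : ℝ) (x : EuclideanSpace ℝ (Fin d)) :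
    planeRot i j t x = x + (Real.cos t - 1) • planeProj i j x + Real.sin t • planeTurn i j x := rfl

theorem planeProj_planeProj (hij : i ≠ j) (x : EuclideanSpace ℝ (Fin d)) :
    planeProj i j (planeProj i j x) = planeProj i j x := by
  simp [planeProj_apply, hij, hij.symm]

theorem planeProj_planeTurn (hij : i ≠ j) (x : EuclideanSpace ℝ (Fin d)) :
    planeProj i j (planeTurn i j x) = planeTurn i j x := by
  simp only [planeProj_apply, planeTurn_apply]
  simp [hij, hij.symm]
  abel

theorem planeTurn_planeProj (hij : i ≠ j) (x : EuclideanSpace ℝ (Fin d)) :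
    planeTurn i j (planeProj i j x) = planeTurn i j x := by
  simp [planeProj_apply, planeTurn_apply, hij, hij.symm]

theorem planeTurn_planeTurn (hij : i ≠ j) (x : EuclideanSpace ℝ (Fin d)) :
    planeTurn i j (planeTurn i j x) = -planeProj i j x := by
  simp only [planeProj_apply, planeTurn_apply]
  simp [hij, hij.symm]
  abel

theorem inner_planeTurn (x : EuclideanSpace ℝ (Fin d)) : inner ℝ x (planeTurn i j x) = 0 := by
  simp only [planeTurn_apply, inner_sub_right, inner_smul_right,
    EuclideanSpace.inner_single_right]
  simp
  ring

theorem planeRot_neg_planeRot (hij : i ≠ j) (t : ℝ) (x : EuclideanSpace ℝ (Fin d)) :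
    planeRot i j (-t) (planeRot i j t x) = x := by
  simp only [planeRot_apply, map_add, map_smul, planeProj_planeProj hij, planeProj_planeTurn hij,
    planeTurn_planeProj hij, planeTurn_planeTurn hij, Real.cos_neg, Real.sin_neg]
  have h := Real.cos_sq_add_sin_sq t
  rw [← sub_eq_zero]
  have : ((Real.cos t ^ 2 + Real.sin t ^ 2) - 1) • planeProj i j x = 0 := by
    rw [h]; simp
  rw [← this]
  module

theorem norm_planeRot (hij : i ≠ j) (t : ℝ) (x : EuclideanSpace ℝ (Fin d)) :
    ‖planeRot i j t x‖ = ‖x‖ := by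
  have h := Real.cos_sq_add_sin_sq t
  have hi : ∀ k, ∑ x_1, (Pi.single k (1 : ℝ) : Fin d → ℝ) x_1 * x x_1 = x k := fun k => by
    simp [Pi.single_apply]
  rw [← sq_eq_sq₀ (norm_nonneg _) (norm_nonneg _), ← real_inner_self_eq_norm_sq,
    ← real_inner_self_eq_norm_sq]
  simp only [planeRot_apply, planeProj_apply, planeTurn_apply, inner_add_left, inner_add_right,
    inner_sub_left, inner_sub_right, inner_smul_left, inner_smul_right,
    EuclideanSpace.inner_single_left, EuclideanSpace.inner_single_right]
  simp [hij, hij.symm]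
  linear_combination (x i ^ 2 + x j ^ 2) * h

theorem abs_det_planeRot (hij : i ≠ j) (t : ℝ) : |(planeRot i j t).det| = 1 := by
  have himg : planeRot i j t '' Metric.closedBall 0 1 = Metric.closedBall 0 1 := by
    ext y
    constructor
    · rintro ⟨x, hx, rfl⟩
      simpa [norm_planeRot hij] using hx
    · intro hy
      refine ⟨planeRot i j (-t) y, by simpa [norm_planeRot hij] using hy, ?_⟩
      simpa using planeRot_neg_planeRot hij (-t) y
  have h := Measure.addHaar_image_continuousLinearMap (volume : Measure (EuclideanSpace ℝ (Fin d)))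
    (planeRot i j t) (Metric.closedBall 0 1)
  rw [himg] at h
  have h0 : (volume (Metric.closedBall (0 : EuclideanSpace ℝ (Fin d)) 1)) ≠ 0 :=
    (Metric.measure_closedBall_pos _ _ one_pos).ne'
  have h1 : (volume (Metric.closedBall (0 : EuclideanSpace ℝ (Fin d)) 1)) ≠ ⊤ :=
    measure_closedBall_lt_top.ne
  have h2 : ENNReal.ofReal |(planeRot i j t).det| = 1 := by
    rw [← ENNReal.mul_left_inj h0 h1, one_mul]
    exact h.symm
  exact ENNReal.ofReal_eq_one.1 h2

theorem hasFDerivAt_twist {θ : ℝ → ℝ} (hθ : Differentiable ℝ θ)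
    (m x : EuclideanSpace ℝ (Fin d)) (hij : i ≠ j) :
    HasFDerivAt (fun x => m + planeRot i j (θ (‖x - m‖ ^ 2)) (x - m))
      ((planeRot i j (θ (‖x - m‖ ^ 2))).comp (ContinuousLinearMap.id ℝ _ +
        ((2 * deriv θ (‖x - m‖ ^ 2)) • innerSL ℝ (x - m)).smulRight (planeTurn i j (x - m)))) x := by
  have h1 : HasFDerivAt (fun x : EuclideanSpace ℝ (Fin d) => x - m)
      (ContinuousLinearMap.id ℝ _) x := (hasFDerivAt_id x).sub_const m
  have h2 : HasFDerivAt (fun x : EuclideanSpace ℝ (Fin d) => ‖x - m‖ ^ 2)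
      (2 • (innerSL ℝ (x - m)).comp (ContinuousLinearMap.id ℝ _)) x := h1.norm_sq
  have h3 := (hθ (‖x - m‖ ^ 2)).hasDerivAt.comp_hasFDerivAt x h2
  have hP := (planeProj i j).hasFDerivAt.comp x h1
  have hJ := (planeTurn i j).hasFDerivAt.comp x h1
  have h4 := ((h1.add ((h3.cos.sub_const 1).smul hP)).add (h3.sin.smul hJ)).const_add m
  refine h4.congr_fderiv ?_
  ext1 y
  simp only [Function.comp, add_apply, ContinuousLinearMap.comp_apply,
    ContinuousLinearMap.smulRight_apply, ContinuousLinearMap.id_apply, smul_apply, map_add,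
    map_smul, planeRot_apply, planeProj_planeTurn hij, planeTurn_planeTurn hij, smul_eq_mul,
    nsmul_eq_mul]
  push_cast
  module

theorem isCompSuppVolDiffeo_twist {θ : ℝ → ℝ} (hθ : ContDiff ℝ (⊤ : ℕ∞) θ) {r : ℝ}
    (hr : ∀ s, r ^ 2 ≤ s → θ s = 0) (m : EuclideanSpace ℝ (Fin d)) (hij : i ≠ j) :
    IsCompSuppVolDiffeo d (fun x => m + planeRot i j (θ (‖x - m‖ ^ 2)) (x - m)) := by
  set B : EuclideanSpace ℝ (Fin d) → EuclideanSpace ℝ (Fin d) :=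
    fun x => m + planeRot i j (θ (‖x - m‖ ^ 2)) (x - m) with hB
  have hBs : ContDiff ℝ (⊤ : ℕ∞) B := by
    have hsub : ContDiff ℝ (⊤ : ℕ∞) fun x : EuclideanSpace ℝ (Fin d) => x - m :=
      contDiff_id.sub contDiff_const
    have hn : ContDiff ℝ (⊤ : ℕ∞) fun x : EuclideanSpace ℝ (Fin d) => θ (‖x - m‖ ^ 2) :=
      hθ.comp (hsub.norm_sq ℝ)
    exact contDiff_const.add (((hsub.add
      ((hn.cos.sub contDiff_const).smul ((planeProj i j).contDiff.comp hsub))).add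
        (hn.sin.smul ((planeTurn i j).contDiff.comp hsub))))
  have hnorm : ∀ x, ‖B x - m‖ = ‖x - m‖ := fun x => by
    simp only [hB, add_sub_cancel_left, norm_planeRot hij]
  have hBb : Function.Bijective B := by
    refine Function.bijective_iff_has_inverse.2
      ⟨fun x => m + planeRot i j (-θ (‖x - m‖ ^ 2)) (x - m), fun x => ?_, fun x => ?_⟩
    · simp only [hnorm]
      simp [hB, planeRot_neg_planeRot hij]
    · have := planeRot_neg_planeRot hij (-θ (‖x - m‖ ^ 2)) (x - m)
      rw [neg_neg] at this
      simp only [hB, add_sub_cancel_left, norm_planeRot hij, this]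
      exact add_sub_cancel _ _
  have hfid : ∀ x : EuclideanSpace ℝ (Fin d),
      (fderiv ℝ (fun x : EuclideanSpace ℝ (Fin d) => x) x).det = 1 := fun x => by
    rw [fderiv_fun_id]
    exact LinearMap.det_id
  have hdet : ∀ x, (fderiv ℝ B x).det = (planeRot i j (θ (‖x - m‖ ^ 2))).det := fun x => by
    have hd : (fderiv ℝ B x) = _ :=
      (hasFDerivAt_twist (hθ.differentiable (by simp)) m x hij).fderiv
    have h1 := det_id_add_smulRight ((2 * deriv θ (‖x - m‖ ^ 2)) • innerSL ℝ (x - m))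
      (planeTurn i j (x - m))
    rw [smul_apply, innerSL_apply_apply, inner_planeTurn, smul_zero, add_zero] at h1
    rw [ContinuousLinearMap.det] at h1
    rw [hd, ContinuousLinearMap.det, ContinuousLinearMap.toLinearMap_comp, LinearMap.det_comp,
      h1, mul_one]
  have hfix : ∀ x ∉ Metric.closedBall m |r|, B x = x := fun x hx => by
    have h1 : |r| ≤ ‖x - m‖ := by
      simp only [Metric.mem_closedBall, not_le, dist_eq_norm] at hx
      exact hx.le
    have h2 : θ (‖x - m‖ ^ 2) = 0 := hr _ (sq_le_sq.2 (by simpa using h1))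
    simp [hB, h2, planeRot_apply]
  obtain ⟨Φ, hΦ, hΦB⟩ := exists_volDiffeo_of_abs_det_eq (A := fun x => x) (B := B) contDiff_id hBs
    Function.bijective_id hBb (fun x => by rw [hfid, hdet, abs_det_planeRot hij, abs_one])
    (fun x => by rw [hfid]; exact one_ne_zero)
    (isCompact_closedBall m |r|) (fun x _ => rfl) hfix
  exact (funext hΦB : Φ = B) ▸ hΦ

/-- There is a compactly supported volume-preserving diffeomorphism that is a half turn in the plane
of the coordinates `i` and `j` on a ball, and the identity outside a larger ball. -/
theorem exists_volDiffeo_halfTurn (hij : i ≠ j) (m : EuclideanSpace ℝ (Fin d)) {r₁ r₂ : ℝ}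
    (h1 : 0 ≤ r₁) (h12 : r₁ < r₂) :
    ∃ Φ, IsCompSuppVolDiffeo d Φ ∧
      (∀ x, ‖x - m‖ ≤ r₁ → Φ x = x - (2 : ℝ) • planeProj i j (x - m)) ∧
      ∀ x, r₂ ≤ ‖x - m‖ → Φ x = x := by
  have h3 : 0 < r₂ ^ 2 - r₁ ^ 2 := by nlinarith
  have hθ : ContDiff ℝ (⊤ : ℕ∞) fun s : ℝ =>
      Real.pi * (1 - Real.smoothTransition ((s - r₁ ^ 2) / (r₂ ^ 2 - r₁ ^ 2))) :=
    contDiff_const.mul (contDiff_const.sub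
      (Real.smoothTransition.contDiff.comp ((contDiff_id.sub contDiff_const).div_const _)))
  have hθ2 : ∀ s : ℝ, r₂ ^ 2 ≤ s →
      Real.pi * (1 - Real.smoothTransition ((s - r₁ ^ 2) / (r₂ ^ 2 - r₁ ^ 2))) = 0 := fun s hs => by
    rw [Real.smoothTransition.one_of_one_le ((one_le_div h3).2 (by linarith))]
    simp
  refine ⟨_, isCompSuppVolDiffeo_twist hθ hθ2 m hij, fun x hx => ?_, fun x hx => ?_⟩
  · have : ‖x - m‖ ^ 2 ≤ r₁ ^ 2 := by gcongr
    rw [Real.smoothTransition.zero_of_nonpos (div_nonpos_of_nonpos_of_nonneg (by linarith) h3.le)]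
    simp only [sub_zero, mul_one, planeRot_apply, Real.cos_pi, Real.sin_pi, zero_smul, add_zero]
    module
  · have : r₂ ^ 2 ≤ ‖x - m‖ ^ 2 := by gcongr; linarith
    rw [hθ2 _ this]
    simp [planeRot_apply]

end Rotations

section LineIntegrals

variable {d : ℕ} {f : EuclideanSpace ℝ (Fin d) → ℝ} {e : EuclideanSpace ℝ (Fin d)}

theorem IsTest.exists_line_bound (hf : IsTest f) (he : e ≠ 0) (r : ℝ) :
    ∃ ρ : ℝ, 0 ≤ ρ ∧ ∀ x, ‖x‖ ≤ r → ∀ t : ℝ, f (x + t • e) ≠ 0 → |t| ≤ ρ := by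
  obtain ⟨R, hR0, hR⟩ := hf.exists_radius
  have he' : 0 < ‖e‖ := norm_pos_iff.2 he
  refine ⟨(R + |r|) / ‖e‖, by positivity, fun x hx t ht => ?_⟩
  rw [le_div_iff₀ he', ← Real.norm_eq_abs t, ← norm_smul]
  calc ‖t • e‖ = ‖(x + t • e) - x‖ := by simp
    _ ≤ ‖x + t • e‖ + ‖x‖ := norm_sub_le _ _
    _ ≤ R + |r| := add_le_add (hR _ ht) (hx.trans (le_abs_self r))

theorem IsTest.hasCompactSupport_line (hf : IsTest f) (he : e ≠ 0)
    (x : EuclideanSpace ℝ (Fin d)) : HasCompactSupport fun t : ℝ => f (x - t • e) := by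
  obtain ⟨ρ, -, hρ⟩ := hf.exists_line_bound he ‖x‖
  refine HasCompactSupport.intro (isCompact_Icc (a := -ρ) (b := ρ)) fun t ht => ?_
  by_contra h
  have := hρ x le_rfl (-t) (by simpa [sub_eq_add_neg] using h)
  rw [abs_neg] at this
  exact ht (abs_le.1 this)

theorem IsTest.continuous_line (hf : IsTest f) (x : EuclideanSpace ℝ (Fin d)) :
    Continuous fun t : ℝ => f (x - t • e) :=
  hf.continuous.comp (by fun_prop)

theorem IsTest.integrable_line (hf : IsTest f) (he : e ≠ 0)
    (x : EuclideanSpace ℝ (Fin d)) : Integrable fun t : ℝ => f (x - t • e) :=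
  (hf.continuous_line x).integrable_of_hasCompactSupport (hf.hasCompactSupport_line he x)

theorem contDiff_lineIntegral {κ : ℝ → ℝ} (hκ : LocallyIntegrable κ) (he : e ≠ 0)
    (hf : IsTest f) : ContDiff ℝ (⊤ : ℕ∞) fun x => ∫ t, κ t * f (x - t • e) := by
  rw [contDiff_iff_contDiffAt]
  intro x₀
  obtain ⟨ρ, -, hρ⟩ := hf.exists_line_bound he (‖x₀‖ + 1)
  have hg : ContDiffOn ℝ (⊤ : ℕ∞)
      (↿fun (p : EuclideanSpace ℝ (Fin d)) (s : ℝ) => f (p + s • e))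
      (Metric.ball x₀ 1 ×ˢ univ) := by
    refine ContDiff.contDiffOn (hf.1.comp ?_)
    exact contDiff_fst.add (contDiff_snd.smul contDiff_const)
  have h := contDiffOn_convolution_right_with_param_comp (μ := volume)
    (ContinuousLinearMap.mul ℝ ℝ) (v := fun _ => (0 : ℝ)) contDiffOn_const Metric.isOpen_ball
    (isCompact_Icc (a := -ρ) (b := ρ)) (f := κ) (fun p s hp hs => ?_) hκ hg
  · have h2 := h.contDiffAt (Metric.ball_mem_nhds x₀ one_pos)
    refine h2.congr_of_eventuallyEq (Eventually.of_forall fun x => ?_)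
    simp [convolution, sub_eq_add_neg]
  · by_contra h
    refine hs (abs_le.1 (hρ p ?_ s h))
    have h1 : ‖p - x₀‖ < 1 := by simpa [dist_eq_norm] using hp
    linarith [norm_le_norm_add_norm_sub' p x₀]

/-- A bounded piece of a line integral solves a finite-difference cohomological equation. -/
theorem exists_dirDeriv_eq_sub_shift (hf : IsTest f) (he : e ≠ 0) (b : ℝ) (hb : 0 ≤ b) :
    ∃ v, IsTest v ∧ dirDeriv e v = f - shift (b • e) f ∧
      (∀ x, v x ≠ 0 → ∃ t, 0 ≤ t ∧ t ≤ b ∧ f (x - t • e) ≠ 0) ∧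
      ∀ C, (∀ x, |f x| ≤ C) → ∀ x, |v x| ≤ C * b := by
  set v : EuclideanSpace ℝ (Fin d) → ℝ := fun x => ∫ t in (0 : ℝ)..b, f (x - t • e) with hv
  have hne : ∀ x, v x ≠ 0 → ∃ t, 0 ≤ t ∧ t ≤ b ∧ f (x - t • e) ≠ 0 := fun x hx => by
    by_contra! h
    refine hx ?_
    rw [hv]
    refine (intervalIntegral.integral_congr (g := fun _ => (0 : ℝ)) fun t ht => ?_).trans (by simp)
    rw [uIcc_of_le hb] at ht
    exact h t ht.1 ht.2
  have hsm : ContDiff ℝ (⊤ : ℕ∞) v := by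
    have h := contDiff_lineIntegral (κ := (Ioc 0 b).indicator fun _ => (1 : ℝ))
      (((integrable_indicator_iff measurableSet_Ioc).2
        (by simp)).locallyIntegrable) he hf
    convert h using 2 with x
    rw [hv]
    simp only
    rw [intervalIntegral.integral_of_le hb, ← integral_indicator measurableSet_Ioc]
    congr 1
    funext t
    by_cases ht : t ∈ Ioc 0 b <;> simp [ht]
  have htest : IsTest v := by
    obtain ⟨R, -, hR⟩ := hf.exists_radius
    refine IsTest.of_radius (R := R + b * ‖e‖) hsm fun x hx => ?_
    obtain ⟨t, ht0, htb, ht⟩ := hne x hx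
    have h1 := hR _ ht
    have h2 : ‖t • e‖ ≤ b * ‖e‖ := by
      rw [norm_smul, Real.norm_eq_abs, abs_of_nonneg ht0]
      gcongr
    have h3 := norm_add_le (x - t • e) (t • e)
    rw [sub_add_cancel] at h3
    linarith
  refine ⟨v, htest, ?_, hne, fun C hC x => ?_⟩
  · funext x
    have h1 := htest.hasDerivAt_line x e 0
    simp only [zero_smul, add_zero] at h1
    have hcont : Continuous fun u : ℝ => f (x + u • e) := hf.continuous.comp (by fun_prop)
    have h2 : (fun s : ℝ => v (x + s • e)) =
        fun s => (∫ u in (0 : ℝ)..s, f (x + u • e)) - ∫ u in (0 : ℝ)..(s - b), f (x + u • e) := by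
      funext s
      rw [intervalIntegral.integral_interval_sub_left (hcont.intervalIntegrable _ _)
        (hcont.intervalIntegrable _ _)]
      have := intervalIntegral.integral_comp_sub_left (a := 0) (b := b)
        (fun u : ℝ => f (x + u • e)) s
      rw [sub_zero] at this
      rw [← this]
      simp only [hv]
      congr 1
      funext t
      congr 1
      module
    have hF : ∀ s, HasDerivAt (fun s => ∫ u in (0 : ℝ)..s, f (x + u • e)) (f (x + s • e)) s :=
      fun s => intervalIntegral.integral_hasDerivAt_right (hcont.intervalIntegrable _ _)
        (hcont.stronglyMeasurableAtFilter _ _) hcont.continuousAt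
    have h3 : HasDerivAt (fun s : ℝ => v (x + s • e)) (f (x + (0 : ℝ) • e) - f (x + (0 - b) • e)) 0 := by
      rw [h2]
      exact (hF 0).sub ((hF (0 - b)).comp_sub_const 0 b)
    rw [h1.unique h3]
    simp [shift, sub_eq_add_neg]
  · have h := intervalIntegral.norm_integral_le_of_norm_le_const (a := 0) (b := b)
      (f := fun t : ℝ => f (x - t • e)) (C := C) fun t _ => hC _
    simpa [abs_of_nonneg hb] using h

end LineIntegrals

section ShearDisplacement

variable {d : ℕ} {f g k w h G : EuclideanSpace ℝ (Fin d) → ℝ} {e ℓ : EuclideanSpace ℝ (Fin d)}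

theorem dirDeriv_sub (hf : IsTest f) (hg : IsTest g) (e : EuclideanSpace ℝ (Fin d)) :
    dirDeriv e (f - g) = dirDeriv e f - dirDeriv e g := by
  funext x
  simp only [dirDeriv, Pi.sub_apply]
  rw [fderiv_sub (hf.differentiable x) (hg.differentiable x)]
  rfl

theorem dirDeriv_const_smul (hf : IsTest f) (a : ℝ) (e : EuclideanSpace ℝ (Fin d)) :
    dirDeriv e (a • f) = a • dirDeriv e f := by
  funext x
  simp only [dirDeriv, Pi.smul_apply]
  rw [fderiv_const_smul (hf.differentiable x)]
  rfl

theorem IsTest.comp (hf : IsTest f) {Φ : EuclideanSpace ℝ (Fin d) → EuclideanSpace ℝ (Fin d)}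
    (hΦ : IsCompSuppVolDiffeo d Φ) : IsTest (f ∘ Φ) := by
  obtain ⟨h1, -, -, K, hK, hKΦ⟩ := hΦ
  refine ⟨hf.1.comp h1, HasCompactSupport.intro (hK.union hf.2.isCompact) fun x hx => ?_⟩
  have h2 : x ∉ K := fun h => hx (Or.inl h)
  have h3 : x ∉ tsupport f := fun h => hx (Or.inr h)
  simp [hKΦ x h2, image_eq_zero_of_notMem_tsupport h3]

theorem IsTest.exists_ne_zero_of_dirDeriv_ne_zero (hf : IsTest f)
    {y : EuclideanSpace ℝ (Fin d)} (hy : _root_.dirDeriv e f y ≠ 0) {δ : ℝ} (hδ : 0 < δ) :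
    ∃ τ : ℝ, |τ| < δ ∧ f (y + τ • e) ≠ 0 := by
  by_contra! H
  have h1 := hf.hasDerivAt_line y e 0
  rw [zero_smul, add_zero] at h1
  have h2 : (fun t : ℝ => f (y + t • e)) =ᶠ[𝓝 0] fun _ => 0 := by
    filter_upwards [Metric.ball_mem_nhds (0 : ℝ) hδ] with t ht
    exact H t (by simpa using ht)
  exact hy (h1.unique ((hasDerivAt_const (0 : ℝ) (0 : ℝ)).congr_of_eventuallyEq h2))

theorem ShearInverse.exists_of_ne_zero (hkw : ShearInverse e k w)
    {z : EuclideanSpace ℝ (Fin d)} (hz : w z ≠ 0) :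
    ∃ x, k x ≠ 0 ∧ z = x + k x • e ∧ w z = -k x := by
  refine ⟨z + w z • e, ?_, ?_, ?_⟩
  · rw [hkw.2]
    exact neg_ne_zero.2 hz
  · rw [hkw.2]
    simp
  · rw [hkw.2]
    simp

theorem ShearInverse.exists_of_ne_zero' (hkw : ShearInverse e k w) (hwh : ShearInverse e (-w) h)
    {z : EuclideanSpace ℝ (Fin d)} (hz : h z ≠ 0) :
    ∃ x, k x ≠ 0 ∧ z = x + (2 * k x) • e ∧ h z = -k x := by
  obtain ⟨x', h1, h2, h3⟩ := hwh.exists_of_ne_zero hz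
  simp only [Pi.neg_apply, neg_neg] at h1 h2 h3
  obtain ⟨x, h4, h5, h6⟩ := hkw.exists_of_ne_zero (z := x') (fun h => h1 (by simp [h]))
  refine ⟨x, h4, ?_, by rw [h3, h6]⟩
  rw [h2, h6, h5, neg_neg, two_mul, add_smul, add_assoc]

/-- If `G` is affine in the plane spanned by `e` and `ℓ` near the support of `k`, growing only in
the direction `e`, then the displacement of `G` by a suitable volume-preserving diffeomorphism is
exactly `κ • k` plus a disjoint translated copy. -/
theorem IsInvariantSeminorm.le_of_affine {N : (EuclideanSpace ℝ (Fin d) → ℝ) → ℝ}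
    (hN : IsInvariantSeminorm N) {j : Fin d} (hej : e j = 0) (hℓj : ℓ j = 1) {κ b R : ℝ}
    (hκ : κ ≠ 0) (hb : 2 * R < b) (hb0 : 0 ≤ b) (hw : IsTest w)
    (hkw : ShearInverse e k w) (hwh : ShearInverse e (-w) h)
    (hw' : ∀ x, |dirDeriv e w x| ≤ 1 / 2) (hkR : ∀ x, k x ≠ 0 → |x j| ≤ R)
    (hk1 : ∀ x, |κ * k x| ≤ 1) (hG : IsTest G)
    (hGk : ∀ x, k x ≠ 0 → ∀ a s : ℝ, |a| ≤ 3 → |s| ≤ 2 * b →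
      G (x + (a / κ) • e + s • ℓ) = G x + a) :
    N (κ • k + κ • shift (b • ℓ) h) ≤ 2 * N G := by
  have hκ' : 0 < |κ| := abs_pos.2 hκ
  have hwR : ∀ z, w z ≠ 0 → |z j| ≤ R := fun z hz => by
    obtain ⟨x, h1, h2, -⟩ := hkw.exists_of_ne_zero hz
    simpa [h2, hej] using hkR x h1
  have hhR : ∀ z, h z ≠ 0 → |z j| ≤ R := fun z hz => by
    obtain ⟨x, h1, h2, -⟩ := hkw.exists_of_ne_zero' hwh hz
    simpa [h2, hej] using hkR x h1
  have hdR : ∀ z, dirDeriv e w z ≠ 0 → |z j| ≤ R := fun z hz => by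
    obtain ⟨τ, -, h2⟩ := hw.exists_ne_zero_of_dirDeriv_ne_zero hz one_pos
    simpa [hej] using hwR _ h2
  have hdisj : ∀ z : EuclideanSpace ℝ (Fin d), |z j| ≤ R → ¬ |(z - b • ℓ) j| ≤ R := fun z h1 h2 => by
    simp only [PiLp.sub_apply, PiLp.smul_apply, hℓj, smul_eq_mul, mul_one] at h2
    linarith [(abs_le.1 h1).2, (abs_le.1 h2).1]
  have hℓ : ℓ ≠ 0 := fun h => by simp [h] at hℓj
  obtain ⟨v, hv, hvd, hv0, hvb⟩ := exists_dirDeriv_eq_sub_shift (hw.dirDeriv e) hℓ b hb0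
  have hvb' := hvb _ hw'
  obtain ⟨Φ, hΦ, hΦx⟩ := exists_volDiffeo_of_dirDeriv_eq (e := e) (ℓ := ℓ)
    (hw.sub (hw.shift (b • ℓ))) hv (fun x => by
      rw [dirDeriv_sub hw (hw.shift _), dirDeriv_shift]
      simp only [Pi.sub_apply, shift]
      by_cases h1 : dirDeriv e w x = 0
      · rw [h1, zero_sub, abs_neg]
        exact hw' _
      · have h2 : dirDeriv e w (x - b • ℓ) = 0 := by
          by_contra h
          exact hdisj x (hdR _ h1) (hdR _ h)
        rw [h2, sub_zero]
        exact hw' _) (by rw [dirDeriv_sub hw (hw.shift _), dirDeriv_shift, hvd])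
  set near : EuclideanSpace ℝ (Fin d) → Prop := fun y => ∃ x a s, k x ≠ 0 ∧ |a| ≤ 2 ∧ |s| ≤ b ∧
    y = x + (a / κ) • e + s • ℓ with hnear
  have hkappa : ∀ x, k x = (κ * k x) / κ := fun x => by field_simp
  have near_k : ∀ y, k y ≠ 0 → near y := fun y hy =>
    ⟨y, 0, 0, hy, by simp, by simpa using hb0, by simp⟩
  have near_h : ∀ y, h (y - b • ℓ) ≠ 0 → near y := fun y hy => by
    obtain ⟨x, h1, h2, -⟩ := hkw.exists_of_ne_zero' hwh hy
    refine ⟨x, 2 * (κ * k x), b, h1, ?_, (abs_of_nonneg hb0).le, ?_⟩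
    · rw [abs_mul, abs_two]
      linarith [hk1 x]
    · rw [mul_div_assoc, ← hkappa, ← h2, sub_add_cancel]
  have near_v : ∀ y, v y ≠ 0 → near y := fun y hy => by
    obtain ⟨t, ht0, htb, ht⟩ := hv0 y hy
    obtain ⟨τ, hτ, hτw⟩ := hw.exists_ne_zero_of_dirDeriv_ne_zero ht (inv_pos.2 hκ')
    obtain ⟨x, h1, h2, -⟩ := hkw.exists_of_ne_zero hτw
    refine ⟨x, κ * k x - κ * τ, t, h1, ?_, by rwa [abs_of_nonneg ht0], ?_⟩
    · have h3 : |κ * τ| ≤ 1 := by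
        rw [abs_mul, ← mul_inv_cancel₀ hκ'.ne']
        gcongr
      linarith [abs_sub (κ * k x) (κ * τ), hk1 x]
    · have h3 : y = (y - t • ℓ + τ • e) - τ • e + t • ℓ := by module
      rw [h3, h2, sub_div, ← hkappa, mul_div_cancel_left₀ _ hκ]
      module
  have hh1 : ∀ z, |κ * h z| ≤ 1 := fun z => by
    by_cases hz : h z = 0
    · simp [hz]
    · obtain ⟨x, -, -, h2⟩ := hkw.exists_of_ne_zero' hwh hz
      rw [h2, mul_neg, abs_neg]
      exact hk1 x
  have key : κ • k + κ • shift (b • ℓ) h = G ∘ Φ - G := by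
    funext y
    obtain ⟨q, hq⟩ : ∃ q, q = k y + h (y - b • ℓ) := ⟨_, rfl⟩
    have hq1 : |κ * q| ≤ 1 := by
      by_cases hy : k y = 0
      · rw [hq, hy, zero_add]
        exact hh1 _
      · have : h (y - b • ℓ) = 0 := by
          by_contra h'
          exact hdisj y (hkR _ hy) (hhR _ h')
        rw [hq, this, add_zero]
        exact hk1 y
    have hwq : w (y + q • e) - w (y + q • e - b • ℓ) = -q := by
      by_cases hy : k y = 0
      · rw [hy, zero_add] at hq
        have h1 := hwh.2 (y - b • ℓ)
        simp only [Pi.neg_apply, ← hq, neg_inj, sub_add_eq_add_sub] at h1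
        rw [h1]
        by_cases h2 : w (y + q • e) = 0
        · rw [h2, zero_sub]
        · exfalso
          have h3 := hwR _ h2
          simp only [PiLp.add_apply, PiLp.smul_apply, hej, smul_zero, add_zero] at h3
          have h4 : q = 0 := by
            rw [hq]
            by_contra h'
            exact hdisj y h3 (hhR _ h')
          have h5 := hkw.1 y
          rw [hy, zero_smul, neg_zero] at h5
          rw [h4, zero_smul] at h2
          exact h2 h5
      · have h1 := hkR _ hy
        have h2 : h (y - b • ℓ) = 0 := by
          by_contra h'
          exact hdisj y h1 (hhR _ h')
        rw [h2, add_zero] at hq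
        have h3 : w (y + q • e - b • ℓ) = 0 := by
          by_contra h'
          exact hdisj (y + q • e) (by simpa [hej] using h1) (hwR _ h')
        rw [h3, sub_zero, hq, hkw.1]
    have hΦy : Φ y = y + q • e + v (y + q • e) • ℓ := by
      have h1 := hΦx (y + q • e)
      simp only [Pi.sub_apply, shift] at h1
      rw [hwq] at h1
      rw [← h1]
      congr 1
      module
    have hfin : G (Φ y) = G y + κ * q := by
      by_cases hy : near y
      · obtain ⟨x, a, s, h1, h2, h3, h4⟩ := hy
        have h5 := hGk x h1 a s (by linarith) (by linarith)
        have h6 := hGk x h1 (a + κ * q) (s + v (y + q • e))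
          (by linarith [abs_add_le a (κ * q)])
          (by linarith [abs_add_le s (v (y + q • e)), hvb' (y + q • e)])
        rw [← h4] at h5
        rw [h5, hΦy, add_assoc (G x), ← h6]
        congr 1
        rw [add_div, mul_div_cancel_left₀ _ hκ]
        generalize v (y + q • e) = v'
        rw [h4]
        module
      · have h1 : k y = 0 := by
          by_contra h'
          exact hy (near_k y h')
        have h2 : h (y - b • ℓ) = 0 := by
          by_contra h'
          exact hy (near_h y h')
        have h3 : v y = 0 := by
          by_contra h'
          exact hy (near_v y h')
        rw [h1, h2, add_zero] at hq
        rw [hΦy, hq]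
        simp [h3]
    simp only [Pi.add_apply, Pi.smul_apply, smul_eq_mul, shift, Pi.sub_apply, Function.comp, hfin,
      hq]
    ring
  rw [key]
  have h1 := hN.sub_le (hG.comp hΦ) hG
  rw [hN.comp hG hΦ] at h1
  linarith

theorem IsInvariantSeminorm.sub_shift_le_of_affine {N : (EuclideanSpace ℝ (Fin d) → ℝ) → ℝ}
    (hN : IsInvariantSeminorm N) {j : Fin d} (hej : e j = 0) (hℓj : ℓ j = 1) {κ R : ℝ}
    (hκ : κ ≠ 0) (hR : 0 < R) (hf : IsTest f)
    (hf' : ∀ x, |dirDeriv e f x| ≤ |κ| / 3) (hfR : ∀ x, f x ≠ 0 → |x j| ≤ R)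
    (hf1 : ∀ x, |f x| ≤ 1) (hG : IsTest G)
    (hGf : ∀ x, f x ≠ 0 → ∀ a s : ℝ, |a| ≤ 3 → |s| ≤ 30 * R →
      G (x + (a / κ) • e + s • ℓ) = G x + a) {t : ℝ} (ht : |t| ≤ R) :
    N (f - shift (t • ℓ) f) ≤ 4 * N G := by
  have hκ' : 0 < |κ| := abs_pos.2 hκ
  set k := κ⁻¹ • f with hkdef
  have hk : IsTest k := hf.const_smul _
  have hkf : κ • k = f := smul_inv_smul₀ hκ f
  have hkf' : ∀ x, κ * k x = f x := fun x => congrFun hkf x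
  have hk0 : ∀ x, k x ≠ 0 → f x ≠ 0 := fun x hx h => hx (by simp [hkdef, h])
  have hk3 : ∀ x, |dirDeriv e k x| ≤ 1 / 3 := fun x => by
    rw [hkdef, dirDeriv_const_smul hf, Pi.smul_apply, smul_eq_mul, abs_mul, abs_inv,
      inv_mul_le_iff₀ hκ']
    linarith [hf' x]
  obtain ⟨w, hw, hkw⟩ := exists_shearInverse (e := e) hk fun x => (hk3 x).trans (by norm_num)
  have hw2 := hkw.dirDeriv_le hk hw hk3
  obtain ⟨h, hh, hwh⟩ := exists_shearInverse (e := e) hw.neg fun x => by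
    have : -w = (-1 : ℝ) • w := by simp
    rw [this, dirDeriv_const_smul hw, Pi.smul_apply, smul_eq_mul, abs_mul, abs_neg, abs_one,
      one_mul]
    exact hw2 x
  have ht' := abs_le.1 ht
  have h1 := hN.le_of_affine (G := G) hej hℓj hκ (b := 10 * R) (R := R) (by linarith) (by linarith)
    hw hkw hwh hw2 (fun x hx => hfR x (hk0 x hx)) (fun x => by rw [hkf']; exact hf1 x) hG
    (fun x hx a s ha hs => hGf x (hk0 x hx) a s ha (by linarith))
  have h2 := hN.le_of_affine (G := G) hej hℓj hκ (b := 10 * R - t) (R := 2 * R) (by linarith)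
    (by linarith) (hw.shift (t • ℓ)) (hkw.shift (t • ℓ))
    (hwh.shift (t • ℓ)) (fun x => by rw [dirDeriv_shift]; exact hw2 _)
    (fun x hx => by
      have h3 := hfR _ (hk0 _ hx)
      simp only [PiLp.sub_apply, PiLp.smul_apply, hℓj, smul_eq_mul, mul_one] at h3
      rw [abs_le] at h3 ⊢
      constructor <;> linarith) (fun x => by simp only [shift, hkf']; exact hf1 _) hG
    (fun x hx a s ha hs => by
      have h3 := hk0 _ hx
      have h4 := hGf _ h3 a (s + t) ha (by
        have := abs_add_le s t
        linarith)
      have h5 := hGf _ h3 0 t (by simp) (by linarith)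
      simp only [zero_div, zero_smul, add_zero, sub_add_cancel] at h5
      rw [h5, ← h4]
      congr 1
      module)
  have h3 : f - shift (t • ℓ) f = (κ • k + κ • shift ((10 * R) • ℓ) h) -
      (κ • shift (t • ℓ) k + κ • shift ((10 * R - t) • ℓ) (shift (t • ℓ) h)) := by
    funext x
    have h4 : x - (10 * R - t) • ℓ - t • ℓ = x - (10 * R) • ℓ := by module
    simp only [Pi.sub_apply, Pi.add_apply, Pi.smul_apply, smul_eq_mul, shift, h4, hkf']
    ring
  rw [h3]
  have h4 := hN.sub_le ((hk.const_smul κ).add ((hh.shift ((10 * R) • ℓ)).const_smul κ))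
    (((hk.shift (t • ℓ)).const_smul κ).add
      (((hh.shift (t • ℓ)).shift ((10 * R - t) • ℓ)).const_smul κ))
  linarith

end ShearDisplacement

section Sawtooth

/-- A smooth bounded function with bounded derivative, the derivative being a sawtooth that is the
identity near zero modulo `2π`. -/
theorem exists_sawtooth : ∃ (S : ℝ → ℝ) (M : ℝ), ContDiff ℝ (⊤ : ℕ∞) S ∧ (∀ t, |S t| ≤ M) ∧
    (∀ t, |deriv S t| ≤ M) ∧
    ∀ (t : ℝ) (q : ℤ), |t - 2 * Real.pi * q| ≤ 1 / 2 → deriv S t = t - 2 * Real.pi * q := by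
  let χ : ContDiffBump (0 : ℝ) := ⟨6 / 10, 9 / 10, by norm_num, by norm_num⟩
  set P : ℝ → ℝ := fun u => χ u * (Real.arcsin u ^ 2 / 2) with hP
  have hPs : ContDiff ℝ (⊤ : ℕ∞) P := by
    rw [contDiff_iff_contDiffAt]
    intro u
    by_cases hu : |u| < 1
    · have h1 := abs_lt.1 hu
      exact χ.contDiff.contDiffAt.mul
        (((Real.contDiffAt_arcsin h1.1.ne' h1.2.ne).pow 2).div_const 2)
    · have : P =ᶠ[𝓝 u] fun _ => 0 := by
        have h2 : u ∉ tsupport χ := by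
          rw [χ.tsupport_eq]
          simp only [Metric.mem_closedBall, dist_zero_right, Real.norm_eq_abs, not_le]
          have : χ.rOut = 9 / 10 := rfl
          rw [this]
          linarith
        filter_upwards [(isClosed_tsupport χ).isOpen_compl.mem_nhds h2] with y hy
        simp [hP, image_eq_zero_of_notMem_tsupport hy]
      exact contDiffAt_const.congr_of_eventuallyEq this
  have hPc : HasCompactSupport P := χ.hasCompactSupport.mul_right
  obtain ⟨M₁, hM₁⟩ := hPc.exists_bound_of_continuous hPs.continuous
  obtain ⟨M₂, hM₂⟩ := hPc.deriv.exists_bound_of_continuous (hPs.continuous_deriv (by simp))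
  have hd : ∀ t, deriv (fun t => P (Real.sin t)) t = deriv P (Real.sin t) * Real.cos t := fun t =>
    (((hPs.differentiable (by simp)) _).hasDerivAt.comp t (Real.hasDerivAt_sin t)).deriv
  refine ⟨fun t => P (Real.sin t), max M₁ M₂, hPs.comp Real.contDiff_sin,
    fun t => (hM₁ _).trans (le_max_left _ _), fun t => ?_, fun t q ht => ?_⟩
  · rw [hd, abs_mul]
    calc |deriv P (Real.sin t)| * |Real.cos t| ≤ |deriv P (Real.sin t)| * 1 := by
          gcongr
          exact Real.abs_cos_le_one t
      _ ≤ max M₁ M₂ := by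
          rw [mul_one]
          exact (hM₂ _).trans (le_max_right _ _)
  · have hev : (fun t => P (Real.sin t)) =ᶠ[𝓝 t] fun s => (s - 2 * Real.pi * q) ^ 2 / 2 := by
      have hcont : Continuous fun s : ℝ => |s - 2 * Real.pi * q| := by fun_prop
      filter_upwards [hcont.continuousAt.eventually_lt continuousAt_const
        (show |t - 2 * Real.pi * q| < 6 / 10 by linarith)] with s hs
      have h1 : Real.sin s = Real.sin (s - 2 * Real.pi * q) := by
        rw [← Real.sin_sub_int_mul_two_pi s q]
        congr 1
        ring
      have h2 : |Real.sin (s - 2 * Real.pi * q)| ≤ 6 / 10 :=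
        Real.abs_sin_le_abs.trans hs.le
      have h3 := abs_lt.1 hs
      have h4 : χ (Real.sin (s - 2 * Real.pi * q)) = 1 :=
        χ.one_of_mem_closedBall (by simpa using h2)
      simp only [hP, h1, h4]
      rw [Real.arcsin_sin (by linarith [Real.pi_gt_three]) (by linarith [Real.pi_gt_three]), one_mul]
    rw [hev.deriv_eq]
    have h5 := (((hasDerivAt_id t).sub_const (2 * Real.pi * q)).pow 2).div_const 2
    refine h5.deriv.trans ?_
    simp

theorem Function.Periodic.exists_abs_le {f : ℝ → ℝ} (hf : Function.Periodic f 1)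
    (hc : Continuous f) : ∃ M, ∀ t, |f t| ≤ M := by
  obtain ⟨M, hM⟩ := isCompact_Icc.exists_bound_of_continuousOn (s := Icc (0 : ℝ) 1) hc.continuousOn
  refine ⟨M, fun t => ?_⟩
  obtain ⟨s, hs, hts⟩ := hf.exists_mem_Ico₀ one_pos t
  rw [hts]
  exact hM s ⟨hs.1, hs.2.le⟩

/-- A smooth partition of unity on the circle `ℝ / ℤ` by `K` bumps of width `2 / K`. -/
theorem exists_periodic_partition {K : ℕ} (hK : 2 ≤ K) :
    ∃ (φ : Fin K → ℝ → ℝ) (M : ℝ), (∀ c, ContDiff ℝ (⊤ : ℕ∞) (φ c)) ∧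
      (∀ c t, |φ c t| ≤ 1) ∧ (∀ t, ∑ c, φ c t = 1) ∧
      (∀ c t, φ c t ≠ 0 → ∃ q : ℤ, |t - (c : ℕ) / K - q| < 1 / K) ∧
      ∀ c t, |deriv (φ c) t| ≤ M := by
  have hK0 : (0 : ℝ) < K := by positivity
  have hK2 : (2 : ℝ) ≤ K := by exact_mod_cast hK
  have hpi := Real.pi_pos
  set B : ℝ → ℝ := fun t =>
    Real.smoothTransition (Real.cos (2 * Real.pi * t) - Real.cos (2 * Real.pi / K)) with hB
  have hBs : ContDiff ℝ (⊤ : ℕ∞) B := Real.smoothTransition.contDiff.comp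
    ((Real.contDiff_cos.comp (contDiff_const.mul contDiff_id)).sub contDiff_const)
  have hB0 : ∀ t, 0 ≤ B t := fun t => Real.smoothTransition.nonneg _
  have hBper : Function.Periodic B 1 := fun t => by
    simp only [hB]
    rw [mul_add, mul_one, Real.cos_add_two_pi]
  have hKpi : 2 * Real.pi / K ≤ Real.pi := by
    rw [div_le_iff₀ hK0]
    nlinarith
  have hBne : ∀ t, B t ≠ 0 → ∃ q : ℤ, |t - q| < 1 / K := fun t ht => by
    refine ⟨round t, ?_⟩
    by_contra! h
    refine ht (Real.smoothTransition.zero_of_nonpos (sub_nonpos.2 ?_))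
    have h1 : Real.cos (2 * Real.pi * t) = Real.cos (2 * Real.pi * |t - round t|) := by
      rw [← abs_of_pos (show (0 : ℝ) < 2 * Real.pi by positivity), ← abs_mul, Real.cos_abs,
        abs_of_pos (show (0 : ℝ) < 2 * Real.pi by positivity),
        ← Real.cos_sub_int_mul_two_pi _ (round t)]
      congr 1
      ring
    rw [h1]
    refine Real.cos_le_cos_of_nonneg_of_le_pi (by positivity) ?_ ?_
    · have := abs_sub_round t
      nlinarith
    · rw [div_eq_mul_one_div]
      gcongr
  have hBpos : ∀ t, ∃ c : Fin K, 0 < B (t - (c : ℕ) / K) := fun t => by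
    have hK1 : 0 < K := by omega
    obtain ⟨q, hq⟩ : ∃ q : ℤ, |t - q / K| ≤ 1 / (2 * K) := by
      refine ⟨round (t * K), ?_⟩
      have h1 := abs_sub_round (t * K)
      have h2 : t - round (t * K) / K = (t * K - round (t * K)) / K := by field_simp
      rw [h2, abs_div, abs_of_pos hK0, div_le_iff₀ hK0]
      have : 1 / (2 * (K : ℝ)) * K = 1 / 2 := by field_simp
      linarith
    have hKz : (0 : ℤ) < K := by exact_mod_cast hK1
    have hm0 := Int.emod_nonneg q hKz.ne'
    have hm1 := Int.emod_lt_of_pos q hKz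
    refine ⟨⟨(q % K).toNat, by omega⟩, ?_⟩
    have h3 : (((q % K).toNat : ℕ) : ℝ) = ((q % K : ℤ) : ℝ) := by
      exact_mod_cast congrArg (Int.cast (R := ℝ)) (Int.toNat_of_nonneg hm0)
    have h4 : (q : ℝ) = K * ((q / K : ℤ) : ℝ) + ((q % K : ℤ) : ℝ) := by
      exact_mod_cast (Int.mul_ediv_add_emod q K).symm
    have h5 : t - (q % K : ℤ) / K = (t - q / K) + ((q / K : ℤ) : ℝ) := by
      rw [h4]
      field_simp
      ring
    simp only [h3]
    have h7 : B ((t - q / K) + ((q / K : ℤ) : ℝ)) = B (t - q / K) := by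
      have := hBper.int_mul (q / K) (t - q / K)
      simpa using this
    rw [h5, h7]
    refine Real.smoothTransition.pos_of_pos (sub_pos.2 ?_)
    rw [← Real.cos_abs (2 * Real.pi * (t - q / K)), abs_mul, abs_of_pos (show (0 : ℝ) < 2 * Real.pi by positivity)]
    refine Real.cos_lt_cos_of_nonneg_of_le_pi (by positivity) hKpi ?_
    rw [div_eq_mul_one_div (2 * Real.pi)]
    refine mul_lt_mul_of_pos_left (hq.trans_lt ?_) (by positivity)
    exact one_div_lt_one_div_of_lt hK0 (by linarith)
  set Z : ℝ → ℝ := fun t => ∑ c : Fin K, B (t - (c : ℕ) / K) with hZ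
  have hZpos : ∀ t, 0 < Z t := fun t => by
    obtain ⟨c, hc⟩ := hBpos t
    exact Finset.sum_pos' (fun i _ => hB0 _) ⟨c, Finset.mem_univ _, hc⟩
  have hBcs : ∀ c : Fin K, ContDiff ℝ (⊤ : ℕ∞) fun t => B (t - (c : ℕ) / K) := fun c =>
    hBs.comp (contDiff_id.sub contDiff_const)
  have hZs : ContDiff ℝ (⊤ : ℕ∞) Z := ContDiff.sum fun c _ => hBcs c
  have hφs : ∀ c : Fin K, ContDiff ℝ (⊤ : ℕ∞) fun t => B (t - (c : ℕ) / K) / Z t := fun c =>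
    (hBcs c).div hZs fun t => (hZpos t).ne'
  have hper : ∀ c : Fin K, Function.Periodic (fun t => B (t - (c : ℕ) / K) / Z t) 1 := fun c t => by
    have h1 : ∀ c : Fin K, B (t + 1 - (c : ℕ) / K) = B (t - (c : ℕ) / K) := fun c => by
      rw [← hBper (t - (c : ℕ) / K)]
      congr 1
      ring
    simp only [hZ, h1]
  have hM : ∀ c : Fin K, ∃ M, ∀ t, |deriv (fun t => B (t - (c : ℕ) / K) / Z t) t| ≤ M := fun c => by
    refine Function.Periodic.exists_abs_le (fun t => ?_) ((hφs c).continuous_deriv (by simp))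
    rw [← deriv_comp_add_const]
    congr 1
    exact funext fun t => hper c t
  choose M hM using hM
  refine ⟨fun c t => B (t - (c : ℕ) / K) / Z t, ∑ c, |M c|, hφs, fun c t => ?_, fun t => ?_,
    fun c t h => ?_, fun c t => ?_⟩
  · rw [abs_of_nonneg (div_nonneg (hB0 _) (hZpos t).le), div_le_one (hZpos t)]
    exact Finset.single_le_sum (f := fun c : Fin K => B (t - (c : ℕ) / K)) (fun i _ => hB0 _)
      (Finset.mem_univ c)
  · rw [← Finset.sum_div, div_self (hZpos t).ne']
  · exact hBne _ fun h0 => h (by simp [h0])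
  · exact (hM c t).trans ((le_abs_self _).trans
      (Finset.single_le_sum (f := fun c => |M c|) (fun i _ => abs_nonneg _) (Finset.mem_univ c)))

end Sawtooth

section ShearedCoordinate

variable {d : ℕ} {f g : EuclideanSpace ℝ (Fin d) → ℝ} {e ℓ : EuclideanSpace ℝ (Fin d)}

theorem dirDeriv_comm (hf : IsTest f) (e ℓ : EuclideanSpace ℝ (Fin d)) :
    dirDeriv e (dirDeriv ℓ f) = dirDeriv ℓ (dirDeriv e f) := by
  have key : ∀ (u v x : EuclideanSpace ℝ (Fin d)),
      dirDeriv u (dirDeriv v f) x = fderiv ℝ (fderiv ℝ f) x u v := fun u v x => by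
    have h1 : DifferentiableAt ℝ (fderiv ℝ f) x :=
      (hf.1.fderiv_right (m := 1) (by
        rw [one_add_one_eq_two]
        exact WithTop.coe_le_coe.2 (le_top : (2 : ℕ∞) ≤ ⊤))).differentiable one_ne_zero x
    change fderiv ℝ (fun y => fderiv ℝ f y v) x u = _
    rw [fderiv_clm_apply h1 (differentiableAt_const v)]
    simp
  funext x
  rw [key, key]
  exact (hf.1.contDiffAt (x := x)).isSymmSndFDerivAt (by
    rw [minSmoothness_of_isRCLikeNormedField]
    exact WithTop.coe_le_coe.2 (le_top : (2 : ℕ∞) ≤ ⊤)) e ℓ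

theorem dirDeriv_mul (hf : Differentiable ℝ f) (hg : Differentiable ℝ g)
    (e : EuclideanSpace ℝ (Fin d)) : dirDeriv e (f * g) = f * dirDeriv e g + dirDeriv e f * g := by
  funext x
  simp [dirDeriv, fderiv_mul (hf x) (hg x), mul_comm]

theorem dirDeriv_comp_apply {p : ℝ → ℝ} (hp : Differentiable ℝ p) (i : Fin d)
    (e : EuclideanSpace ℝ (Fin d)) :
    dirDeriv e (fun x => p (x i)) = fun x => deriv p (x i) * e i := by
  funext x
  have h1 : HasFDerivAt (fun x : EuclideanSpace ℝ (Fin d) => x i)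
      (EuclideanSpace.proj (𝕜 := ℝ) i) x := (EuclideanSpace.proj (𝕜 := ℝ) i).hasFDerivAt
  have h2 := (hp (x i)).hasDerivAt.comp_hasFDerivAt x h1
  have h3 : fderiv ℝ (fun x : EuclideanSpace ℝ (Fin d) => p (x i)) x = _ := h2.fderiv
  simp [dirDeriv, h3]

theorem dirDeriv_comp_const_smul (hf : Differentiable ℝ f) (a : ℝ)
    (e : EuclideanSpace ℝ (Fin d)) :
    dirDeriv e (fun x => f (a • x)) = fun x => a * dirDeriv e f (a • x) := by
  funext x
  have h1 : HasFDerivAt (fun x : EuclideanSpace ℝ (Fin d) => a • x)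
      (a • ContinuousLinearMap.id ℝ (EuclideanSpace ℝ (Fin d))) x := (hasFDerivAt_id x).const_smul a
  have h3 : fderiv ℝ (fun x : EuclideanSpace ℝ (Fin d) => f (a • x)) x = _ :=
    ((hf (a • x)).hasFDerivAt.comp x h1).fderiv
  simp [dirDeriv, h3]

theorem dirDeriv_eq_zero_of_eventually_const {x : EuclideanSpace ℝ (Fin d)} {c : ℝ}
    (h : ∀ᶠ y in 𝓝 x, f y = c) (e : EuclideanSpace ℝ (Fin d)) : dirDeriv e f x = 0 := by
  have h1 : f =ᶠ[𝓝 x] fun _ => c := h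
  simp [dirDeriv, h1.fderiv_eq]

theorem contDiff_comp_apply {p : ℝ → ℝ} (hp : ContDiff ℝ (⊤ : ℕ∞) p) (i : Fin d) :
    ContDiff ℝ (⊤ : ℕ∞) fun x : EuclideanSpace ℝ (Fin d) => p (x i) :=
  hp.comp (EuclideanSpace.proj (𝕜 := ℝ) i).contDiff

/-- Cut-off functions with small first and second derivatives. -/
theorem exists_flat_cutoff (e ℓ : EuclideanSpace ℝ (Fin d)) (r : ℝ) {ε : ℝ} (hε : 0 < ε) :
    ∃ Θ : EuclideanSpace ℝ (Fin d) → ℝ, IsTest Θ ∧ (∀ x, ‖x‖ < r → Θ x = 1) ∧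
      (∀ x, |Θ x| ≤ 1) ∧ (∀ x, |dirDeriv e Θ x| ≤ ε) ∧
      ∀ x, |dirDeriv ℓ (dirDeriv e Θ) x| ≤ ε := by
  let θ : ContDiffBump (0 : EuclideanSpace ℝ (Fin d)) := ⟨1, 2, one_pos, one_lt_two⟩
  have hθ : IsTest (θ : EuclideanSpace ℝ (Fin d) → ℝ) := ⟨θ.contDiff, θ.hasCompactSupport⟩
  obtain ⟨A, hA0, hA⟩ := (hθ.dirDeriv e).exists_bound
  obtain ⟨B, hB0, hB⟩ := ((hθ.dirDeriv e).dirDeriv ℓ).exists_bound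
  set L : ℝ := max (max 1 r) ((A + B) / ε) with hL
  have hL1 : 1 ≤ L := (le_max_left _ _).trans (le_max_left _ _)
  have hLr : r ≤ L := (le_max_right _ _).trans (le_max_left _ _)
  have hLε : (A + B) / ε ≤ L := le_max_right _ _
  have hL0 : 0 < L := by linarith
  rw [div_le_iff₀ hε] at hLε
  have h1 : dirDeriv e (fun x => θ (L⁻¹ • x)) = fun x => L⁻¹ * dirDeriv e θ (L⁻¹ • x) :=
    dirDeriv_comp_const_smul hθ.differentiable _ e
  have h2 : dirDeriv ℓ (dirDeriv e fun x => θ (L⁻¹ • x)) =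
      fun x => L⁻¹ * (L⁻¹ * dirDeriv ℓ (dirDeriv e θ) (L⁻¹ • x)) := by
    have h3 : (fun x => L⁻¹ * dirDeriv e θ (L⁻¹ • x)) =
        fun x => (L⁻¹ • dirDeriv e θ) (L⁻¹ • x) := rfl
    rw [h1, h3, dirDeriv_comp_const_smul ((hθ.dirDeriv e).const_smul _).differentiable,
      dirDeriv_const_smul (hθ.dirDeriv e)]
    rfl
  have hinv : L⁻¹ ≤ 1 := inv_le_one_of_one_le₀ hL1
  refine ⟨fun x => θ (L⁻¹ • x), IsTest.of_radius (R := 2 * L)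
    (hθ.1.comp (contDiff_const_smul _)) fun x hx => ?_, fun x hx => ?_, fun x => ?_,
    fun x => ?_, fun x => ?_⟩
  · by_contra! h
    refine hx (θ.zero_of_le_dist ?_)
    rw [dist_zero_right, norm_smul, norm_inv, Real.norm_of_nonneg hL0.le, le_inv_mul_iff₀ hL0]
    change L * 2 ≤ _
    linarith
  · refine θ.one_of_mem_closedBall ?_
    rw [mem_closedBall_zero_iff, norm_smul, norm_inv, Real.norm_of_nonneg hL0.le,
      inv_mul_le_iff₀ hL0]
    change _ ≤ L * 1
    linarith
  · rw [abs_of_nonneg θ.nonneg]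
    exact θ.le_one
  · rw [h1, abs_mul, abs_of_pos (inv_pos.2 hL0), inv_mul_le_iff₀ hL0]
    nlinarith [hA (L⁻¹ • x)]
  · rw [h2, abs_mul, abs_mul, abs_of_pos (inv_pos.2 hL0), inv_mul_le_iff₀ hL0]
    have h4 := mul_le_mul hinv (hB (L⁻¹ • x)) (abs_nonneg _) zero_le_one
    nlinarith

/-- The coordinate `x_j`, sheared by a fast oscillating function of `x_i`, agrees on a given ball
with functions of uniformly bounded norm. -/
theorem IsInvariantSeminorm.exists_sheared_coordinate {N : (EuclideanSpace ℝ (Fin d) → ℝ) → ℝ}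
    (hN : IsInvariantSeminorm N) {i j : Fin d} (hij : i ≠ j) {S : ℝ → ℝ}
    (hS : ContDiff ℝ (⊤ : ℕ∞) S) {M : ℝ} (hSM : ∀ t, |S t| ≤ M) (hSM' : ∀ t, |deriv S t| ≤ M)
    {D : ℝ} (hD : 0 < D) (r : ℝ) :
    ∃ C, ∀ κ : ℝ, 1 ≤ |κ| → ∀ c : ℝ, ∃ G, IsTest G ∧ N G ≤ C ∧
      ∀ x, ‖x‖ < r → G x = x j + D * deriv S (κ * x i / D - c) := by
  have hM : 0 ≤ M := (abs_nonneg _).trans (hSM 0)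
  set ei := EuclideanSpace.single i (1 : ℝ) with hei
  set ej := EuclideanSpace.single j (1 : ℝ) with hej
  have heii : ei i = 1 := by simp [hei]
  have heji : ej i = 0 := by simp [hej, hij]
  have hejj : ej j = 1 := by simp [hej]
  have hejn : ‖ej‖ = 1 := by simp [hej]
  set ε : ℝ := 1 / (2 * (D * M + D ^ 2 * M + 1)) with hε
  have hden : 0 < D * M + D ^ 2 * M + 1 := by positivity
  have hε0 : 0 < ε := by positivity
  obtain ⟨Θ, hΘ, hΘ1, -, hΘ2, hΘ3⟩ := exists_flat_cutoff ej ei r hε0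
  obtain ⟨F₀, hF₀, hF₁, -⟩ := exists_flat_cutoff ej ei (r + D * M) one_pos
  have hF : IsTest ((fun x : EuclideanSpace ℝ (Fin d) => x j) * F₀) :=
    hF₀.mul_left (contDiff_comp_apply contDiff_id j)
  refine ⟨N ((fun x : EuclideanSpace ℝ (Fin d) => x j) * F₀), fun κ hκ c => ?_⟩
  have hκ0 : κ ≠ 0 := fun h => by norm_num [h] at hκ
  set p : ℝ → ℝ := fun t => D ^ 2 / κ * S (κ * t / D - c) with hp
  have hps : ContDiff ℝ (⊤ : ℕ∞) p := contDiff_const.mul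
    (hS.comp (((contDiff_const.mul contDiff_id).div_const D).sub contDiff_const))
  have hpd : Differentiable ℝ p := hps.differentiable (by simp)
  have hp' : ∀ t, deriv p t = D * deriv S (κ * t / D - c) := fun t => by
    have h1 : HasDerivAt (fun t => κ * t / D - c) (κ * 1 / D) t :=
      (((hasDerivAt_id t).const_mul κ).div_const D).sub_const c
    have h2 := (((hS.differentiable (by simp)) (κ * t / D - c)).hasDerivAt.comp t h1).const_mul
      (D ^ 2 / κ)
    refine h2.deriv.trans ?_
    field_simp
  have hpM : ∀ t, |p t| ≤ D ^ 2 * M := fun t => by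
    rw [hp, abs_mul, abs_div, abs_of_pos (by positivity : 0 < D ^ 2)]
    exact mul_le_mul (div_le_self (by positivity) hκ) (hSM _) (abs_nonneg _) (by positivity)
  have hpM' : ∀ t, |deriv p t| ≤ D * M := fun t => by
    rw [hp', abs_mul, abs_of_pos hD]
    exact mul_le_mul_of_nonneg_left (hSM' _) hD.le
  set P : EuclideanSpace ℝ (Fin d) → ℝ := fun x => p (x i) with hP
  have hPs : ContDiff ℝ (⊤ : ℕ∞) P := contDiff_comp_apply hps i
  have hPd : Differentiable ℝ P := hPs.differentiable (by simp)
  have hPi : dirDeriv ei P = fun x => deriv p (x i) := by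
    rw [hP, dirDeriv_comp_apply hpd]
    simp [heii]
  have hPj : dirDeriv ej P = 0 := by
    rw [hP, dirDeriv_comp_apply hpd]
    simp only [heji, mul_zero]
    rfl
  have hW : IsTest (P * Θ) := hΘ.mul_left hPs
  have hw : dirDeriv ej (P * Θ) = P * dirDeriv ej Θ := by
    rw [dirDeriv_mul hPd hΘ.differentiable, hPj, zero_mul, add_zero]
  have hv : dirDeriv ei (P * Θ) = P * dirDeriv ei Θ + (fun x => deriv p (x i)) * Θ := by
    rw [dirDeriv_mul hPd hΘ.differentiable, hPi]
  have hw' : ∀ x, |dirDeriv ei (dirDeriv ej (P * Θ)) x| ≤ 1 / 2 := fun x => by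
    rw [hw, dirDeriv_mul hPd (hΘ.dirDeriv ej).differentiable, hPi]
    simp only [Pi.add_apply, Pi.mul_apply]
    refine (abs_add_le _ _).trans ?_
    rw [abs_mul (P x), abs_mul (deriv p (x i))]
    have h1 := mul_le_mul (hpM (x i)) (hΘ3 x) (abs_nonneg _) (by positivity)
    have h2 := mul_le_mul (hpM' (x i)) (hΘ2 x) (abs_nonneg _) (by positivity)
    have h3 : (D * M + D ^ 2 * M + 1) * ε = 1 / 2 := by
      rw [hε]
      field_simp
    have h4 : |P x| = |p (x i)| := rfl
    rw [h4]
    linarith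
  obtain ⟨Φ, hΦ, hΦx⟩ := exists_volDiffeo_of_dirDeriv_eq (hW.dirDeriv ej) (hW.dirDeriv ei) hw'
    (dirDeriv_comm hW ei ej)
  refine ⟨_, hF.comp hΦ, (hN.comp hF hΦ).le, fun x hx => ?_⟩
  have hev : ∀ᶠ y in 𝓝 x, Θ y = 1 := by
    filter_upwards [continuous_norm.isOpen_preimage _ isOpen_Iio |>.mem_nhds hx] with y hy
    exact hΘ1 y hy
  have h1 := hΦx x
  rw [hw, hv] at h1
  simp only [Pi.add_apply, Pi.mul_apply, dirDeriv_eq_zero_of_eventually_const hev, mul_zero,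
    zero_smul, add_zero, zero_add, hΘ1 x hx, mul_one] at h1
  simp only [Function.comp_apply, h1, Pi.mul_apply]
  rw [hF₁, mul_one, ← hp']
  · simp [hejj]
  · refine (norm_add_le _ _).trans_lt ?_
    rw [norm_smul, hejn, mul_one]
    exact add_lt_add_of_lt_of_le hx (hpM' _)

end ShearedCoordinate

section Translation

variable {d : ℕ} {f : EuclideanSpace ℝ (Fin d) → ℝ}
  {N : (EuclideanSpace ℝ (Fin d) → ℝ) → ℝ}

theorem shift_sum {ι : Type*} (s : Finset ι) (F : ι → EuclideanSpace ℝ (Fin d) → ℝ)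
    (v : EuclideanSpace ℝ (Fin d)) : shift v (∑ a ∈ s, F a) = ∑ a ∈ s, shift v (F a) := by
  funext x
  simp [shift]

theorem norm_single_sub_inv_smul_le {i j : Fin d} {κ : ℝ} (hκ : 1 ≤ |κ|) :
    ‖EuclideanSpace.single j (1 : ℝ) - κ⁻¹ • EuclideanSpace.single i (1 : ℝ)‖ ≤ 2 := by
  refine (norm_sub_le _ _).trans ?_
  have : |κ|⁻¹ ≤ 1 := inv_le_one_of_one_le₀ hκ
  simp [norm_smul]
  linarith

/-- A function oscillating at most at frequency `κ` in the direction `e_i` can be moved along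
`e_j - e_i / κ` at bounded cost. -/
theorem IsInvariantSeminorm.exists_sub_shift_oblique_le (hN : IsInvariantSeminorm N) {i j : Fin d}
    (hij : i ≠ j) {R : ℝ} (hR : 0 < R) :
    ∃ C, ∀ κ : ℝ, 1 ≤ |κ| → ∀ f, IsTest f → (∀ x, f x ≠ 0 → ‖x‖ ≤ R) → (∀ x, |f x| ≤ 1) →
      (∀ x, |dirDeriv (EuclideanSpace.single i (1 : ℝ)) f x| ≤ |κ| / 6) → ∀ t : ℝ, |t| ≤ R →
      N (f - shift (t • (EuclideanSpace.single j (1 : ℝ) -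
        κ⁻¹ • EuclideanSpace.single i (1 : ℝ))) f) ≤ C := by
  obtain ⟨S, M, hS, hSM, hSM', hSq⟩ := exists_sawtooth
  obtain ⟨φ, M', hφs, hφ1, hφsum, hφq, hφM'⟩ := exists_periodic_partition (K := 32) (by norm_num)
  have hpi := Real.pi_gt_three
  have hpi4 := Real.pi_le_four
  set D : ℝ := |M'| + 4 * (3 + 30 * R) with hD
  have hDM : |M'| ≤ D := by linarith
  have hDR : 4 * (3 + 30 * R) ≤ D := by linarith [abs_nonneg M']
  have hD0 : 0 < D := by linarith
  obtain ⟨C, hC⟩ := hN.exists_sheared_coordinate hij hS hSM hSM' hD0 (61 * R + 4)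
  refine ⟨∑ _c : Fin 32, 4 * C, fun κ hκ f hf hfR hf1 hf' t ht => ?_⟩
  have hκ0 : κ ≠ 0 := fun h => by norm_num [h] at hκ
  set ei := EuclideanSpace.single i (1 : ℝ) with hei
  set ej := EuclideanSpace.single j (1 : ℝ) with hej
  have heii : ei i = 1 := by simp [hei]
  have heij : ei j = 0 := by simp [hei, hij.symm]
  have heji : ej i = 0 := by simp [hej, hij]
  have hejj : ej j = 1 := by simp [hej]
  set ℓ := ej - κ⁻¹ • ei with hℓ
  have hℓn : ‖ℓ‖ ≤ 2 := norm_single_sub_inv_smul_le hκ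
  set ψ : Fin 32 → ℝ → ℝ := fun c t => φ c (κ / (2 * Real.pi * D) * t) with hψ
  have hψs : ∀ c, ContDiff ℝ (⊤ : ℕ∞) (ψ c) := fun c =>
    (hφs c).comp (contDiff_const.mul contDiff_id)
  have hψ' : ∀ c t, |deriv (ψ c) t| ≤ |κ| / 6 := fun c t => by
    have h1 : HasDerivAt (fun t => κ / (2 * Real.pi * D) * t) (κ / (2 * Real.pi * D) * 1) t :=
      (hasDerivAt_id t).const_mul _
    have h2 := (((hφs c).differentiable (by simp)) (κ / (2 * Real.pi * D) * t)).hasDerivAt.comp t h1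
    have h3 : deriv (ψ c) t = _ := h2.deriv
    rw [h3, mul_one, abs_mul, abs_div, abs_of_pos (by positivity : 0 < 2 * Real.pi * D),
      mul_div_assoc', div_le_div_iff₀ (by positivity) (by norm_num)]
    have h4 : |deriv (φ c) (κ / (2 * Real.pi * D) * t)| ≤ D :=
      (hφM' c _).trans ((le_abs_self _).trans hDM)
    have h5 := mul_le_mul_of_nonneg_right h4 (abs_nonneg κ)
    have h6 : 0 ≤ |κ| * D := by positivity
    nlinarith
  set F : Fin 32 → EuclideanSpace ℝ (Fin d) → ℝ := fun c => (fun x => ψ c (x i)) * f with hF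
  have hFt : ∀ c, IsTest (F c) := fun c => hf.mul_left (contDiff_comp_apply (hψs c) i)
  have hFf : ∀ c x, F c x ≠ 0 → f x ≠ 0 := fun c x hx => right_ne_zero_of_mul hx
  have hsum : f = ∑ c, F c := by
    funext x
    simp [hF, hψ, ← Finset.sum_mul, hφsum]
  have key : ∀ c, N (F c - shift (t • ℓ) (F c)) ≤ 4 * C := fun c => by
    obtain ⟨G, hG, hGC, hGx⟩ := hC κ hκ (2 * Real.pi * ((c : ℕ) / (32 : ℕ)))
    refine (hN.sub_shift_le_of_affine (e := ei) (ℓ := ℓ) (G := G) heij (by simp [hℓ, heij, hejj])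
      hκ0 hR (hFt c) (fun x => ?_) (fun x hx => ?_) (fun x => ?_) hG (fun x hx a s ha hs => ?_)
      ht).trans (by linarith)
    · have h1 : dirDeriv ei (F c) x = ψ c (x i) * dirDeriv ei f x + deriv (ψ c) (x i) * f x := by
        rw [hF, dirDeriv_mul (contDiff_comp_apply (hψs c) i |>.differentiable (by simp))
          hf.differentiable, dirDeriv_comp_apply ((hψs c).differentiable (by simp))]
        simp [heii]
      rw [h1]
      refine (abs_add_le _ _).trans ?_
      rw [abs_mul, abs_mul]
      have h2 := mul_le_mul (hφ1 c (κ / (2 * Real.pi * D) * x i)) (hf' x) (abs_nonneg _) zero_le_one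
      have h3 := mul_le_mul (hψ' c (x i)) (hf1 x) (abs_nonneg _) (by positivity)
      have h4 : |ψ c (x i)| = |φ c (κ / (2 * Real.pi * D) * x i)| := rfl
      rw [h4]
      linarith
    · exact (PiLp.norm_apply_le x j).trans (hfR x (hFf c x hx))
    · simp only [hF, Pi.mul_apply, abs_mul]
      exact mul_le_one₀ (hφ1 _ _) (abs_nonneg _) (hf1 x)
    · obtain ⟨q, hq⟩ := hφq c _ (left_ne_zero_of_mul hx)
      have hxR := hfR x (hFf c x hx)
      have hq' : |κ * x i / D - 2 * Real.pi * ((c : ℕ) / (32 : ℕ)) - 2 * Real.pi * q| ≤ 1 / 4 := by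
        have h1 : κ * x i / D - 2 * Real.pi * ((c : ℕ) / (32 : ℕ)) - 2 * Real.pi * q =
            2 * Real.pi * (κ / (2 * Real.pi * D) * x i - (c : ℕ) / (32 : ℕ) - q) := by
          field_simp
        rw [h1, abs_mul, abs_of_pos (by positivity : 0 < 2 * Real.pi)]
        have h2 := mul_le_mul_of_nonneg_left hq.le (by positivity : 0 ≤ 2 * Real.pi)
        refine h2.trans ?_
        push_cast
        linarith
      have has : |(a - s) / D| ≤ 1 / 4 := by
        rw [abs_div, abs_of_pos hD0, div_le_iff₀ hD0]
        have := abs_sub a s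
        linarith
      have hy : ‖x + (a / κ) • ei + s • ℓ‖ < 61 * R + 4 := by
        have h1 : ‖(a / κ) • ei‖ ≤ 3 := by
          rw [norm_smul, hei, PiLp.norm_single, norm_one, mul_one, Real.norm_eq_abs,
            abs_div]
          exact (div_le_self (abs_nonneg _) hκ).trans ha
        have h2 : ‖s • ℓ‖ ≤ 60 * R := by
          rw [norm_smul, Real.norm_eq_abs]
          have := mul_le_mul hs hℓn (norm_nonneg _) (by positivity)
          linarith
        have h3 := norm_add₃_le (a := x) (b := (a / κ) • ei) (c := s • ℓ)
        linarith
      rw [hGx _ hy, hGx x (by linarith)]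
      have h1 : (x + (a / κ) • ei + s • ℓ) j = x j + s := by simp [hℓ, heij, hejj]
      have h2 : κ * (x + (a / κ) • ei + s • ℓ) i / D - 2 * Real.pi * ((c : ℕ) / (32 : ℕ)) =
          κ * x i / D - 2 * Real.pi * ((c : ℕ) / (32 : ℕ)) + (a - s) / D := by
        simp only [hℓ, PiLp.add_apply, PiLp.smul_apply, PiLp.sub_apply, heii, heji, smul_eq_mul]
        field_simp
        ring
      rw [h1, h2, hSq _ q, hSq _ q]
      · field_simp
        ring
      · linarith
      · rw [abs_le] at hq' has ⊢
        constructor <;> linarith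
  have h1 : f - shift (t • ℓ) f = ∑ c, (F c - shift (t • ℓ) (F c)) := by
    rw [Finset.sum_sub_distrib, ← shift_sum, ← hsum]
  rw [h1]
  exact (hN.sum_le fun c _ => (hFt c).sub ((hFt c).shift _)).trans
    (Finset.sum_le_sum fun c _ => key c)

/-- Bounded translations along a coordinate axis cost at most the sup norm. -/
theorem IsInvariantSeminorm.exists_sub_shift_le (hN : IsInvariantSeminorm N) {i j : Fin d}
    (hij : i ≠ j) {R : ℝ} (hR : 0 < R) :
    ∃ C, 0 ≤ C ∧ ∀ f, IsTest f → (∀ x, f x ≠ 0 → ‖x‖ ≤ R) → ∀ B : ℝ, (∀ x, |f x| ≤ B) →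
      ∀ t : ℝ, |t| ≤ R → N (f - shift (t • EuclideanSpace.single j (1 : ℝ)) f) ≤ C * B := by
  obtain ⟨C, hC⟩ := hN.exists_sub_shift_oblique_le hij (R := 3 * R) (by linarith)
  have unit : ∀ f, IsTest f → (∀ x, f x ≠ 0 → ‖x‖ ≤ R) → (∀ x, |f x| ≤ 1) → ∀ t : ℝ, |t| ≤ R →
      N (f - shift (t • EuclideanSpace.single j (1 : ℝ)) f) ≤ |C| + |C| := fun f hf hfR hf1 t ht => by
    set ei := EuclideanSpace.single i (1 : ℝ) with hei
    set ej := EuclideanSpace.single j (1 : ℝ) with hej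
    obtain ⟨A, hA0, hA⟩ := (hf.dirDeriv ei).exists_bound
    set κ : ℝ := max 1 (6 * A) with hκ
    have hκ1 : 1 ≤ |κ| := (le_max_left _ _).trans (le_abs_self _)
    have hκA : A ≤ |κ| / 6 := by
      have := (le_max_right 1 (6 * A)).trans (le_abs_self κ)
      linarith
    have ht2 : |t / 2| ≤ 3 * R := by
      rw [abs_div, abs_two]
      linarith [abs_nonneg t]
    have h1 := hC κ hκ1 f hf (fun x hx => (hfR x hx).trans (by linarith)) hf1
      (fun x => (hA x).trans hκA) (t / 2) ht2
    set g := shift ((t / 2) • (ej - κ⁻¹ • ei)) f with hg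
    have hgt : IsTest g := hf.shift _
    have h2 := hC (-κ) (by rwa [abs_neg]) g hgt (fun x hx => ?_) (fun x => hf1 _) (fun x => ?_)
      (t / 2) ht2
    · have h3 : f - shift (t • ej) f =
          (f - g) + (g - shift ((t / 2) • (ej - (-κ)⁻¹ • ei)) g) := by
        funext x
        have h4 : x - (t / 2) • (ej - (-κ)⁻¹ • ei) - (t / 2) • (ej - κ⁻¹ • ei) = x - t • ej := by
          rw [inv_neg]
          module
        simp only [Pi.sub_apply, Pi.add_apply, hg, shift, h4]
        ring
      rw [h3]
      refine (hN.add_le (hf.sub hgt) (hgt.sub (hgt.shift _))).trans (add_le_add ?_ ?_)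
      · exact h1.trans (le_abs_self C)
      · exact h2.trans (le_abs_self C)
    · have h3 := hfR _ hx
      have h4 : ‖(t / 2) • (ej - κ⁻¹ • ei)‖ ≤ R := by
        rw [norm_smul, Real.norm_eq_abs, abs_div, abs_two]
        have := mul_le_mul (div_le_div_of_nonneg_right ht zero_le_two)
          (norm_single_sub_inv_smul_le (i := i) (j := j) hκ1) (norm_nonneg _) (by linarith)
        linarith
      have h5 := norm_le_norm_add_norm_sub' x ((t / 2) • (ej - κ⁻¹ • ei))
      linarith
    · rw [hg, dirDeriv_shift, abs_neg]
      exact (hA _).trans hκA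
  refine ⟨|C| + |C|, by positivity, fun f hf hfR B hB t ht => ?_⟩
  rcases ((abs_nonneg _).trans (hB 0)).eq_or_lt with h0 | h0
  · have hf0 : f = 0 := by
      funext x
      have := hB x
      rw [← h0] at this
      exact abs_nonpos_iff.1 this
    have h1 : f - shift (t • EuclideanSpace.single j (1 : ℝ)) f = 0 := by
      rw [hf0]
      funext x
      simp [shift]
    rw [h1, hN.map_zero, ← h0, mul_zero]
  · have h1 := unit (B⁻¹ • f) (hf.const_smul _) (fun x hx => hfR x (right_ne_zero_of_mul hx))
      (fun x => ?_) t ht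
    · have h2 : f - shift (t • EuclideanSpace.single j (1 : ℝ)) f =
          B • (B⁻¹ • f - shift (t • EuclideanSpace.single j (1 : ℝ)) (B⁻¹ • f)) := by
        funext x
        simp only [Pi.sub_apply, Pi.smul_apply, smul_eq_mul, shift]
        field_simp
      rw [h2, hN.smul _ ((hf.const_smul _).sub ((hf.const_smul _).shift _)), abs_of_pos h0, mul_comm]
      exact mul_le_mul_of_nonneg_right h1 h0.le
    · rw [Pi.smul_apply, smul_eq_mul, abs_mul, abs_inv, abs_of_pos h0, inv_mul_le_iff₀ h0, mul_one]
      exact hB x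

end Translation

section SmallDivisors

theorem one_div_le_abs_mul_sqrt_two_sub (n : ℕ) (hn : 1 ≤ n) (m : ℤ) (hm : |n * √2 - m| ≤ 1 / 2) :
    1 / (4 * n) ≤ |n * √2 - m| := by
  have hn1 : (1 : ℝ) ≤ n := by exact_mod_cast hn
  have h2 : √2 * √2 = 2 := Real.mul_self_sqrt (by norm_num)
  have h3 : √2 ≤ 3 / 2 := by
    rw [Real.sqrt_le_left (by norm_num)]
    norm_num
  have h4 : 1 ≤ √2 := Real.one_le_sqrt.2 (by norm_num)
  have h5 : (1 : ℝ) ≤ |(2 * n ^ 2 - m ^ 2 : ℝ)| := by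
    have h6 : (2 * n ^ 2 - m ^ 2 : ℤ) ≠ 0 := fun h => by
      have h7 : Irrational √2 := irrational_sqrt_two
      refine h7 ⟨|(m : ℚ)| / n, ?_⟩
      have h8 : ((m : ℝ)) ^ 2 = 2 * n ^ 2 := by exact_mod_cast (sub_eq_zero.1 h).symm
      push_cast
      rw [eq_comm, Real.sqrt_eq_iff_mul_self_eq (by norm_num) (by positivity)]
      rw [div_mul_div_comm, abs_mul_abs_self, ← pow_two, ← pow_two, h8]
      field_simp
    exact_mod_cast Int.one_le_abs h6
  have h6 : (2 * n ^ 2 - m ^ 2 : ℝ) = (n * √2 - m) * (n * √2 + m) := by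
    nlinarith
  rw [h6, abs_mul] at h5
  have h7 : |n * √2 + m| ≤ 4 * n := by
    have h8 := abs_le.1 hm
    have h9 : (n : ℝ) * √2 ≤ n * (3 / 2) := by gcongr
    rw [abs_le]
    constructor <;> nlinarith
  rw [div_le_iff₀ (by positivity)]
  exact h5.trans (by gcongr)

theorem one_div_le_abs_sin_mul_sqrt_two (n : ℕ) (hn : 1 ≤ n) :
    1 / (2 * n) ≤ |Real.sin (Real.pi * n * √2)| := by
  have hpi := Real.pi_pos
  set m := round (n * √2) with hm
  have h1 : |n * √2 - m| ≤ 1 / 2 := abs_sub_round _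
  have h2 := one_div_le_abs_mul_sqrt_two_sub n hn m h1
  have h3 : |Real.sin (Real.pi * n * √2)| = |Real.sin (Real.pi * |n * √2 - m|)| := by
    rw [← abs_of_pos hpi, ← abs_mul, abs_of_pos hpi]
    have h4 : Real.pi * (n * √2 - m) = Real.pi * n * √2 - m * Real.pi := by ring
    rw [h4]
    rcases abs_choice (Real.pi * n * √2 - m * Real.pi) with h | h <;> rw [h]
    · rw [Real.sin_sub_int_mul_pi, abs_mul, abs_neg_one_zpow, one_mul]
    · rw [Real.sin_neg, abs_neg, Real.sin_sub_int_mul_pi, abs_mul, abs_neg_one_zpow, one_mul]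
  have h4 := Real.mul_le_sin (x := Real.pi * |n * √2 - m|) (by positivity) (by nlinarith)
  rw [h3]
  refine le_trans ?_ (h4.trans (le_abs_self _))
  have h5 : 2 / Real.pi * (Real.pi * |n * √2 - m|) = 2 * |n * √2 - m| := by field_simp
  have h6 : 1 / (2 * (n : ℝ)) = 2 * (1 / (4 * n)) := by
    have : (n : ℝ) ≠ 0 := by positivity
    field_simp
    norm_num
  rw [h5, h6]
  gcongr

/-- The periodized Bernoulli polynomial `B₄` is a difference of translates by `√2` of a
continuous `1`-periodic function. -/
theorem exists_bernoulliFun_eq_sub : ∃ (κ : ℝ → ℝ) (M : ℝ), Continuous κ ∧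
    Function.Periodic κ 1 ∧ (∀ t, |κ t| ≤ M) ∧
    ∀ t, κ t - κ (t - √2) = bernoulliFun 4 (Int.fract t) := by
  set a : ℕ → ℝ → ℝ := fun n t =>
    Real.sin (2 * Real.pi * n * t + Real.pi * n * √2) / (2 * n ^ 4 * Real.sin (Real.pi * n * √2))
  have hsin : ∀ n : ℕ, 1 ≤ n → Real.sin (Real.pi * n * √2) ≠ 0 := fun n hn h => by
    have h1 := one_div_le_abs_sin_mul_sqrt_two n hn
    have h2 : (0 : ℝ) < n := by exact_mod_cast hn
    rw [h, abs_zero] at h1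
    exact absurd h1 (not_le.2 (by positivity))
  have ha : ∀ n t, ‖a n t‖ ≤ 1 / (n : ℝ) ^ 3 := fun n t => by
    rcases Nat.eq_zero_or_pos n with rfl | hn
    · simp [a]
    have hn0 : (0 : ℝ) < n := by exact_mod_cast hn
    have h1 := one_div_le_abs_sin_mul_sqrt_two n hn
    have h2 := Real.abs_sin_le_one (2 * Real.pi * n * t + Real.pi * n * √2)
    rw [Real.norm_eq_abs, abs_div, abs_mul, abs_of_pos (by positivity : (0 : ℝ) < 2 * n ^ 4)]
    refine div_le_div₀ zero_le_one h2 (by positivity) ?_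
    calc (n : ℝ) ^ 3 = 2 * n ^ 4 * (1 / (2 * n)) := by field_simp
      _ ≤ _ := by gcongr
  have hsum : Summable fun n : ℕ => 1 / (n : ℝ) ^ 3 :=
    Real.summable_one_div_nat_pow.2 (by norm_num)
  have hcont : Continuous fun t => ∑' n, a n t :=
    continuous_tsum (fun n => by fun_prop) hsum ha
  have hasum : ∀ t, Summable fun n => a n t := fun t => Summable.of_norm_bounded hsum fun n => ha n t
  have hper : ∀ n, Function.Periodic (a n) 1 := fun n t => by
    have : 2 * Real.pi * n * (t + 1) + Real.pi * n * √2 =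
        2 * Real.pi * n * t + Real.pi * n * √2 + n * (2 * Real.pi) := by ring
    simp only [a, this, Real.sin_add_nat_mul_two_pi]
  have hκper : Function.Periodic (fun t => ∑' n, a n t) 1 := fun t =>
    tsum_congr fun n => hper n t
  set c : ℝ := -48 / (2 * Real.pi) ^ 4 with hc
  have hdiff : ∀ n t, a n t - a n (t - √2) = 1 / (n : ℝ) ^ 4 * Real.cos (2 * Real.pi * n * t) :=
    fun n t => by
    rcases Nat.eq_zero_or_pos n with rfl | hn
    · simp [a]
    have hn0 : (0 : ℝ) < n := by exact_mod_cast hn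
    have h1 := hsin n hn
    have h2 : 2 * Real.pi * n * (t - √2) + Real.pi * n * √2 =
      2 * Real.pi * n * t - Real.pi * n * √2 := by ring
    simp only [a]
    rw [h2, ← sub_div, Real.sin_add, Real.sin_sub]
    field_simp
    ring
  obtain ⟨M, hM⟩ := hκper.exists_abs_le hcont
  refine ⟨fun t => c * ∑' n, a n t, |c| * M, continuous_const.mul hcont, fun t => ?_, fun t => ?_,
    fun t => ?_⟩
  · simp only [hκper t]
  · rw [abs_mul]
    exact mul_le_mul_of_nonneg_left (hM t) (abs_nonneg c)
  · have h1 := hasSum_one_div_nat_pow_mul_cos (k := 2) two_ne_zero (x := Int.fract t)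
      ⟨Int.fract_nonneg t, (Int.fract_lt_one t).le⟩
    have h2 : (fun n : ℕ => 1 / (n : ℝ) ^ (2 * 2) * Real.cos (2 * Real.pi * n * Int.fract t)) =
        fun n => a n t - a n (t - √2) := by
      funext n
      rw [hdiff]
      have h3 : 2 * Real.pi * n * Int.fract t =
          2 * Real.pi * n * t - ((n * ⌊t⌋ : ℤ) : ℝ) * (2 * Real.pi) := by
        rw [← Int.self_sub_floor]
        push_cast
        ring
      rw [h3, Real.cos_sub_int_mul_two_pi]
    rw [h2] at h1
    rw [← mul_sub, ← (hasum t).tsum_sub (hasum _), h1.tsum_eq, hc, bernoulliFun]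
    norm_num [Nat.factorial]
    field_simp
    ring

/-- Euler–Maclaurin summation of order four for functions supported in `(-M, M)`. -/
theorem integral_bernoulliFun_fract_mul {φ : ℕ → ℝ → ℝ} {M : ℕ}
    (hd : ∀ k t, HasDerivAt (φ k) (φ (k + 1) t) t) (hz : ∀ k t, (M : ℝ) ≤ |t| → φ k t = 0) :
    ∫ t, bernoulliFun 4 (Int.fract t) * φ 4 t =
      24 * (∫ t, φ 0 t) - 24 * ∑ k ∈ Finset.range (2 * M + 1), φ 0 (k - M) := by
  have hcont : ∀ k, Continuous (φ k) := fun k =>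
    continuous_iff_continuousAt.2 fun t => (hd k t).continuousAt
  have hB4 : bernoulliFun 4 1 = bernoulliFun 4 0 := bernoulliFun_endpoints_eq_of_ne_one (by norm_num)
  have hB : Continuous fun t => bernoulliFun 4 (Int.fract t) :=
    (continuous_bernoulliFun (k := 4)).continuousOn.comp_fract'' hB4.symm
  have hint : ∀ g : ℝ → ℝ, (∀ t, (M : ℝ) ≤ |t| → g t = 0) →
      ∫ t, g t = ∫ t in (-M : ℝ)..(M + 1), g t := fun g hg => by
    refine (intervalIntegral.integral_eq_integral_of_support_subset fun t ht => ?_).symm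
    by_contra h
    refine ht (hg t ?_)
    by_contra! h1
    rw [abs_lt] at h1
    exact h ⟨h1.1, by linarith⟩
  have hpiece : ∀ m : ℤ, ∫ t in (m : ℝ)..(m + 1), bernoulliFun 4 (Int.fract t) * φ 4 t =
      24 * (∫ t in (m : ℝ)..(m + 1), φ 0 t) +
      (bernoulliFun 4 0 * (φ 3 (m + 1) - φ 3 m) + 12 * bernoulliFun 2 0 * (φ 1 (m + 1) - φ 1 m)) -
      12 * (φ 0 (m + 1) + φ 0 m) := fun m => by
    have h1 : ∫ t in (m : ℝ)..(m + 1), bernoulliFun 4 (Int.fract t) * φ 4 t =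
        ∫ t in (m : ℝ)..(m + 1), bernoulliFun 4 (t - m) * φ 4 t := by
      refine intervalIntegral.integral_congr fun t ht => ?_
      rw [uIcc_of_le (by linarith)] at ht
      congr 1
      rcases ht.2.eq_or_lt with h | h
      · rw [h, add_sub_cancel_left, hB4, ← Int.cast_one, ← Int.cast_add, Int.fract_intCast]
      · rw [← Int.self_sub_floor, Int.floor_eq_iff.2 ⟨ht.1, h⟩]
    have hs : ∀ k : ℕ, ∀ t, HasDerivAt (fun t => bernoulliFun k (t - m))
        (k * bernoulliFun (k - 1) (t - m)) t := fun k t =>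
      (hasDerivAt_bernoulliFun k (t - m)).comp_sub_const t m
    have h2 : ∀ t, HasDerivAt (fun t => bernoulliFun 4 (t - m) * φ 3 t -
        4 * (bernoulliFun 3 (t - m) * φ 2 t) + 12 * (bernoulliFun 2 (t - m) * φ 1 t) -
        24 * (bernoulliFun 1 (t - m) * φ 0 t))
        (bernoulliFun 4 (t - m) * φ 4 t - 24 * φ 0 t) t := fun t => by
      have h3 := (((((hs 4 t).mul (hd 3 t)).sub (((hs 3 t).mul (hd 2 t)).const_mul 4)).add
        (((hs 2 t).mul (hd 1 t)).const_mul 12))).sub (((hs 1 t).mul (hd 0 t)).const_mul 24)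
      refine h3.congr_deriv ?_
      norm_num
      ring
    have hBc : Continuous fun t : ℝ => bernoulliFun 4 (t - m) :=
      (continuous_bernoulliFun (k := 4)).comp (continuous_id.sub continuous_const)
    have i1 : IntervalIntegrable (fun t => bernoulliFun 4 (t - m) * φ 4 t) volume m (m + 1) :=
      (hBc.mul (hcont 4)).intervalIntegrable _ _
    have i2 : IntervalIntegrable (fun t => 24 * φ 0 t) volume m (m + 1) :=
      (continuous_const.mul (hcont 0)).intervalIntegrable _ _
    have h3 := intervalIntegral.integral_eq_sub_of_hasDerivAt (a := (m : ℝ)) (b := m + 1)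
      (fun t _ => h2 t) (i1.sub i2)
    rw [intervalIntegral.integral_sub i1 i2, intervalIntegral.integral_const_mul] at h3
    have e3 : bernoulliFun 3 0 = 0 := by
      rw [bernoulliFun_eval_zero, bernoulli_eq_zero_of_odd (by decide) (by norm_num), Rat.cast_zero]
    have e3' : bernoulliFun 3 1 = 0 := by
      rw [bernoulliFun_endpoints_eq_of_ne_one (by norm_num), e3]
    have e2 : bernoulliFun 2 1 = bernoulliFun 2 0 :=
      bernoulliFun_endpoints_eq_of_ne_one (by norm_num)
    simp only [add_sub_cancel_left, sub_self, hB4, e3, e3', e2, bernoulliFun_one] at h3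
    rw [h1]
    linarith
  have hterm : ∀ k : ℕ, ((k + 1 : ℕ) : ℝ) - M = (((k : ℤ) - M : ℤ) : ℝ) + 1 := fun k => by
    push_cast
    ring
  have hterm' : ∀ k : ℕ, (k : ℝ) - M = (((k : ℤ) - M : ℤ) : ℝ) := fun k => by push_cast; rfl
  have hadj : ∀ g : ℝ → ℝ, Continuous g → ∫ t in (-M : ℝ)..(M + 1), g t =
      ∑ k ∈ Finset.range (2 * M + 1),
        ∫ t in (((k : ℤ) - M : ℤ) : ℝ)..((((k : ℤ) - M : ℤ) : ℝ) + 1), g t := fun g hg => by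
    have h1 := intervalIntegral.sum_integral_adjacent_intervals (f := g) (μ := volume)
      (a := fun k : ℕ => (k : ℝ) - M) (n := 2 * M + 1) fun k _ => hg.intervalIntegrable _ _
    simp only [hterm, hterm'] at h1
    rw [h1]
    congr 1
    · push_cast
      ring
    · push_cast
      ring
  have htel : ∀ k : ℕ, ∑ n ∈ Finset.range (2 * M + 1),
      (φ k ((((n : ℤ) - M : ℤ) : ℝ) + 1) - φ k (((n : ℤ) - M : ℤ) : ℝ)) = 0 := fun k => by
    have h1 := Finset.sum_range_sub (fun n : ℕ => φ k ((n : ℝ) - M)) (2 * M + 1)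
    simp only [hterm, hterm'] at h1
    rw [h1, ← hterm', ← hterm', hz, hz, sub_zero]
    · push_cast
      rw [zero_sub, abs_neg]
      exact le_abs_self _
    · push_cast
      refine le_trans ?_ (le_abs_self _)
      linarith
  rw [hint (fun t => bernoulliFun 4 (Int.fract t) * φ 4 t) fun t ht => by simp [hz 4 t ht],
    hint _ (hz 0), hadj (fun t => bernoulliFun 4 (Int.fract t) * φ 4 t) (hB.mul (hcont 4)), hadj _ (hcont 0)]
  simp only [hpiece, hterm']
  have h1 := htel 0
  rw [Finset.sum_sub_distrib] at h1
  rw [Finset.sum_sub_distrib, Finset.sum_add_distrib, ← Finset.mul_sum, ← Finset.mul_sum,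
    Finset.sum_add_distrib, ← Finset.mul_sum, ← Finset.mul_sum, htel 3, htel 1,
    Finset.sum_add_distrib]
  linarith

end SmallDivisors

section UnitBump

/-- A bump function on `[-1, 1]` whose integer translates sum to one. -/
noncomputable def unitBump (t : ℝ) : ℝ := Real.smoothTransition (t + 1) - Real.smoothTransition t

theorem contDiff_unitBump : ContDiff ℝ (⊤ : ℕ∞) unitBump :=
  (Real.smoothTransition.contDiff.comp (contDiff_id.add contDiff_const)).sub
    Real.smoothTransition.contDiff

theorem unitBump_zero : unitBump 0 = 1 := by
  simp [unitBump]

theorem unitBump_eq_zero {t : ℝ} (ht : 1 ≤ |t|) : unitBump t = 0 := by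
  rcases le_abs.1 ht with h | h
  · rw [unitBump, Real.smoothTransition.one_of_one_le h,
      Real.smoothTransition.one_of_one_le (by linarith), sub_self]
  · rw [unitBump, Real.smoothTransition.zero_of_nonpos (by linarith),
      Real.smoothTransition.zero_of_nonpos (by linarith), sub_self]

theorem abs_lt_one_of_unitBump_ne_zero {t : ℝ} (ht : unitBump t ≠ 0) : |t| < 1 := by
  by_contra! h
  exact ht (unitBump_eq_zero h)

theorem unitBump_nonneg (t : ℝ) : 0 ≤ unitBump t := by
  rcases le_or_gt 0 t with h | h
  · rw [unitBump, Real.smoothTransition.one_of_one_le (by linarith)]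
    linarith [Real.smoothTransition.le_one t]
  · rw [unitBump, Real.smoothTransition.zero_of_nonpos h.le, sub_zero]
    exact Real.smoothTransition.nonneg _

theorem abs_unitBump_le (t : ℝ) : |unitBump t| ≤ 1 := by
  rw [abs_of_nonneg (unitBump_nonneg t), unitBump]
  linarith [Real.smoothTransition.le_one (t + 1), Real.smoothTransition.nonneg t]

theorem sum_unitBump_add {M : ℕ} {t : ℝ} (ht : |t| ≤ M) :
    ∑ k ∈ Finset.range (2 * M + 1), unitBump (t + (k - M)) = 1 := by
  have h := abs_le.1 ht
  have h1 := Finset.sum_range_sub (fun k : ℕ => Real.smoothTransition (t + (k - M))) (2 * M + 1)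
  rw [Real.smoothTransition.zero_of_nonpos (x := t + ((0 : ℕ) - M)) (by push_cast; linarith),
    Real.smoothTransition.one_of_one_le (by push_cast; linarith), sub_zero] at h1
  rw [← h1]
  refine Finset.sum_congr rfl fun k _ => ?_
  rw [unitBump]
  push_cast
  ring_nf

theorem sum_unitBump_sub {M : ℕ} {t : ℝ} (ht : |t| ≤ M) :
    ∑ k ∈ Finset.range (2 * M + 1), unitBump (t - (k - M)) = 1 := by
  rw [← Finset.sum_range_reflect, ← sum_unitBump_add ht]
  refine Finset.sum_congr rfl fun k hk => ?_
  have hk' : k ≤ 2 * M := Nat.lt_succ_iff.1 (Finset.mem_range.1 hk)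
  rw [Nat.add_sub_cancel, Nat.cast_sub hk']
  push_cast
  ring_nf

theorem abs_integral_le_of_support {g : ℝ → ℝ} {A r : ℝ} (hr : 0 ≤ r)
    (hg : ∀ t, g t ≠ 0 → |t| ≤ r) (hA : ∀ t, |g t| ≤ A) : |∫ t, g t| ≤ A * (2 * r) := by
  rw [← setIntegral_eq_integral_of_forall_compl_eq_zero (s := Icc (-r) r) fun t ht => by
    by_contra h
    exact ht (abs_le.1 (hg t h))]
  have h : ‖∫ t in Icc (-r) r, g t‖ ≤ A * volume.real (Icc (-r) r) :=
    norm_setIntegral_le_of_norm_le_const measure_Icc_lt_top fun t _ => hA t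
  rw [Real.norm_eq_abs, Measure.real, Real.volume_Icc, ENNReal.toReal_ofReal (by linarith)] at h
  exact h.trans_eq (by ring)

end UnitBump

section ZeroMean

variable {d : ℕ} {f : EuclideanSpace ℝ (Fin d) → ℝ} {N : (EuclideanSpace ℝ (Fin d) → ℝ) → ℝ}

theorem IsTest.iterate_dirDeriv (hf : IsTest f) (e : EuclideanSpace ℝ (Fin d)) (k : ℕ) :
    IsTest ((_root_.dirDeriv e)^[k] f) := by
  induction k with
  | zero => exact hf
  | succ k ih =>
    rw [Function.iterate_succ_apply']
    exact ih.dirDeriv e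

theorem norm_le_of_dirDeriv_ne_zero {R : ℝ} (hR : ∀ x, f x ≠ 0 → ‖x‖ ≤ R)
    (e : EuclideanSpace ℝ (Fin d)) (x : EuclideanSpace ℝ (Fin d)) (hx : dirDeriv e f x ≠ 0) :
    ‖x‖ ≤ R := by
  by_contra! h
  refine hx (dirDeriv_eq_zero_of_eventually_const (c := 0) ?_ e)
  filter_upwards [continuous_norm.isOpen_preimage _ isOpen_Ioi |>.mem_nhds h] with y hy
  by_contra h1
  exact absurd (hR y h1) (not_le.2 hy)

theorem norm_le_of_iterate_dirDeriv_ne_zero {R : ℝ} (hR : ∀ x, f x ≠ 0 → ‖x‖ ≤ R)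
    (e : EuclideanSpace ℝ (Fin d)) (k : ℕ) :
    ∀ x, (dirDeriv e)^[k] f x ≠ 0 → ‖x‖ ≤ R := by
  induction k with
  | zero => exact hR
  | succ k ih =>
    rw [Function.iterate_succ_apply']
    exact norm_le_of_dirDeriv_ne_zero ih e

theorem norm_shift_support_le {R b : ℝ} (hR : ∀ x, f x ≠ 0 → ‖x‖ ≤ R)
    {v : EuclideanSpace ℝ (Fin d)} (hv : ‖v‖ ≤ b) (x : EuclideanSpace ℝ (Fin d))
    (hx : shift v f x ≠ 0) : ‖x‖ ≤ R + b := by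
  have h1 := hR _ hx
  have h2 := norm_le_norm_add_norm_sub' x v
  linarith

theorem norm_le_of_line {R : ℝ} {j : Fin d} {x : EuclideanSpace ℝ (Fin d)} {t : ℝ}
    (h : ‖x - t • EuclideanSpace.single j (1 : ℝ)‖ ≤ R) (hx : |x j| ≤ 1) : ‖x‖ ≤ R + 1 := by
  have h1 : ‖x - x j • EuclideanSpace.single j (1 : ℝ)‖ ≤
      ‖x - t • EuclideanSpace.single j (1 : ℝ)‖ := by
    rw [EuclideanSpace.norm_eq, EuclideanSpace.norm_eq]
    refine Real.sqrt_le_sqrt (Finset.sum_le_sum fun k _ => ?_)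
    by_cases hk : k = j
    · subst hk
      simp [sq_nonneg]
    · simp [hk]
  have h2 : ‖x j • EuclideanSpace.single j (1 : ℝ)‖ ≤ 1 := by simpa [norm_smul] using hx
  have h3 := norm_le_norm_add_norm_sub' x (x j • EuclideanSpace.single j (1 : ℝ))
  linarith

theorem abs_lt_of_line {R : ℝ} {j : Fin d} {x : EuclideanSpace ℝ (Fin d)} {t : ℝ}
    (h : ‖x - t • EuclideanSpace.single j (1 : ℝ)‖ ≤ R) (hx : |x j| < 1) : |t| < R + 1 := by
  have h1 := (PiLp.norm_apply_le (x - t • EuclideanSpace.single j (1 : ℝ)) j).trans h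
  simp only [PiLp.sub_apply, PiLp.smul_apply, PiLp.single_apply, if_true, smul_eq_mul,
    mul_one, Real.norm_eq_abs] at h1
  rw [abs_le] at h1
  rw [abs_lt] at hx ⊢
  constructor <;> linarith

/-- Replacing a function by the cut-off of its periodization. -/
theorem IsInvariantSeminorm.exists_sub_periodization_le (hN : IsInvariantSeminorm N) {i j : Fin d}
    (hij : i ≠ j) {R : ℝ} (hR : 0 < R) {M : ℕ} (hM : R ≤ M) :
    ∃ C, 0 ≤ C ∧ ∀ f, IsTest f → (∀ x, f x ≠ 0 → ‖x‖ ≤ R) → ∀ B : ℝ, (∀ x, |f x| ≤ B) →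
      N (f - (fun x => unitBump (x j)) * ∑ k ∈ Finset.range (2 * M + 1),
        shift (((k : ℝ) - M) • EuclideanSpace.single j (1 : ℝ)) f) ≤ C * B := by
  have hM0 : (0 : ℝ) < M := hR.trans_le hM
  obtain ⟨C, hC0, hC⟩ := hN.exists_sub_shift_le hij hM0
  refine ⟨∑ _k ∈ Finset.range (2 * M + 1), C, by positivity, fun f hf hfR B hB => ?_⟩
  set ej := EuclideanSpace.single j (1 : ℝ) with hej
  have hejj : ej j = 1 := by simp [hej]
  set F : ℕ → EuclideanSpace ℝ (Fin d) → ℝ := fun k =>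
    (fun x => unitBump (x j + (k - M))) * f with hF
  have hFt : ∀ k, IsTest (F k) := fun k =>
    hf.mul_left (contDiff_comp_apply (contDiff_unitBump.comp (contDiff_id.add contDiff_const)) j)
  have hsum : f = ∑ k ∈ Finset.range (2 * M + 1), F k := by
    funext x
    simp only [hF, Finset.sum_apply, Pi.mul_apply, ← Finset.sum_mul]
    by_cases hx : f x = 0
    · simp [hx]
    · rw [sum_unitBump_add, one_mul]
      exact ((PiLp.norm_apply_le x j).trans (hfR x hx)).trans hM
  have hsum' : (fun x => unitBump (x j)) * ∑ k ∈ Finset.range (2 * M + 1),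
      shift (((k : ℝ) - M) • ej) f =
      ∑ k ∈ Finset.range (2 * M + 1), shift (((k : ℝ) - M) • ej) (F k) := by
    rw [Finset.mul_sum]
    refine Finset.sum_congr rfl fun k _ => ?_
    funext x
    simp [shift, hF, hejj]
  rw [hsum']
  nth_rw 1 [hsum]
  rw [← Finset.sum_sub_distrib, Finset.sum_mul]
  refine (hN.sum_le fun k _ => (hFt k).sub ((hFt k).shift _)).trans (Finset.sum_le_sum fun k hk => ?_)
  refine hC _ (hFt k) (fun x hx => (hfR x (right_ne_zero_of_mul hx)).trans hM) B (fun x => ?_) _ ?_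
  · simp only [hF, Pi.mul_apply, abs_mul]
    exact (mul_le_of_le_one_left (abs_nonneg _) (abs_unitBump_le _)).trans (hB x)
  · have hk' : (k : ℝ) ≤ 2 * M := by exact_mod_cast Nat.lt_succ_iff.1 (Finset.mem_range.1 hk)
    rw [abs_le]
    constructor <;> linarith [(Nat.cast_nonneg k : (0 : ℝ) ≤ k)]

/-- Functions with zero mean on all lines parallel to a coordinate axis are controlled by their
`C⁴` norm along this axis. -/
theorem IsInvariantSeminorm.exists_le_of_zero_mean_of_deriv (hN : IsInvariantSeminorm N)
    {i j : Fin d} (hij : i ≠ j) {R : ℝ} (hR : 0 < R) :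
    ∃ C, 0 ≤ C ∧ ∀ f, IsTest f → (∀ x, f x ≠ 0 → ‖x‖ ≤ R) → ∀ B : ℝ, (∀ x, |f x| ≤ B) →
      (∀ x, |(dirDeriv (EuclideanSpace.single j (1 : ℝ)))^[4] f x| ≤ B) →
      (∀ x, ∫ t : ℝ, f (x - t • EuclideanSpace.single j (1 : ℝ)) = 0) → N f ≤ C * B := by
  obtain ⟨κ, K, hκc, hκp, hκK, hκ⟩ := exists_bernoulliFun_eq_sub
  have hK0 : 0 ≤ K := (abs_nonneg _).trans (hκK 0)
  set M : ℕ := ⌈R + 3⌉₊ with hMdef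
  have hM : R + 3 ≤ M := Nat.le_ceil _
  have hM0 : (0 : ℝ) ≤ M := Nat.cast_nonneg M
  have hsqrt : √2 ≤ 2 := by
    rw [Real.sqrt_le_left (by norm_num)]
    norm_num
  have hsqrt0 : 0 ≤ √2 := Real.sqrt_nonneg 2
  obtain ⟨C₁, hC₁, h₁⟩ := hN.exists_sub_shift_le hij (R := R + 3) (by linarith)
  obtain ⟨C₂, hC₂, h₂⟩ := hN.exists_sub_periodization_le hij (R := R + 3) (by linarith) hM
  refine ⟨C₂ + (C₁ + C₂) * (K * (2 * M)), by positivity, fun f hf hfR B hB hB4 hmean => ?_⟩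
  have hB0 : 0 ≤ B := (abs_nonneg _).trans (hB 0)
  set e := EuclideanSpace.single j (1 : ℝ) with he
  have hej : e j = 1 := by simp [he]
  have hen : ‖e‖ = 1 := by simp [he]
  have he0 : e ≠ 0 := fun h => by simp [h] at hen
  set ρ : EuclideanSpace ℝ (Fin d) → ℝ := fun x => unitBump (x j) with hρ
  have hρs : ContDiff ℝ (⊤ : ℕ∞) ρ := contDiff_comp_apply contDiff_unitBump j
  set F := (dirDeriv e)^[4] f with hFdef
  have hF : IsTest F := hf.iterate_dirDeriv e 4
  have hFR := norm_le_of_iterate_dirDeriv_ne_zero hfR e 4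
  set g : EuclideanSpace ℝ (Fin d) → ℝ := fun x => ∫ t, κ t * F (x - t • e) with hg
  have hgs : ContDiff ℝ (⊤ : ℕ∞) g := contDiff_lineIntegral hκc.locallyIntegrable he0 hF
  have hgper : ∀ x, Function.Periodic (fun t : ℝ => g (x - t • e)) 1 := fun x t => by
    simp only [hg]
    rw [← integral_add_right_eq_self (fun s => κ s * F (x - t • e - s • e)) (1 : ℝ)]
    refine integral_congr_ae (Eventually.of_forall fun s => ?_)
    simp only [hκp s]
    congr 2
    module
  have hline : ∀ x, ρ x ≠ 0 → ∀ t : ℝ, ∀ k, (M : ℝ) ≤ |t| → (dirDeriv e)^[k] f (x - t • e) = 0 :=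
    fun x hx t k ht => by
    by_contra h
    have h3 := abs_lt_of_line (norm_le_of_iterate_dirDeriv_ne_zero hfR e k _ h)
      (abs_lt_one_of_unitBump_ne_zero hx)
    linarith
  set u := ρ * g with hu
  have hu0 : ∀ x, u x ≠ 0 → ‖x‖ ≤ R + 1 := fun x hx => by
    have h3 : ∃ t : ℝ, F (x - t • e) ≠ 0 := by
      by_contra! h
      exact hx (by simp [hu, hg, h])
    obtain ⟨t, ht⟩ := h3
    exact norm_le_of_line (hFR _ ht)
      (abs_lt_one_of_unitBump_ne_zero (left_ne_zero_of_mul hx)).le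
  have hut : IsTest u := IsTest.of_radius (hρs.mul hgs) hu0
  have huB : ∀ x, |u x| ≤ K * (2 * M) * B := fun x => by
    by_cases hx : ρ x = 0
    · simp only [hu, Pi.mul_apply, hx, zero_mul, abs_zero]
      positivity
    · rw [hu, Pi.mul_apply, abs_mul]
      refine (mul_le_of_le_one_left (abs_nonneg _) (abs_unitBump_le _)).trans ?_
      refine (abs_integral_le_of_support (A := K * B) hM0 (fun t ht => ?_) fun t => ?_).trans_eq
        (by ring)
      · by_contra! h
        exact right_ne_zero_of_mul ht (hline x hx t 4 h.le)
      · rw [abs_mul]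
        exact mul_le_mul (hκK t) (hB4 _) (abs_nonneg _) hK0
  have hv : ‖√2 • e‖ ≤ 2 := by
    rw [norm_smul, hen, mul_one, Real.norm_of_nonneg hsqrt0]
    exact hsqrt
  have hv' : |√2| ≤ R + 3 := by
    rw [abs_of_nonneg hsqrt0]
    linarith
  set u₁ := shift (√2 • e) u with hu₁
  have hu₁t : IsTest u₁ := hut.shift _
  have hu₁0 : ∀ x, u₁ x ≠ 0 → ‖x‖ ≤ R + 3 := fun x hx =>
    (norm_shift_support_le hu0 hv x hx).trans (by linarith)
  have a1 := h₁ u hut (fun x hx => (hu0 x hx).trans (by linarith)) _ huB _ hv'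
  have a2 := h₂ u₁ hu₁t hu₁0 _ fun x => huB _
  have a3 := h₂ f hf (fun x hx => (hfR x hx).trans (by linarith)) B hB
  set p₁ := ρ * ∑ k ∈ Finset.range (2 * M + 1), shift (((k : ℝ) - M) • e) u₁ with hp₁
  set p := ρ * ∑ k ∈ Finset.range (2 * M + 1), shift (((k : ℝ) - M) • e) f with hp
  have hp₁t : IsTest p₁ := (IsTest.sum fun k _ => hu₁t.shift _).mul_left hρs
  have hpt : IsTest p := (IsTest.sum fun k _ => hf.shift _).mul_left hρs
  have hint : ∀ c x, Integrable fun t : ℝ => κ (t - c) * F (x - t • e) := fun c x =>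
    ((hκc.comp (continuous_id.sub continuous_const)).mul
      (hF.continuous_line x)).integrable_of_hasCompactSupport
      (hF.hasCompactSupport_line he0 x).mul_left
  have hgsub : ∀ x, ρ x ≠ 0 → g x - g (x - √2 • e) =
      -24 * ∑ k ∈ Finset.range (2 * M + 1), f (x - ((k : ℝ) - M) • e) := fun x hx => by
    have h3 : g (x - √2 • e) = ∫ t, κ (t - √2) * F (x - t • e) := by
      simp only [hg]
      rw [← integral_sub_right_eq_self (fun t => κ t * F (x - √2 • e - t • e)) √2]
      refine integral_congr_ae (Eventually.of_forall fun s => ?_)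
      simp only
      congr 2
      module
    have h4 := hint 0 x
    simp only [sub_zero] at h4
    rw [h3, ← integral_sub h4 (hint _ x)]
    simp only [← sub_mul, hκ]
    have h5 := integral_bernoulliFun_fract_mul (M := M)
      (φ := fun k t => (-1) ^ k * (dirDeriv e)^[k] f (x - t • e)) (fun k t => by
        have h6 := ((hf.iterate_dirDeriv e k).hasDerivAt_line_sub x e t).const_mul ((-1 : ℝ) ^ k)
        rw [Function.iterate_succ_apply']
        exact h6.congr_deriv (by ring)) (fun k t ht => by rw [hline x hx t k ht, mul_zero])
    simp only [pow_zero, one_mul, Function.iterate_zero, id_eq, hmean, mul_zero, zero_sub,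
      Even.neg_pow (by decide : Even 4), one_pow] at h5
    rw [hFdef, h5]
    ring
  have hkey : p = (-1 / 24 : ℝ) • (u - p₁) := by
    funext x
    simp only [hp, hp₁, hu₁, hu, shift, Pi.smul_apply, Pi.sub_apply, Pi.mul_apply, smul_eq_mul,
      Finset.sum_apply]
    by_cases hx : ρ x = 0
    · simp [hx]
    have h3 : ∀ k ∈ Finset.range (2 * M + 1), ρ (x - ((k : ℝ) - M) • e - √2 • e) *
        g (x - ((k : ℝ) - M) • e - √2 • e) =
        unitBump (x j - √2 - (k - M)) * g (x - √2 • e) := fun k _ => by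
      have h4 := (hgper (x - √2 • e)).int_mul_eq ((k : ℤ) - M)
      simp only [mul_one, zero_smul, sub_zero] at h4
      push_cast at h4
      rw [sub_right_comm x, h4, hρ]
      simp [hej, sub_right_comm]
    have h4 : |x j - √2| ≤ M := by
      have h5 := abs_lt.1 (abs_lt_one_of_unitBump_ne_zero hx)
      rw [abs_le]
      constructor <;> linarith
    rw [Finset.sum_congr rfl h3, ← Finset.sum_mul, sum_unitBump_sub h4, one_mul, ← mul_sub,
      hgsub x hx]
    ring
  have hnp : N p ≤ 1 / 24 * (C₁ * (K * (2 * M) * B) + C₂ * (K * (2 * M) * B)) := by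
    rw [hkey, hN.smul _ (hut.sub hp₁t)]
    have h3 : u - p₁ = (u - u₁) + (u₁ - p₁) := by abel
    have h4 := hN.add_le (hut.sub hu₁t) (hu₁t.sub hp₁t)
    rw [← h3] at h4
    norm_num
    linarith
  have h3 := hN.le_add_sub hf hpt
  have h4 : 0 ≤ (C₁ + C₂) * (K * (2 * M)) * B := by positivity
  linarith

end ZeroMean

section LineAverage

variable {d : ℕ} {f : EuclideanSpace ℝ (Fin d) → ℝ} {N : (EuclideanSpace ℝ (Fin d) → ℝ) → ℝ}

theorem abs_sum_deriv_le {φ φ' φ'' : ℝ → ℝ} {D S : ℝ} (h1 : ∀ t, HasDerivAt φ (φ' t) t)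
    (h2 : ∀ t, HasDerivAt φ' (φ'' t) t) (hD : ∀ t, |φ t| ≤ D) (hS : ∀ t, |φ'' t| ≤ S) {m : ℕ}
    (hm : 0 < m) : |(m : ℝ)⁻¹ * ∑ s ∈ Finset.range m, φ' ((s : ℝ) / m)| ≤ 2 * D + S / m := by
  have hm0 : (0 : ℝ) < m := Nat.cast_pos.2 hm
  have hS0 : 0 ≤ S := (abs_nonneg _).trans (hS 0)
  have hlip : ∀ a b : ℝ, |φ' b - φ' a| ≤ S * |b - a| := fun a b =>
    convex_univ.norm_image_sub_le_of_norm_hasDerivWithin_le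
      (fun t _ => (h2 t).hasDerivWithinAt) (fun t _ => hS t) (mem_univ a) (mem_univ b)
  have hterm : ∀ s ∈ Finset.range m,
      |(m : ℝ)⁻¹ * φ' ((s : ℝ) / m) - (φ (((s + 1 : ℕ) : ℝ) / m) - φ ((s : ℝ) / m))| ≤
        S / m * (m : ℝ)⁻¹ := fun s _ => by
    have hlt : (s : ℝ) / m < ((s + 1 : ℕ) : ℝ) / m := by
      push_cast
      gcongr
      linarith
    have hdiff : ((s + 1 : ℕ) : ℝ) / m - (s : ℝ) / m = (m : ℝ)⁻¹ := by
      push_cast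
      field_simp
      ring
    obtain ⟨c, hc, hc'⟩ := exists_hasDerivAt_eq_slope φ φ' hlt
      (fun t _ => (h1 t).continuousAt.continuousWithinAt) fun t _ => h1 t
    rw [hdiff, eq_div_iff (by positivity)] at hc'
    rw [← hc', mul_comm (φ' c), ← mul_sub, abs_mul, abs_of_pos (inv_pos.2 hm0),
      mul_comm (S / m)]
    gcongr
    refine (hlip _ _).trans ?_
    rw [div_eq_mul_inv S]
    gcongr
    rw [abs_sub_comm, abs_of_pos (sub_pos.2 hc.1), ← hdiff]
    linarith [hc.2]
  have htel := Finset.sum_range_sub (fun s : ℕ => φ ((s : ℝ) / m)) m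
  have h3 := (Finset.abs_sum_le_sum_abs _ _).trans (Finset.sum_le_sum hterm)
  rw [Finset.sum_sub_distrib, ← Finset.mul_sum, htel, Finset.sum_const, Finset.card_range,
    nsmul_eq_mul, mul_left_comm, mul_inv_cancel₀ hm0.ne', mul_one] at h3
  have h4 := hD ((m : ℝ) / m)
  have h5 := hD (((0 : ℕ) : ℝ) / m)
  rw [abs_le] at *
  constructor <;> linarith

/-- The average of `m` equidistant translates of a function along the unit segment in the
direction `e`. -/
noncomputable def lineAverage (m : ℕ) (e : EuclideanSpace ℝ (Fin d))
    (f : EuclideanSpace ℝ (Fin d) → ℝ) : EuclideanSpace ℝ (Fin d) → ℝ :=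
  (m : ℝ)⁻¹ • ∑ s ∈ Finset.range m, shift (((s : ℝ) / m) • e) f

theorem IsTest.lineAverage (hf : IsTest f) (m : ℕ) (e : EuclideanSpace ℝ (Fin d)) :
    IsTest (lineAverage m e f) :=
  (IsTest.sum fun _ _ => hf.shift _).const_smul _

theorem dirDeriv_lineAverage (hf : IsTest f) (m : ℕ) (e : EuclideanSpace ℝ (Fin d)) :
    dirDeriv e (lineAverage m e f) = lineAverage m e (dirDeriv e f) := by
  have h : ∀ s : Finset ℕ, dirDeriv e (∑ k ∈ s, shift (((k : ℝ) / m) • e) f) =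
      ∑ k ∈ s, shift (((k : ℝ) / m) • e) (dirDeriv e f) := fun s => by
    funext x
    simp only [dirDeriv, Finset.sum_apply]
    rw [fderiv_sum fun k _ => (hf.shift _).differentiable x, sum_apply]
    exact Finset.sum_congr rfl fun k _ => congrFun (dirDeriv_shift _ _ _) x
  rw [lineAverage, lineAverage,
    dirDeriv_const_smul (IsTest.sum fun _ _ => hf.shift _), h]

theorem iterate_dirDeriv_lineAverage (hf : IsTest f) (m : ℕ) (e : EuclideanSpace ℝ (Fin d))
    (k : ℕ) : (dirDeriv e)^[k] (lineAverage m e f) = lineAverage m e ((dirDeriv e)^[k] f) := by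
  induction k with
  | zero => rfl
  | succ k ih =>
    rw [Function.iterate_succ_apply', Function.iterate_succ_apply', ih,
      dirDeriv_lineAverage (hf.iterate_dirDeriv e k)]

theorem abs_lineAverage_le {B : ℝ} (hB : ∀ x, |f x| ≤ B) {m : ℕ} (hm : 0 < m)
    (e x : EuclideanSpace ℝ (Fin d)) : |lineAverage m e f x| ≤ B := by
  have hm0 : (0 : ℝ) < m := Nat.cast_pos.2 hm
  rw [lineAverage, Pi.smul_apply, Finset.sum_apply, smul_eq_mul, abs_mul,
    abs_of_pos (inv_pos.2 hm0), inv_mul_le_iff₀ hm0]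
  refine (Finset.abs_sum_le_sum_abs _ _).trans
    ((Finset.sum_le_sum (g := fun _ => B) fun s _ => hB _).trans_eq ?_)
  simp

theorem norm_le_of_lineAverage_ne_zero {R : ℝ} (hR : ∀ x, f x ≠ 0 → ‖x‖ ≤ R)
    {e : EuclideanSpace ℝ (Fin d)} (he : ‖e‖ = 1) (m : ℕ) (x : EuclideanSpace ℝ (Fin d))
    (hx : lineAverage m e f x ≠ 0) : ‖x‖ ≤ R + 1 := by
  rw [lineAverage, Pi.smul_apply, Finset.sum_apply] at hx
  obtain ⟨s, hs, hsx⟩ := Finset.exists_ne_zero_of_sum_ne_zero (smul_ne_zero_iff.1 hx).2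
  refine norm_shift_support_le hR ?_ x hsx
  have hsm : (s : ℝ) ≤ m := by exact_mod_cast (Finset.mem_range.1 hs).le
  rw [norm_smul, he, mul_one, Real.norm_of_nonneg (by positivity)]
  exact div_le_one_of_le₀ hsm (Nat.cast_nonneg m)

theorem integral_lineAverage_eq_zero (hf : IsTest f) {e : EuclideanSpace ℝ (Fin d)} (he : e ≠ 0)
    (hmean : ∀ x, ∫ t : ℝ, f (x - t • e) = 0) (m : ℕ) (x : EuclideanSpace ℝ (Fin d)) :
    ∫ t : ℝ, lineAverage m e f (x - t • e) = 0 := by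
  simp only [lineAverage, Pi.smul_apply, Finset.sum_apply, smul_eq_mul]
  rw [integral_const_mul, integral_finsetSum _ fun s _ => (hf.shift _).integrable_line he x,
    Finset.sum_eq_zero, mul_zero]
  intro s _
  rw [← hmean (x - ((s : ℝ) / m) • e)]
  simp only [shift, sub_right_comm]

theorem IsInvariantSeminorm.exists_smoothing_step (hN : IsInvariantSeminorm N) {i j : Fin d}
    (hij : i ≠ j) {R : ℝ} (hR : 0 < R) (k : ℕ) :
    ∃ C, 0 ≤ C ∧ ∀ f, IsTest f → (∀ x, f x ≠ 0 → ‖x‖ ≤ R) → ∀ B : ℝ, (∀ x, |f x| ≤ B) →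
      (∀ x, ∫ t : ℝ, f (x - t • EuclideanSpace.single j (1 : ℝ)) = 0) → ∀ D : ℝ, 0 < D →
      (∀ x, |(dirDeriv (EuclideanSpace.single j (1 : ℝ)))^[k] f x| ≤ D) →
      ∃ h, IsTest h ∧ (∀ x, h x ≠ 0 → ‖x‖ ≤ R + 1) ∧ (∀ x, |h x| ≤ B) ∧
        (∀ x, ∫ t : ℝ, h (x - t • EuclideanSpace.single j (1 : ℝ)) = 0) ∧
        (∀ x, |(dirDeriv (EuclideanSpace.single j (1 : ℝ)))^[k + 1] h x| ≤ 3 * D) ∧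
        N (f - h) ≤ C * B := by
  obtain ⟨C, hC, hCf⟩ := hN.exists_sub_shift_le hij (R := R + 1) (by linarith)
  refine ⟨C, hC, fun f hf hfR B hB hmean D hD hfD => ?_⟩
  set e := EuclideanSpace.single j (1 : ℝ) with he
  have hen : ‖e‖ = 1 := by simp [he]
  have he0 : e ≠ 0 := fun h => by simp [h] at hen
  have hB0 : 0 ≤ B := (abs_nonneg _).trans (hB 0)
  set G := (dirDeriv e)^[k] f with hG
  have hGt : IsTest G := hf.iterate_dirDeriv e k
  obtain ⟨S, hS0, hS⟩ := ((hGt.dirDeriv e).dirDeriv e).exists_bound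
  obtain ⟨m, hm⟩ := exists_nat_gt (S / D)
  have hm0 : (0 : ℝ) < m := (div_nonneg hS0 hD.le).trans_lt hm
  have hmpos : 0 < m := Nat.cast_pos.1 hm0
  refine ⟨lineAverage m e f, hf.lineAverage m e, norm_le_of_lineAverage_ne_zero hfR hen m,
    abs_lineAverage_le hB hmpos e, integral_lineAverage_eq_zero hf he0 hmean m, fun x => ?_, ?_⟩
  · rw [iterate_dirDeriv_lineAverage hf, Function.iterate_succ_apply', ← hG]
    have h1 := abs_sum_deriv_le (φ := fun t => -G (x - t • e))
      (φ' := fun t => dirDeriv e G (x - t • e))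
      (φ'' := fun t => -dirDeriv e (dirDeriv e G) (x - t • e)) (D := D) (S := S)
      (fun t => (hGt.hasDerivAt_line_sub x e t).neg.congr_deriv (neg_neg _))
      (fun t => (hGt.dirDeriv e).hasDerivAt_line_sub x e t)
      (fun t => by rw [abs_neg]; exact hfD _) (fun t => by rw [abs_neg]; exact hS _) hmpos
    simp only [lineAverage, Pi.smul_apply, Finset.sum_apply, smul_eq_mul, shift]
    have h2 : S / m < D := by
      rw [div_lt_iff₀ hm0]
      rwa [div_lt_iff₀ hD, mul_comm] at hm
    linarith
  · have h1 : f - lineAverage m e f =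
        (m : ℝ)⁻¹ • ∑ s ∈ Finset.range m, (f - shift (((s : ℝ) / m) • e) f) := by
      rw [lineAverage, Finset.sum_sub_distrib, smul_sub, Finset.sum_const, Finset.card_range,
        ← Nat.cast_smul_eq_nsmul ℝ, smul_smul, inv_mul_cancel₀ hm0.ne', one_smul]
    have hst : ∀ s ∈ Finset.range m, IsTest (f - shift (((s : ℝ) / m) • e) f) :=
      fun s _ => hf.sub (hf.shift _)
    rw [h1, hN.smul _ (IsTest.sum hst), abs_of_pos (inv_pos.2 hm0), inv_mul_le_iff₀ hm0]
    refine (hN.sum_le hst).trans ((Finset.sum_le_sum fun s hs => hCf f hf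
      (fun x hx => (hfR x hx).trans (by linarith)) B hB _ ?_).trans_eq (by simp))
    have hsm : (s : ℝ) ≤ m := by exact_mod_cast (Finset.mem_range.1 hs).le
    rw [abs_of_nonneg (by positivity)]
    exact (div_le_one_of_le₀ hsm hm0.le).trans (by linarith)

theorem IsInvariantSeminorm.exists_smoothing (hN : IsInvariantSeminorm N) {i j : Fin d}
    (hij : i ≠ j) {R : ℝ} (hR : 0 < R) (k : ℕ) :
    ∃ C, 0 ≤ C ∧ ∀ f, IsTest f → (∀ x, f x ≠ 0 → ‖x‖ ≤ R) → ∀ B : ℝ, 0 < B → (∀ x, |f x| ≤ B) →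
      (∀ x, ∫ t : ℝ, f (x - t • EuclideanSpace.single j (1 : ℝ)) = 0) →
      ∃ h, IsTest h ∧ (∀ x, h x ≠ 0 → ‖x‖ ≤ R + k) ∧ (∀ x, |h x| ≤ B) ∧
        (∀ x, ∫ t : ℝ, h (x - t • EuclideanSpace.single j (1 : ℝ)) = 0) ∧
        (∀ x, |(dirDeriv (EuclideanSpace.single j (1 : ℝ)))^[k] h x| ≤ 3 ^ k * B) ∧
        N (f - h) ≤ C * B := by
  induction k with
  | zero =>
    refine ⟨0, le_rfl, fun f hf hfR B _ hB hmean =>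
      ⟨f, hf, by simpa using hfR, hB, hmean, by simpa using hB, ?_⟩⟩
    rw [sub_self, hN.map_zero, zero_mul]
  | succ k ih =>
    obtain ⟨C₁, hC₁, h₁⟩ := ih
    obtain ⟨C₂, hC₂, h₂⟩ := hN.exists_smoothing_step hij (R := R + k) (by positivity) k
    refine ⟨C₁ + C₂, by positivity, fun f hf hfR B hB0 hB hmean => ?_⟩
    obtain ⟨g, hg, hgR, hgB, hgm, hgD, hfg⟩ := h₁ f hf hfR B hB0 hB hmean
    obtain ⟨h, hh, hhR, hhB, hhm, hhD, hgh⟩ := h₂ g hg hgR B hgB hgm (3 ^ k * B) (by positivity) hgD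
    refine ⟨h, hh, fun x hx => (hhR x hx).trans_eq (by push_cast; ring), hhB, hhm,
      fun x => (hhD x).trans_eq (by ring), ?_⟩
    have h3 := hN.add_le (hf.sub hg) (hg.sub hh)
    rw [sub_add_sub_cancel] at h3
    linarith

/-- Functions with zero mean on all lines parallel to a coordinate axis are controlled by their
supremum. -/
theorem IsInvariantSeminorm.exists_le_of_zero_mean (hN : IsInvariantSeminorm N)
    {i j : Fin d} (hij : i ≠ j) {R : ℝ} (hR : 0 < R) :
    ∃ C, 0 ≤ C ∧ ∀ f, IsTest f → (∀ x, f x ≠ 0 → ‖x‖ ≤ R) → ∀ B : ℝ, (∀ x, |f x| ≤ B) →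
      (∀ x, ∫ t : ℝ, f (x - t • EuclideanSpace.single j (1 : ℝ)) = 0) → N f ≤ C * B := by
  obtain ⟨C₁, hC₁, h₁⟩ := hN.exists_smoothing hij hR 4
  obtain ⟨C₂, hC₂, h₂⟩ := hN.exists_le_of_zero_mean_of_deriv hij
    (R := R + (4 : ℕ)) (by positivity)
  refine ⟨C₁ + C₂ * 3 ^ 4, by positivity, fun f hf hfR B hB hmean => ?_⟩
  rcases ((abs_nonneg _).trans (hB 0)).eq_or_lt with hB0 | hB0
  · have h0 : f = 0 := funext fun x => abs_nonpos_iff.1 ((hB x).trans_eq hB0.symm)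
    rw [h0, hN.map_zero, ← hB0, mul_zero]
  · obtain ⟨h, hh, hhR, hhB, hhm, hhD, hfh⟩ := h₁ f hf hfR B hB0 hB hmean
    have h3 := h₂ h hh hhR (3 ^ 4 * B) (fun x => (hhB x).trans (by linarith)) hhD hhm
    have h4 := hN.le_add_sub hf hh
    linarith

end LineAverage

section LineProjection

variable {d : ℕ} {f : EuclideanSpace ℝ (Fin d) → ℝ} {N : (EuclideanSpace ℝ (Fin d) → ℝ) → ℝ}

theorem continuous_unitBump : Continuous unitBump := contDiff_unitBump.continuous

theorem hasCompactSupport_unitBump : HasCompactSupport unitBump :=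
  HasCompactSupport.intro (isCompact_Icc (a := -1) (b := 1)) fun t ht => by
    by_contra h
    exact ht (abs_le.1 (abs_lt_one_of_unitBump_ne_zero h).le)

theorem integral_unitBump_pos : 0 < ∫ t, unitBump t :=
  continuous_unitBump.integral_pos_of_hasCompactSupport_nonneg_nonzero hasCompactSupport_unitBump
    unitBump_nonneg (x := 0) (by simp [unitBump_zero])

/-- The function with the same means along the lines parallel to the `j`-th axis as `f`, and with
the profile of the unit bump on each of these lines. -/
noncomputable def lineProj (j : Fin d) (f : EuclideanSpace ℝ (Fin d) → ℝ) :
    EuclideanSpace ℝ (Fin d) → ℝ := fun x =>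
  unitBump (x j) * ((∫ t, unitBump t)⁻¹ * ∫ s : ℝ, f (x - s • EuclideanSpace.single j (1 : ℝ)))

theorem norm_le_of_lineProj_ne_zero {R : ℝ} (hR : ∀ x, f x ≠ 0 → ‖x‖ ≤ R) {j : Fin d}
    (x : EuclideanSpace ℝ (Fin d)) (hx : lineProj j f x ≠ 0) : ‖x‖ ≤ R + 1 := by
  have h3 : ∃ s : ℝ, f (x - s • EuclideanSpace.single j (1 : ℝ)) ≠ 0 := by
    by_contra! h
    exact hx (by simp [lineProj, h])
  obtain ⟨s, hs⟩ := h3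
  exact norm_le_of_line (hR _ hs) (abs_lt_one_of_unitBump_ne_zero (left_ne_zero_of_mul hx)).le

theorem single_one_ne_zero (j : Fin d) : EuclideanSpace.single j (1 : ℝ) ≠ 0 := by
  simp

theorem IsTest.lineProj (hf : IsTest f) (j : Fin d) : IsTest (lineProj j f) := by
  obtain ⟨R, -, hR⟩ := hf.exists_radius
  have h := contDiff_lineIntegral (κ := fun _ => 1) continuous_const.locallyIntegrable
    (single_one_ne_zero j) hf
  simp only [one_mul] at h
  exact IsTest.of_radius ((contDiff_comp_apply contDiff_unitBump j).mul (contDiff_const.mul h))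
    (norm_le_of_lineProj_ne_zero hR)

theorem abs_lineProj_le {R B : ℝ} (hR0 : 0 ≤ R) (hR : ∀ x, f x ≠ 0 → ‖x‖ ≤ R)
    (hB : ∀ x, |f x| ≤ B) (j : Fin d) (x : EuclideanSpace ℝ (Fin d)) :
    |lineProj j f x| ≤ (∫ t, unitBump t)⁻¹ * (2 * (R + 1)) * B := by
  have hI := integral_unitBump_pos
  have hB0 : 0 ≤ B := (abs_nonneg _).trans (hB 0)
  by_cases hx : unitBump (x j) = 0
  · rw [lineProj, hx, zero_mul, abs_zero]
    positivity
  · rw [lineProj, abs_mul]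
    refine (mul_le_of_le_one_left (abs_nonneg _) (abs_unitBump_le _)).trans ?_
    rw [abs_mul, abs_of_pos (inv_pos.2 hI), mul_assoc]
    gcongr
    rw [mul_comm]
    exact abs_integral_le_of_support (by linarith) (fun s hs =>
      (abs_lt_of_line (hR _ hs) (abs_lt_one_of_unitBump_ne_zero hx)).le) fun s => hB _

theorem integral_line_translate (x : EuclideanSpace ℝ (Fin d)) (e : EuclideanSpace ℝ (Fin d))
    (t : ℝ) : ∫ s : ℝ, f (x + t • e - s • e) = ∫ s : ℝ, f (x - s • e) := by
  rw [← integral_sub_right_eq_self (fun s => f (x - s • e)) t]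
  refine integral_congr_ae (Eventually.of_forall fun s => ?_)
  simp only
  congr 1
  module

theorem integral_lineProj (hf : IsTest f) (j : Fin d) (x : EuclideanSpace ℝ (Fin d)) :
    ∫ t : ℝ, (f - lineProj j f) (x - t • EuclideanSpace.single j (1 : ℝ)) = 0 := by
  have h : ∀ t : ℝ, lineProj j f (x - t • EuclideanSpace.single j (1 : ℝ)) =
      unitBump (x j - t) * ((∫ t, unitBump t)⁻¹ *
        ∫ s : ℝ, f (x - s • EuclideanSpace.single j (1 : ℝ))) := fun t => by
    rw [lineProj, ← integral_line_translate x _ (-t)]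
    simp [sub_eq_add_neg]
  simp only [Pi.sub_apply]
  rw [integral_sub (hf.integrable_line (single_one_ne_zero j) x)
    ((hf.lineProj j).integrable_line (single_one_ne_zero j) x)]
  simp only [h]
  rw [integral_mul_const, integral_sub_left_eq_self unitBump, mul_inv_cancel_left₀
    integral_unitBump_pos.ne', sub_self]

/-- A function whose restriction to each line parallel to the `m`-th axis is proportional to the
unit bump. -/
def HasBumpProfile (m : Fin d) (f : EuclideanSpace ℝ (Fin d) → ℝ) : Prop :=
  ∀ (x : EuclideanSpace ℝ (Fin d)) (t : ℝ),
    f (x + t • EuclideanSpace.single m (1 : ℝ)) * unitBump (x m) = f x * unitBump (x m + t)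

theorem hasBumpProfile_lineProj (j : Fin d) (f : EuclideanSpace ℝ (Fin d) → ℝ) :
    HasBumpProfile j (lineProj j f) := fun x t => by
  rw [lineProj, integral_line_translate, lineProj]
  simp
  ring

theorem HasBumpProfile.lineProj {m j : Fin d} (h : HasBumpProfile m f) (hmj : m ≠ j) :
    HasBumpProfile m (lineProj j f) := fun x t => by
  have h1 : ∀ s : ℝ, f (x + t • EuclideanSpace.single m (1 : ℝ) -
      s • EuclideanSpace.single j (1 : ℝ)) * unitBump (x m) =
      f (x - s • EuclideanSpace.single j (1 : ℝ)) * unitBump (x m + t) := fun s => by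
    have h2 := h (x - s • EuclideanSpace.single j (1 : ℝ)) t
    rw [sub_add_eq_add_sub] at h2
    simpa [hmj] using h2
  simp only [_root_.lineProj]
  rw [mul_assoc, mul_assoc, ← integral_mul_const]
  simp only [h1]
  rw [integral_mul_const]
  simp [hmj.symm]
  ring

theorem sum_smul_single (x : EuclideanSpace ℝ (Fin d)) :
    ∑ m, x m • EuclideanSpace.single m (1 : ℝ) = x := by
  ext k
  simp [Finset.sum_apply, Pi.single_apply]

theorem norm_le_mul_of_abs_apply_le {b : ℝ} {x : EuclideanSpace ℝ (Fin d)}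
    (h : ∀ m, |x m| ≤ b) : ‖x‖ ≤ d * b := by
  rw [← sum_smul_single x]
  refine (norm_sum_le_of_le (n := fun _ => b) _ fun m _ => ?_).trans_eq (by simp)
  rw [norm_smul, PiLp.norm_single, norm_one, mul_one]
  exact h m

theorem eq_mul_prod_unitBump (h : ∀ m, HasBumpProfile m f) (x : EuclideanSpace ℝ (Fin d)) :
    f x = f 0 * ∏ m, unitBump (x m) := by
  classical
  suffices ∀ s : Finset (Fin d), f (∑ m ∈ s, x m • EuclideanSpace.single m (1 : ℝ)) =
      f 0 * ∏ m ∈ s, unitBump (x m) by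
    rw [← this, sum_smul_single]
  intro s
  induction s using Finset.induction_on with
  | empty => simp
  | insert a s ha ih =>
    have h1 := h a (∑ m ∈ s, x m • EuclideanSpace.single m (1 : ℝ)) (x a)
    have h2 : (∑ m ∈ s, x m • EuclideanSpace.single m (1 : ℝ)) a = 0 := by
      simp [Pi.single_apply, ha]
    rw [h2, unitBump_zero, mul_one, zero_add] at h1
    rw [Finset.sum_insert ha, add_comm, h1, ih, Finset.prod_insert ha]
    ring

theorem isTest_prod_unitBump : IsTest fun x : EuclideanSpace ℝ (Fin d) => ∏ m, unitBump (x m) := by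
  refine IsTest.of_radius (R := d * 1)
    (contDiff_prod fun m _ => contDiff_comp_apply contDiff_unitBump m) fun x hx => ?_
  exact norm_le_mul_of_abs_apply_le fun m =>
    (abs_lt_one_of_unitBump_ne_zero (Finset.prod_ne_zero_iff.1 hx m (Finset.mem_univ m))).le

theorem IsInvariantSeminorm.exists_hasBumpProfile [Nontrivial (Fin d)] (hN : IsInvariantSeminorm N)
    (J : Finset (Fin d)) {R : ℝ} (hR : 0 < R) :
    ∃ C A R', 0 ≤ C ∧ 0 ≤ A ∧ 0 < R' ∧ ∀ f, IsTest f → (∀ x, f x ≠ 0 → ‖x‖ ≤ R) → ∀ B : ℝ,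
      (∀ x, |f x| ≤ B) → ∃ g, IsTest g ∧ (∀ x, g x ≠ 0 → ‖x‖ ≤ R') ∧ (∀ x, |g x| ≤ A * B) ∧
        (∀ m ∈ J, HasBumpProfile m g) ∧ N (f - g) ≤ C * B := by
  classical
  have hI := integral_unitBump_pos
  induction J using Finset.induction_on with
  | empty =>
    refine ⟨0, 1, R, le_rfl, zero_le_one, hR, fun f hf hfR B hB =>
      ⟨f, hf, hfR, by simpa using hB, by simp, ?_⟩⟩
    rw [sub_self, hN.map_zero, zero_mul]
  | insert j J hj ih =>
    obtain ⟨C, A, R', hC, hA, hR', h⟩ := ih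
    obtain ⟨i, hij⟩ := exists_ne j
    obtain ⟨C', hC', h'⟩ := hN.exists_le_of_zero_mean hij (R := R' + 1) (by linarith)
    set Q := (∫ t, unitBump t)⁻¹ * (2 * (R' + 1)) with hQ
    have hQ0 : 0 ≤ Q := by positivity
    refine ⟨C + C' * (A + Q * A), Q * A, R' + 1, by positivity, by positivity, by linarith,
      fun f hf hfR B hB => ?_⟩
    obtain ⟨g, hg, hgR, hgB, hgJ, hfg⟩ := h f hf hfR B hB
    have hgB' := abs_lineProj_le hR'.le hgR hgB j
    refine ⟨lineProj j g, hg.lineProj j, norm_le_of_lineProj_ne_zero hgR,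
      fun x => (hgB' x).trans_eq (by ring), fun m hm => ?_, ?_⟩
    · rcases Finset.mem_insert.1 hm with rfl | hm
      · exact hasBumpProfile_lineProj m g
      · exact (hgJ m hm).lineProj fun hmj => hj (hmj ▸ hm)
    · have h3 := h' (g - lineProj j g) (hg.sub (hg.lineProj j)) (fun x hx => ?_)
        ((A + Q * A) * B) (fun x => ?_) (integral_lineProj hg j)
      · have h4 := hN.add_le (hf.sub hg) (hg.sub (hg.lineProj j))
        rw [sub_add_sub_cancel] at h4
        linarith
      · by_cases hgx : g x = 0
        · refine norm_le_of_lineProj_ne_zero hgR (j := j) x fun h0 => hx ?_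
          rw [Pi.sub_apply, hgx, h0, sub_zero]
        · linarith [hgR x hgx]
      · have h4 := abs_sub (g x) (lineProj j g x)
        have h5 := hgB x
        have h6 := hgB' x
        rw [Pi.sub_apply]
        linarith

/-- On functions supported in a fixed ball an invariant seminorm is controlled by the supremum. -/
theorem IsInvariantSeminorm.exists_le_of_support [Nontrivial (Fin d)] (hN : IsInvariantSeminorm N)
    {R : ℝ} (hR : 0 < R) :
    ∃ C, 0 ≤ C ∧ ∀ f, IsTest f → (∀ x, f x ≠ 0 → ‖x‖ ≤ R) → ∀ B : ℝ, (∀ x, |f x| ≤ B) →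
      N f ≤ C * B := by
  obtain ⟨C, A, R', hC, hA, hR', h⟩ := hN.exists_hasBumpProfile Finset.univ hR
  have hP := hN.nonneg (isTest_prod_unitBump (d := d))
  refine ⟨A * N (fun x => ∏ m, unitBump (x m)) + C, by positivity, fun f hf hfR B hB => ?_⟩
  obtain ⟨g, hg, hgR, hgB, hgJ, hfg⟩ := h f hf hfR B hB
  have h1 : g = g 0 • fun x => ∏ m, unitBump (x m) :=
    funext fun x => eq_mul_prod_unitBump (fun m => hgJ m (Finset.mem_univ m)) x
  have h2 : N g = |g 0| * N fun x => ∏ m, unitBump (x m) := by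
    nth_rw 1 [h1]
    exact hN.smul _ isTest_prod_unitBump
  have h3 := hN.le_add_sub hf hg
  have h4 := mul_le_mul_of_nonneg_right (hgB 0) hP
  linarith

end LineProjection

section LatticeSwaps

variable {d : ℕ} {N : (EuclideanSpace ℝ (Fin d) → ℝ) → ℝ}

theorem norm_sub_two_smul_planeProj {i j : Fin d} (hij : i ≠ j) (v : EuclideanSpace ℝ (Fin d)) :
    ‖v - (2 : ℝ) • planeProj i j v‖ = ‖v‖ := by
  rw [EuclideanSpace.norm_eq, EuclideanSpace.norm_eq]
  congr 1
  refine Finset.sum_congr rfl fun k _ => ?_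
  rw [planeProj_apply]
  by_cases hki : k = i
  · subst hki
    simp only [PiLp.sub_apply, PiLp.smul_apply, PiLp.add_apply, PiLp.single_apply, if_true, hij,
      if_false, smul_eq_mul, Real.norm_eq_abs, sq_abs]
    ring
  · by_cases hkj : k = j
    · subst hkj
      simp only [PiLp.sub_apply, PiLp.smul_apply, PiLp.add_apply, PiLp.single_apply, if_true, hki,
        if_false, smul_eq_mul, Real.norm_eq_abs, sq_abs]
      ring
    · simp [hki, hkj]

/-- The points of the lattice of mesh `ε`, translated by `ε • w`. -/
noncomputable def latticePoint (ε : ℝ) (w : Fin d → ℝ) (p : Fin d → ℤ) : EuclideanSpace ℝ (Fin d) :=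
  WithLp.toLp 2 fun m => ε * (p m + w m)

theorem latticePoint_apply (ε : ℝ) (w : Fin d → ℝ) (p : Fin d → ℤ) (m : Fin d) :
    latticePoint ε w p m = ε * (p m + w m) := rfl

theorem le_norm_latticePoint_sub {ε : ℝ} (hε : 0 < ε) (w : Fin d → ℝ) {p q : Fin d → ℤ}
    (hpq : p ≠ q) : ε ≤ ‖latticePoint ε w p - latticePoint ε w q‖ := by
  obtain ⟨k, hk⟩ := Function.ne_iff.1 hpq
  refine le_trans ?_ (PiLp.norm_apply_le _ k)
  have h1 : (1 : ℝ) ≤ |(p k : ℝ) - q k| := by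
    exact_mod_cast Int.one_le_abs (sub_ne_zero.2 hk)
  rw [PiLp.sub_apply, latticePoint_apply, latticePoint_apply, ← mul_sub, add_sub_add_right_eq_sub,
    Real.norm_eq_abs, abs_mul, abs_of_pos hε]
  exact le_mul_of_one_le_right hε.le h1

theorem latticePoint_unique {ε r : ℝ} (hr : 2 * r < ε) (hε : 0 < ε) {w : Fin d → ℝ}
    {p q : Fin d → ℤ} {x : EuclideanSpace ℝ (Fin d)} (hp : ‖x - latticePoint ε w p‖ ≤ r)
    (hq : ‖x - latticePoint ε w q‖ ≤ r) : p = q := by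
  by_contra h
  have h1 := le_norm_latticePoint_sub hε w h
  have h2 := norm_sub_le_norm_sub_add_norm_sub (latticePoint ε w p) x (latticePoint ε w q)
  rw [norm_sub_rev _ x] at h2
  linarith

/-- `σ` is realized by a diffeomorphism permuting the balls of radius `r` around lattice points. -/
def IsRealizable (ε r : ℝ) (w : Fin d → ℝ) (σ : Equiv.Perm (Fin d → ℤ)) : Prop :=
  ∃ Φ, IsCompSuppVolDiffeo d Φ ∧ ∀ s x, ‖Φ x - latticePoint ε w s‖ ≤ r →
    ‖x - latticePoint ε w (σ s)‖ ≤ r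

theorem isRealizable_swap_add_single [Nontrivial (Fin d)] {ε : ℝ} (hε : 0 < ε) (w : Fin d → ℝ)
    (p : Fin d → ℤ) (i : Fin d) :
    IsRealizable ε (ε / 10) w (Equiv.swap p (p + Pi.single i 1)) := by
  obtain ⟨j, hji⟩ := exists_ne i
  have hij := hji.symm
  set q := p + Pi.single i 1 with hq
  have hqi : q i = p i + 1 := by simp [hq]
  have hqk : ∀ k, k ≠ i → q k = p k := fun k hk => by simp [hq, hk]
  set e := EuclideanSpace.single i (1 : ℝ) with he
  have hen : ‖e‖ = 1 := by simp [he]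
  set m := latticePoint ε w p + (ε / 2) • e with hm
  obtain ⟨Φ, hΦ, hΦ1, hΦ2⟩ := exists_volDiffeo_halfTurn hij m (r₁ := 6 / 10 * ε) (r₂ := 8 / 10 * ε)
    (by positivity) (by linarith)
  have hinj : Function.Injective Φ := by
    obtain ⟨-, ⟨Ψ, -, hΨ, -⟩, -⟩ := hΦ
    exact hΨ.injective
  have hmp : latticePoint ε w p - m = -((ε / 2) • e) := by rw [hm]; abel
  have hmq : latticePoint ε w q - m = (ε / 2) • e := by
    ext k
    rw [hm]
    simp only [PiLp.sub_apply, PiLp.add_apply, PiLp.smul_apply, latticePoint_apply, he,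
      PiLp.single_apply, smul_eq_mul]
    by_cases hk : k = i
    · subst hk
      rw [hqi, if_pos rfl]
      push_cast
      ring
    · rw [hqk k hk, if_neg hk]
      ring
  have hPe : planeProj i j e = e := by simp [planeProj_apply, he, hij]
  have hturn : ∀ a b x, a - m = -(b - m) → planeProj i j (a - m) = a - m →
      ‖a - m‖ ≤ ε / 2 → ‖Φ x - a‖ ≤ ε / 10 → ‖x - b‖ ≤ ε / 10 := fun a b x hab hPa han hx => by
    set y := Φ x with hy
    set x' := y - (2 : ℝ) • planeProj i j (y - m) with hx'
    have h1 : x' - m = (y - m) - (2 : ℝ) • planeProj i j (y - m) := by rw [hx']; abel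
    have h2 : ‖x' - m‖ ≤ 6 / 10 * ε := by
      rw [h1, norm_sub_two_smul_planeProj hij]
      have := norm_sub_le_norm_sub_add_norm_sub y a m
      linarith
    have h3 : Φ x' = Φ x := by
      rw [hΦ1 x' h2, h1, map_sub, map_smul, planeProj_planeProj hij, hx', ← hy]
      module
    have h4 : b = a - (2 : ℝ) • planeProj i j (a - m) := by
      rw [hPa]
      have h5 : b - m = -(a - m) := by rw [hab, neg_neg]
      have h6 : b = m + -(a - m) := by rw [← h5]; abel
      rw [h6]
      module
    have h5 : x - b = (y - a) - (2 : ℝ) • planeProj i j (y - a) := by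
      rw [← hinj h3, hx', h4]
      have h6 : planeProj i j (y - a) = planeProj i j (y - m) - planeProj i j (a - m) := by
        rw [← map_sub, sub_sub_sub_cancel_right]
      rw [h6]
      module
    rw [h5, norm_sub_two_smul_planeProj hij]
    exact hx
  have hhalf : ‖(ε / 2) • e‖ ≤ ε / 2 := by
    rw [norm_smul, hen, mul_one, Real.norm_of_nonneg (by positivity)]
  refine ⟨Φ, hΦ, fun s x hx => ?_⟩
  by_cases hsp : s = p
  · rw [hsp, Equiv.swap_apply_left]
    refine hturn _ _ x (by rw [hmp, hmq]) ?_ ?_ (hsp ▸ hx)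
    · rw [hmp, map_neg, map_smul, hPe]
    · rw [hmp, norm_neg]
      exact hhalf
  by_cases hsq : s = q
  · rw [hsq, Equiv.swap_apply_right]
    refine hturn _ _ x (by rw [hmp, hmq, neg_neg]) ?_ ?_ (hsq ▸ hx)
    · rw [hmq, map_smul, hPe]
    · rw [hmq]
      exact hhalf
  rw [Equiv.swap_apply_of_ne_of_ne hsp hsq]
  have hfar : ε ≤ ‖latticePoint ε w s - m‖ := by
    have hcoord : ∃ k, ε ≤ |(latticePoint ε w s - m) k| := by
      by_cases h : ∃ k, k ≠ i ∧ s k ≠ p k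
      · obtain ⟨k, hk, hsk⟩ := h
        refine ⟨k, ?_⟩
        have h1 : (1 : ℝ) ≤ |(s k : ℝ) - p k| := by
          exact_mod_cast Int.one_le_abs (sub_ne_zero.2 hsk)
        have h2 : (latticePoint ε w s - m) k = ε * (s k - p k) := by
          simp only [hm, PiLp.sub_apply, PiLp.add_apply, PiLp.smul_apply, latticePoint_apply, he,
            PiLp.single_apply, smul_eq_mul, if_neg hk]
          ring
        rw [h2, abs_mul, abs_of_pos hε]
        exact le_mul_of_one_le_right hε.le h1
      · push Not at h
        refine ⟨i, ?_⟩
        have h1 : s i ≠ p i := fun h1 => hsp (funext fun k => by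
          by_cases hk : k = i
          · rw [hk, h1]
          · exact h k hk)
        have h2 : s i ≠ p i + 1 := fun h2 => hsq (funext fun k => by
          by_cases hk : k = i
          · rw [hk, h2, hqi]
          · rw [h k hk, hqk k hk])
        have h3 : (latticePoint ε w s - m) i = ε * (s i - p i - 1 / 2) := by
          simp only [hm, PiLp.sub_apply, PiLp.add_apply, PiLp.smul_apply, latticePoint_apply, he,
            PiLp.single_apply, smul_eq_mul, if_true]
          ring
        rw [h3, abs_mul, abs_of_pos hε]
        refine le_mul_of_one_le_right hε.le (le_abs.2 ?_)
        rcases lt_or_gt_of_ne h1 with h4 | h4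
        · right
          have h5 : (s i : ℝ) + 1 ≤ p i := by exact_mod_cast h4
          linarith
        · left
          have h5 : (p i : ℝ) + 2 ≤ s i := by
            have : p i + 2 ≤ s i := by omega
            exact_mod_cast this
          linarith
    obtain ⟨k, hk⟩ := hcoord
    exact hk.trans (PiLp.norm_apply_le (latticePoint ε w s - m) k)
  have h1 : 8 / 10 * ε ≤ ‖Φ x - m‖ := by
    have h2 := norm_sub_le_norm_sub_add_norm_sub (latticePoint ε w s) (Φ x) m
    rw [norm_sub_rev _ (Φ x)] at h2
    linarith
  rwa [hinj (hΦ2 _ h1)] at hx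

/-- The seminorm of a sum of functions supported in the balls of radius `r` around the lattice
points in `S` is controlled by the supremum. -/
def IsControlled (N : (EuclideanSpace ℝ (Fin d) → ℝ) → ℝ) (C ε r : ℝ) (w : Fin d → ℝ)
    (S : Finset (Fin d → ℤ)) : Prop :=
  ∀ (a : (Fin d → ℤ) → EuclideanSpace ℝ (Fin d) → ℝ) (B : ℝ), 0 ≤ B →
    (∀ p ∈ S, IsTest (a p)) → (∀ p ∈ S, ∀ x, a p x ≠ 0 → ‖x - latticePoint ε w p‖ ≤ r) →
    (∀ p ∈ S, ∀ x, |a p x| ≤ B) → N (∑ p ∈ S, a p) ≤ C * B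

variable {C ε r : ℝ} {w : Fin d → ℝ} {S T : Finset (Fin d → ℤ)}

theorem IsControlled.of_image (hN : IsInvariantSeminorm N) {σ : Equiv.Perm (Fin d → ℤ)}
    (hσ : IsRealizable ε r w σ) (h : IsControlled N C ε r w (S.image σ)) :
    IsControlled N C ε r w S := fun a B hB ha hs hab => by
  obtain ⟨Φ, hΦ, hΦs⟩ := hσ
  have hsum : (∑ p ∈ S, a p) ∘ Φ = ∑ q ∈ S.image σ, a (σ.symm q) ∘ Φ := by
    rw [Finset.sum_image σ.injective.injOn]
    funext x
    simp [Finset.sum_apply]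
  rw [← hN.comp (IsTest.sum ha) hΦ, hsum]
  refine h _ B hB (fun q hq => ?_) (fun q hq x hx => ?_) fun q hq x => ?_ <;>
    obtain ⟨p, hp, rfl⟩ := Finset.mem_image.1 hq
  · rw [σ.symm_apply_apply]
    exact (ha p hp).comp hΦ
  · rw [σ.symm_apply_apply] at hx
    exact hΦs p x (hs p hp _ hx)
  · rw [σ.symm_apply_apply]
    exact hab p hp _

theorem IsControlled.mono (hST : S ⊆ T)
    (h : IsControlled N C ε r w T) : IsControlled N C ε r w S := fun a B hB ha hs hab => by
  classical
  have hsum : ∑ p ∈ S, a p = ∑ p ∈ T, if p ∈ S then a p else 0 := by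
    rw [Finset.sum_ite_mem, Finset.inter_eq_right.2 hST]
  rw [hsum]
  refine h _ B hB (fun p _ => ?_) (fun p _ x hx => ?_) fun p _ x => ?_ <;> by_cases hp : p ∈ S
  · simpa [hp] using ha p hp
  · simpa [hp] using IsTest.zero
  · simp only [hp, if_true] at hx
    exact hs p hp x hx
  · simp [hp] at hx
  · simpa [hp] using hab p hp x
  · simpa [hp] using hB

/-- The control of a sum over a finite set of lattice points can be transported along `σ`. -/
def IsTransport (N : (EuclideanSpace ℝ (Fin d) → ℝ) → ℝ) (C ε r : ℝ) (w : Fin d → ℝ)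
    (σ : Equiv.Perm (Fin d → ℤ)) : Prop :=
  ∀ S : Finset (Fin d → ℤ), IsControlled N C ε r w (S.image σ) → IsControlled N C ε r w S

theorem IsTransport.mul {σ τ : Equiv.Perm (Fin d → ℤ)} (hσ : IsTransport N C ε r w σ)
    (hτ : IsTransport N C ε r w τ) : IsTransport N C ε r w (σ * τ) := fun S h => by
  refine hτ S (hσ _ ?_)
  rwa [Finset.image_image, ← Equiv.Perm.coe_mul]

theorem isTransport_swap_trans {p q s : Fin d → ℤ}
    (h1 : IsTransport N C ε r w (Equiv.swap p q)) (h2 : IsTransport N C ε r w (Equiv.swap q s)) :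
    IsTransport N C ε r w (Equiv.swap p s) := by
  by_cases hpq : p = q
  · rwa [hpq]
  by_cases hps : p = s
  · intro S h
    rw [hps, Equiv.swap_self] at h
    simpa using h
  have h3 := (h2.mul h1).mul h2
  rw [Equiv.swap_mul_swap_mul_swap hpq hps] at h3
  rwa [Equiv.swap_comm]

theorem isTransport_swap [Nontrivial (Fin d)] (hN : IsInvariantSeminorm N) (hε : 0 < ε)
    (p q : Fin d → ℤ) : IsTransport N C ε (ε / 10) w (Equiv.swap p q) := by
  have hrefl : ∀ p, IsTransport N C ε (ε / 10) w (Equiv.swap p p) := fun p S h => by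
    rw [Equiv.swap_self] at h
    simpa using h
  have hstep : ∀ p i, IsTransport N C ε (ε / 10) w (Equiv.swap p (p + Pi.single i 1)) :=
    fun p i S h => h.of_image hN (isRealizable_swap_add_single hε w p i)
  have hline : ∀ i (z : ℤ) p, IsTransport N C ε (ε / 10) w (Equiv.swap p (p + Pi.single i z)) :=
      fun i z => by
    induction z using Int.induction_on with
    | zero => simpa using hrefl
    | succ k ih =>
      intro p
      refine isTransport_swap_trans (ih p) ?_
      rw [Pi.single_add, ← add_assoc]
      exact hstep _ i
    | pred k ih =>
      intro p
      refine isTransport_swap_trans (ih p) ?_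
      rw [Equiv.swap_comm]
      have h1 := hstep (p + Pi.single i (-(k : ℤ) - 1)) i
      rwa [add_assoc, ← Pi.single_add, sub_add_cancel] at h1
  suffices ∀ s : Finset (Fin d),
      IsTransport N C ε (ε / 10) w (Equiv.swap p (p + ∑ i ∈ s, Pi.single i (q i - p i))) by
    have h1 := this Finset.univ
    rwa [Finset.univ_sum_single (fun i => q i - p i),
      show (p + fun i => q i - p i) = q from funext fun i => add_sub_cancel _ _] at h1
  intro s
  induction s using Finset.induction_on with
  | empty => simpa using hrefl p
  | insert i s hi ih =>
    refine isTransport_swap_trans ih ?_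
    rw [Finset.sum_insert hi, add_comm (Pi.single i _), ← add_assoc]
    exact hline i _ _

theorem IsControlled.of_card_eq [Nontrivial (Fin d)] (hN : IsInvariantSeminorm N) (hε : 0 < ε)
    (hT : IsControlled N C ε (ε / 10) w T) (hST : S.card = T.card) :
    IsControlled N C ε (ε / 10) w S := by
  induction hn : (S \ T).card using Nat.strong_induction_on generalizing S with
  | _ n ih =>
    by_cases hsub : S ⊆ T
    · rwa [Finset.eq_of_subset_of_card_le hsub hST.ge]
    obtain ⟨p, hpS, hpT⟩ := Finset.not_subset.1 hsub
    have hsub' : ¬ T ⊆ S := fun h => hsub (Finset.eq_of_subset_of_card_le h hST.le).ge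
    obtain ⟨q, hqT, hqS⟩ := Finset.not_subset.1 hsub'
    refine isTransport_swap hN hε p q S (ih _ ?_ ?_ rfl)
    · rw [← hn]
      refine Finset.card_lt_card ((Finset.ssubset_iff_of_subset fun s hs => ?_).2
        ⟨p, Finset.mem_sdiff.2 ⟨hpS, hpT⟩, fun h => ?_⟩)
      · obtain ⟨hs1, hs2⟩ := Finset.mem_sdiff.1 hs
        obtain ⟨t, ht, rfl⟩ := Finset.mem_image.1 hs1
        have htq : t ≠ q := fun h => hqS (h ▸ ht)
        have htp : t ≠ p := fun h => hs2 (by rwa [h, Equiv.swap_apply_left])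
        rw [Equiv.swap_apply_of_ne_of_ne htp htq] at hs2 ⊢
        exact Finset.mem_sdiff.2 ⟨ht, hs2⟩
      · obtain ⟨t, ht, htp⟩ := Finset.mem_image.1 (Finset.mem_sdiff.1 h).1
        rw [Equiv.swap_apply_eq_iff, Equiv.swap_apply_left] at htp
        exact hqS (htp ▸ ht)
    · rw [Finset.card_image_of_injective _ (Equiv.injective _), hST]

theorem IsControlled.of_card_le [Nontrivial (Fin d)] (hN : IsInvariantSeminorm N) (hε : 0 < ε)
    (hT : IsControlled N C ε (ε / 10) w T) (hST : S.card ≤ T.card) :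
    IsControlled N C ε (ε / 10) w S := by
  have : Nonempty (Fin d) := Nontrivial.to_nonempty
  obtain ⟨U, hSU, hU⟩ := Infinite.exists_superset_card_eq S _ hST
  exact (hT.of_card_eq hN hε hU).mono hSU

end LatticeSwaps

section Globalization

variable {d : ℕ} {N : (EuclideanSpace ℝ (Fin d) → ℝ) → ℝ}

theorem abs_sum_le_of_support {ε r B : ℝ} (hε : 0 < ε) (hr : 2 * r < ε) {w : Fin d → ℝ}
    {S : Finset (Fin d → ℤ)} {a : (Fin d → ℤ) → EuclideanSpace ℝ (Fin d) → ℝ} (hB : 0 ≤ B)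
    (hs : ∀ p ∈ S, ∀ x, a p x ≠ 0 → ‖x - latticePoint ε w p‖ ≤ r)
    (ha : ∀ p ∈ S, ∀ x, |a p x| ≤ B) (x : EuclideanSpace ℝ (Fin d)) : |(∑ p ∈ S, a p) x| ≤ B := by
  rw [Finset.sum_apply]
  by_cases h : ∃ p ∈ S, a p x ≠ 0
  · obtain ⟨p, hp, hpx⟩ := h
    rw [Finset.sum_eq_single_of_mem p hp fun q hq hqp => ?_]
    · exact ha p hp x
    · by_contra hqx
      exact hqp (latticePoint_unique hr hε (hs q hq x hqx) (hs p hp x hpx))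
  · push Not at h
    rwa [Finset.sum_eq_zero h, abs_zero]

theorem IsInvariantSeminorm.exists_isControlled_of_card_le [Nontrivial (Fin d)]
    (hN : IsInvariantSeminorm N) :
    ∃ C, 0 ≤ C ∧ ∀ k : ℕ, 0 < k → ∀ w : Fin d → ℝ, (∀ m, 0 ≤ w m ∧ w m ≤ 1) →
      ∀ S : Finset (Fin d → ℤ), S.card ≤ k ^ d → IsControlled N C (1 / k) (1 / k / 10) w S := by
  obtain ⟨C, hC, h⟩ := hN.exists_le_of_support (R := d + 1) (by positivity)
  refine ⟨C, hC, fun k hk w hw S hS => ?_⟩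
  have hk0 : (0 : ℝ) < k := Nat.cast_pos.2 hk
  have hk1 : (1 : ℝ) / k ≤ 1 := by
    rw [div_le_one hk0]
    exact_mod_cast hk
  have hε : (0 : ℝ) < 1 / k := by positivity
  refine IsControlled.of_card_le (T := Fintype.piFinset fun _ => Finset.Ico 0 (k : ℤ)) hN hε ?_
    (by simpa using hS)
  intro a B hB ha hs hab
  refine h _ (IsTest.sum ha) (fun x hx => ?_) B
    (abs_sum_le_of_support hε (by linarith) hB hs hab)
  rw [Finset.sum_apply] at hx
  obtain ⟨p, hp, hpx⟩ := Finset.exists_ne_zero_of_sum_ne_zero hx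
  have h1 := hs p hp x hpx
  have h2 : ‖latticePoint (1 / (k : ℝ)) w p‖ ≤ d * 1 := norm_le_mul_of_abs_apply_le fun m => by
    obtain ⟨h3, h4⟩ := Finset.mem_Ico.1 (Fintype.mem_piFinset.1 hp m)
    have h5 : (0 : ℝ) ≤ p m := by exact_mod_cast h3
    have h6 : (p m : ℝ) + 1 ≤ k := by exact_mod_cast h4
    rw [latticePoint_apply, abs_of_nonneg (mul_nonneg hε.le (add_nonneg h5 (hw m).1)),
      one_div_mul_eq_div, div_le_one hk0]
    linarith [(hw m).2]
  have h3 := norm_le_norm_add_norm_sub' x (latticePoint (1 / (k : ℝ)) w p)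
  linarith

theorem exists_subset_card_eq_forall_le {ι : Type*} [DecidableEq ι] (s : ι → ℝ) (S : Finset ι)
    {m : ℕ} (hm : m ≤ S.card) :
    ∃ U ⊆ S, U.card = m ∧ ∀ u ∈ U, ∀ v ∈ S \ U, s v ≤ s u := by
  induction m with
  | zero => exact ⟨∅, Finset.empty_subset _, rfl, by simp⟩
  | succ m ih =>
    obtain ⟨U, hUS, hUm, hU⟩ := ih (by omega)
    have hne : (S \ U).Nonempty := by
      rw [← Finset.card_pos, Finset.card_sdiff_of_subset hUS]
      omega
    obtain ⟨a, ha, hmax⟩ := Finset.exists_max_image (S \ U) s hne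
    obtain ⟨haS, haU⟩ := Finset.mem_sdiff.1 ha
    refine ⟨insert a U, Finset.insert_subset haS hUS, by rw [Finset.card_insert_of_notMem haU, hUm],
      fun u hu v hv => ?_⟩
    obtain ⟨hvS, hvU⟩ := Finset.mem_sdiff.1 hv
    have hv' : v ∈ S \ U := Finset.mem_sdiff.2 ⟨hvS, fun h => hvU (Finset.mem_insert_of_mem h)⟩
    rcases Finset.mem_insert.1 hu with rfl | hu
    · exact hmax v hv'
    · exact hU u hu v hv'

/-- Rearrangement: sums over many cells are controlled by the largest cells and by the average. -/
theorem IsInvariantSeminorm.sum_le_of_isControlled (hN : IsInvariantSeminorm N) {C ε r : ℝ}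
    {w : Fin d → ℝ} {M : ℕ} (hM : 0 < M) (hC : 0 ≤ C)
    (h : ∀ S : Finset (Fin d → ℤ), S.card ≤ M → IsControlled N C ε r w S)
    {a : (Fin d → ℤ) → EuclideanSpace ℝ (Fin d) → ℝ} (ha : ∀ p, IsTest (a p))
    (hs : ∀ p x, a p x ≠ 0 → ‖x - latticePoint ε w p‖ ≤ r)
    {s : (Fin d → ℤ) → ℝ} (has : ∀ p x, |a p x| ≤ s p) (S : Finset (Fin d → ℤ)) {σ : ℝ}
    (hσ0 : 0 ≤ σ) (hσ : ∀ p ∈ S, s p ≤ σ) :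
    N (∑ p ∈ S, a p) ≤ C * (σ + (M : ℝ)⁻¹ * ∑ p ∈ S, s p) := by
  classical
  have hM0 : (0 : ℝ) < M := Nat.cast_pos.2 hM
  have hs0 : ∀ p, 0 ≤ s p := fun p => (abs_nonneg _).trans (has p 0)
  induction hn : S.card using Nat.strong_induction_on generalizing S σ with
  | _ n ih =>
    by_cases hSM : S.card ≤ M
    · refine (h S hSM a σ hσ0 (fun p _ => ha p) (fun p _ => hs p)
        fun p hp x => (has p x).trans (hσ p hp)).trans ?_
      have h1 : 0 ≤ (M : ℝ)⁻¹ * ∑ p ∈ S, s p :=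
        mul_nonneg (by positivity) (Finset.sum_nonneg fun p _ => hs0 p)
      gcongr
      linarith
    · obtain ⟨U, hUS, hUM, hU⟩ := exists_subset_card_eq_forall_le s S (not_le.1 hSM).le
      have h1 := h U hUM.le a σ hσ0 (fun p _ => ha p) (fun p _ => hs p)
        fun p hp x => (has p x).trans (hσ p (hUS hp))
      have hτ0 : 0 ≤ (M : ℝ)⁻¹ * ∑ p ∈ U, s p :=
        mul_nonneg (by positivity) (Finset.sum_nonneg fun p _ => hs0 p)
      have hcard : (S \ U).card < n := by
        rw [Finset.card_sdiff_of_subset hUS]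
        omega
      have h2 := ih _ hcard (S \ U) hτ0 (fun p hp => by
        rw [le_inv_mul_iff₀ hM0, ← hUM, ← nsmul_eq_mul]
        exact Finset.card_nsmul_le_sum _ _ _ fun u hu => hU u hu p hp) rfl
      have h3 := hN.add_le (IsTest.sum (s := S \ U) fun p _ => ha p)
        (IsTest.sum (s := U) fun p _ => ha p)
      rw [Finset.sum_sdiff hUS] at h3
      rw [← Finset.sum_sdiff hUS (f := s)]
      linarith

theorem exists_lattice_decomposition {F : EuclideanSpace ℝ (Fin d) → ℝ} (hF : IsTest F) {ε : ℝ}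
    (hε : 0 < ε) (w : Fin d → ℝ) (h : ∀ x, F x ≠ 0 → ∃ p, ‖x - latticePoint ε w p‖ ≤ ε / 10) :
    ∃ a : (Fin d → ℤ) → EuclideanSpace ℝ (Fin d) → ℝ, (∀ p, IsTest (a p)) ∧
      (∀ p x, a p x ≠ 0 → ‖x - latticePoint ε w p‖ ≤ ε / 10) ∧ (∀ p x, |a p x| ≤ |F x|) ∧
      ∀ S : Finset (Fin d → ℤ), (∀ p x, F x ≠ 0 → ‖x - latticePoint ε w p‖ ≤ ε / 10 → p ∈ S) →
        F = ∑ p ∈ S, a p := by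
  let b : ∀ p, ContDiffBump (latticePoint ε w p) := fun p =>
    ⟨ε / 10, ε / 5, by positivity, by linarith⟩
  have hsupp : ∀ p x, (b p x) * F x ≠ 0 → ‖x - latticePoint ε w p‖ ≤ ε / 10 := fun p x hx => by
    obtain ⟨q, hq⟩ := h x (right_ne_zero_of_mul hx)
    have h1 : x ∈ Metric.ball (latticePoint ε w p) (ε / 5) := by
      rw [← (b p).support_eq]
      exact left_ne_zero_of_mul hx
    rw [mem_ball_iff_norm] at h1
    rwa [latticePoint_unique (r := ε / 5) (by linarith) hε h1.le (hq.trans (by linarith))]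
  refine ⟨fun p => b p * F, fun p => hF.mul_left (b p).contDiff, hsupp, fun p x => ?_,
    fun S hS => ?_⟩
  · change |b p x * F x| ≤ _
    rw [abs_mul, abs_of_nonneg (b p).nonneg]
    exact mul_le_of_le_one_left (abs_nonneg _) (b p).le_one
  · funext x
    rw [Finset.sum_apply]
    by_cases hx : F x = 0
    · simp [hx]
    · obtain ⟨p, hp⟩ := h x hx
      rw [Finset.sum_eq_single_of_mem p (hS p x hx hp) fun q _ hqp => ?_]
      · rw [Pi.mul_apply, (b p).one_of_mem_closedBall (mem_closedBall_iff_norm.2 hp), one_mul]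
      · by_contra hq
        exact hqp (latticePoint_unique (by linarith) hε (hsupp q x hq) hp)

theorem sum_latticePoint_le_integral {f : EuclideanSpace ℝ (Fin d) → ℝ} (hf : IsTest f) {ε ω : ℝ}
    (hε : 0 < ε) (hω : ∀ x y, ‖x - y‖ ≤ ε / 10 → |f x - f y| ≤ ω) (w : Fin d → ℝ)
    (S : Finset (Fin d → ℤ)) :
    (ε / 10) ^ d * volume.real (Metric.ball (0 : EuclideanSpace ℝ (Fin d)) 1) *
      ∑ p ∈ S, (|f (latticePoint ε w p)| - ω) ≤ ∫ x, |f x| := by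
  have hint : Integrable fun x => |f x| := (hf.1.continuous.integrable_of_hasCompactSupport hf.2).abs
  set β : (Fin d → ℤ) → Set (EuclideanSpace ℝ (Fin d)) := fun p =>
    Metric.ball (latticePoint ε w p) (ε / 10) with hβ
  have hvol : ∀ p, volume.real (β p) =
      (ε / 10) ^ d * volume.real (Metric.ball (0 : EuclideanSpace ℝ (Fin d)) 1) := fun p => by
    simp only [hβ, Measure.real]
    rw [Measure.addHaar_ball_of_pos _ _ (by positivity : 0 < ε / 10), ENNReal.toReal_mul,
      ENNReal.toReal_ofReal (by positivity), finrank_euclideanSpace_fin]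
  have hdisj : (S : Set (Fin d → ℤ)).PairwiseDisjoint β := fun p _ q _ hpq => by
    refine Set.disjoint_left.2 fun x hx hx' => hpq ?_
    rw [hβ, mem_ball_iff_norm] at hx hx'
    exact latticePoint_unique (by linarith) hε hx.le hx'.le
  calc _ = ∑ p ∈ S, volume.real (β p) * (|f (latticePoint ε w p)| - ω) := by
        rw [Finset.mul_sum]
        exact Finset.sum_congr rfl fun p _ => by rw [hvol]
    _ ≤ ∑ p ∈ S, ∫ x in β p, |f x| := by
        refine Finset.sum_le_sum fun p _ => ?_
        rw [← smul_eq_mul, ← setIntegral_const]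
        refine setIntegral_mono_on (integrableOn_const measure_ball_lt_top.ne) hint.integrableOn
          measurableSet_ball fun x hx => ?_
        rw [mem_ball_iff_norm, norm_sub_rev] at hx
        have h1 := hω _ _ hx.le
        have h2 := abs_sub_abs_le_abs_sub (f (latticePoint ε w p)) (f x)
        linarith
    _ = ∫ x in ⋃ p ∈ S, β p, |f x| :=
        (integral_biUnion_finset S (fun p _ => measurableSet_ball) hdisj
          fun p _ => hint.integrableOn).symm
    _ ≤ ∫ x, |f x| := setIntegral_le_integral hint (Eventually.of_forall fun x => abs_nonneg _)

end Globalization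

section UpperBound

variable {d : ℕ} {N : (EuclideanSpace ℝ (Fin d) → ℝ) → ℝ}

theorem exists_lattice_partition (hd : 0 < d) {ε : ℝ} (hε : 0 < ε) :
    ∃ φ : (Fin d → Fin (10 * d)) → EuclideanSpace ℝ (Fin d) → ℝ,
      (∀ c, ContDiff ℝ (⊤ : ℕ∞) (φ c)) ∧ (∀ c x, |φ c x| ≤ 1) ∧ (∀ x, ∑ c, φ c x = 1) ∧
      ∀ c x, φ c x ≠ 0 →
        ∃ p, ‖x - latticePoint ε (fun m => (c m : ℕ) / (10 * d : ℕ)) p‖ ≤ ε / 10 := by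
  obtain ⟨φ, -, hφ, hφ1, hφs, hφ0, -⟩ := exists_periodic_partition (K := 10 * d) (by omega)
  refine ⟨fun c x => ∏ m, φ (c m) (x m / ε), fun c => ?_, fun c x => ?_, fun x => ?_,
    fun c x hx => ?_⟩
  · exact contDiff_prod fun m _ =>
      contDiff_comp_apply (p := fun t => φ (c m) (t / ε)) ((hφ _).comp (contDiff_id.div_const ε)) m
  · rw [Finset.abs_prod]
    exact Finset.prod_le_one (fun m _ => abs_nonneg _) fun m _ => hφ1 _ _
  · change ∑ c : Fin d → Fin (10 * d), ∏ m, φ (c m) (x m / ε) = 1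
    rw [← Fintype.prod_sum fun m c => φ c (x m / ε)]
    simp [hφs]
  · have h1 : ∀ m, φ (c m) (x m / ε) ≠ 0 := fun m =>
      Finset.prod_ne_zero_iff.1 hx m (Finset.mem_univ m)
    choose p hp using fun m => hφ0 _ _ (h1 m)
    have hd0 : (0 : ℝ) < d := Nat.cast_pos.2 hd
    refine ⟨p, (norm_le_mul_of_abs_apply_le (b := ε / (10 * d)) fun m => ?_).trans_eq
      (by field_simp)⟩
    have h2 : x m - ε * (p m + (c m : ℕ) / (10 * d : ℕ)) =
        ε * (x m / ε - (c m : ℕ) / (10 * d : ℕ) - p m) := by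
      field_simp
      ring
    rw [PiLp.sub_apply, latticePoint_apply, h2, abs_mul, abs_of_pos hε, div_eq_mul_one_div ε]
    have h3 := hp m
    push_cast at h3 ⊢
    exact mul_le_mul_of_nonneg_left h3.le hε.le

theorem exists_finset_forall_latticePoint_mem {k : ℕ} (hk : 0 < k) {R : ℝ} (hR : 0 ≤ R)
    {w : Fin d → ℝ} (hw : ∀ m, 0 ≤ w m ∧ w m ≤ 1) :
    ∃ S : Finset (Fin d → ℤ), (S.card : ℝ) ≤ (k : ℝ) ^ d * (2 * R + 7) ^ d ∧
      ∀ p x, ‖x‖ ≤ R → ‖x - latticePoint (1 / k) w p‖ ≤ 1 / k / 10 → p ∈ S := by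
  have hk0 : (0 : ℝ) < k := Nat.cast_pos.2 hk
  have hk1 : (1 : ℝ) ≤ k := by exact_mod_cast hk
  set L : ℕ := ⌈k * R⌉₊ + 2 with hL
  have hL1 : (L : ℝ) ≤ k * R + 3 := by
    rw [hL]
    push_cast
    linarith [Nat.ceil_lt_add_one (mul_nonneg hk0.le hR)]
  have hL2 : k * R + 2 ≤ (L : ℝ) := by
    rw [hL]
    push_cast
    linarith [Nat.le_ceil (k * R)]
  refine ⟨Fintype.piFinset fun _ => Finset.Icc (-(L : ℤ)) L, ?_, fun p x hx hp => ?_⟩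
  · have h1 : ((L : ℤ) + 1 - -(L : ℤ)).toNat = 2 * L + 1 := by omega
    rw [Fintype.card_piFinset_const, Int.card_Icc, h1, ← mul_pow]
    push_cast
    exact pow_le_pow_left₀ (by positivity) (by nlinarith) d
  · refine Fintype.mem_piFinset.2 fun m => Finset.mem_Icc.2 (abs_le.1 ?_)
    have h1 := (PiLp.norm_apply_le x m).trans hx
    have h2 := (PiLp.norm_apply_le (x - latticePoint (1 / (k : ℝ)) w p) m).trans hp
    have h3 : (1 : ℝ) / k * |p m + w m| ≤ R + 1 / k / 10 := by
      rw [← abs_of_pos (show (0 : ℝ) < 1 / k by positivity), ← abs_mul,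
        abs_of_pos (show (0 : ℝ) < 1 / k by positivity), ← latticePoint_apply]
      rw [PiLp.sub_apply, norm_sub_rev, Real.norm_eq_abs] at h2
      rw [Real.norm_eq_abs] at h1
      have h4 := abs_sub_abs_le_abs_sub (latticePoint (1 / (k : ℝ)) w p m) (x m)
      linarith
    have h4 : |(p m : ℝ) + w m| ≤ k * R + 1 / 10 := by
      have h5 := mul_le_mul_of_nonneg_left h3 hk0.le
      field_simp at h5 ⊢
      linarith
    have h5 : |(p m : ℝ)| ≤ |(p m : ℝ) + w m| + |w m| := by
      simpa using abs_sub ((p m : ℝ) + w m) (w m)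
    rw [abs_of_nonneg (hw m).1] at h5
    have h6 : |(p m : ℝ)| ≤ (L : ℝ) := by linarith [(hw m).2]
    exact_mod_cast h6

theorem IsInvariantSeminorm.le_of_isControlled (hN : IsInvariantSeminorm N) {C : ℝ} (hC : 0 ≤ C)
    {k : ℕ} (hk : 0 < k) {w : Fin d → ℝ} (hw : ∀ m, 0 ≤ w m ∧ w m ≤ 1)
    (hS : ∀ S : Finset (Fin d → ℤ), S.card ≤ k ^ d → IsControlled N C (1 / k) (1 / k / 10) w S)
    {f F : EuclideanSpace ℝ (Fin d) → ℝ} (hf : IsTest f) (hF : IsTest F)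
    (hFf : ∀ x, |F x| ≤ |f x|)
    (hFs : ∀ x, F x ≠ 0 → ∃ p, ‖x - latticePoint (1 / k) w p‖ ≤ 1 / k / 10)
    {R B ω : ℝ} (hR : 0 ≤ R) (hfR : ∀ x, f x ≠ 0 → ‖x‖ ≤ R) (hB : 0 ≤ B) (hfB : ∀ x, |f x| ≤ B)
    (hω0 : 0 ≤ ω) (hω : ∀ x y, ‖x - y‖ ≤ 1 / k / 10 → |f x - f y| ≤ ω) :
    N F ≤ C * (B + ω + 2 * ω * (2 * R + 7) ^ d +
      10 ^ d / volume.real (Metric.ball (0 : EuclideanSpace ℝ (Fin d)) 1) * ∫ x, |f x|) := by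
  have hk0 : (0 : ℝ) < k := Nat.cast_pos.2 hk
  have hε : (0 : ℝ) < 1 / k := by positivity
  have hv : 0 < volume.real (Metric.ball (0 : EuclideanSpace ℝ (Fin d)) 1) :=
    ENNReal.toReal_pos (Metric.measure_ball_pos _ _ one_pos).ne' measure_ball_lt_top.ne
  obtain ⟨a, ha, has, haF, hsum⟩ := exists_lattice_decomposition hF hε w hFs
  obtain ⟨S, hcard, hSmem⟩ := exists_finset_forall_latticePoint_mem hk hR hw
  have hFS : F = ∑ p ∈ S, a p := hsum S fun p x hx => hSmem p x (hfR x fun h0 => hx (by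
    simpa [h0] using hFf x))
  have h1 := hN.sum_le_of_isControlled (pow_pos hk d) hC hS ha has
    (s := fun p => |f (latticePoint (1 / k) w p)| + ω) (fun p x => by
      by_cases hx : a p x = 0
      · rw [hx, abs_zero]
        positivity
      · have h2 := hω x _ (has p x hx)
        have h3 := abs_sub_abs_le_abs_sub (f x) (f (latticePoint (1 / k) w p))
        linarith [haF p x, hFf x]) S (add_nonneg hB hω0) fun p _ => by
      linarith [hfB (latticePoint (1 / k) w p)]
  rw [hFS]
  refine h1.trans (mul_le_mul_of_nonneg_left ?_ hC)
  have h2 := sum_latticePoint_le_integral hf hε hω w S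
  have h3 : ∑ p ∈ S, (|f (latticePoint (1 / k) w p)| + ω) =
      ∑ p ∈ S, (|f (latticePoint (1 / k) w p)| - ω) + 2 * ω * S.card := by
    simp only [Finset.sum_add_distrib, Finset.sum_sub_distrib, Finset.sum_const, nsmul_eq_mul]
    ring
  have h4 : ((k ^ d : ℕ) : ℝ)⁻¹ * ∑ p ∈ S, (|f (latticePoint (1 / k) w p)| - ω) ≤
      10 ^ d / volume.real (Metric.ball (0 : EuclideanSpace ℝ (Fin d)) 1) * ∫ x, |f x| := by
    refine le_trans (le_of_eq ?_) (mul_le_mul_of_nonneg_left h2 (by positivity))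
    rw [div_pow, div_pow, one_pow]
    push_cast
    field_simp
  have h5 : ((k ^ d : ℕ) : ℝ)⁻¹ * (2 * ω * S.card) ≤ 2 * ω * (2 * R + 7) ^ d := by
    push_cast
    rw [inv_mul_le_iff₀ (by positivity)]
    calc _ ≤ 2 * ω * ((k : ℝ) ^ d * (2 * R + 7) ^ d) := by gcongr
      _ = _ := by ring
  rw [h3, mul_add]
  linarith

theorem IsInvariantSeminorm.exists_le_sup_add_integral [Nontrivial (Fin d)]
    (hN : IsInvariantSeminorm N) :
    ∃ C, 0 ≤ C ∧ ∀ f, IsTest f → ∀ B, 0 < B → (∀ x, |f x| ≤ B) →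
      N f ≤ C * (B + ∫ x, |f x|) := by
  have hd : 0 < d := Fin.pos_iff_nonempty.2 inferInstance
  obtain ⟨C, hC, hctrl⟩ := hN.exists_isControlled_of_card_le
  set A : ℝ := 10 ^ d / volume.real (Metric.ball (0 : EuclideanSpace ℝ (Fin d)) 1) with hA
  have hA0 : 0 ≤ A := by positivity
  refine ⟨Fintype.card (Fin d → Fin (10 * d)) * (C * (4 + A)), by positivity,
    fun f hf B hB hfB => ?_⟩
  obtain ⟨R, hR, hfR⟩ := hf.exists_radius
  have hV : 1 ≤ (2 * R + 7) ^ d := one_le_pow₀ (by linarith)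
  set ω : ℝ := B / (2 * R + 7) ^ d with hω
  have hω0 : 0 < ω := by positivity
  have hωB : ω ≤ B := div_le_self hB.le hV
  have hωV : 2 * ω * (2 * R + 7) ^ d = 2 * B := by
    rw [hω]
    field_simp
  have huc : UniformContinuous f := hf.2.uniformContinuous_of_continuous hf.continuous
  obtain ⟨δ, hδ, hfδ⟩ := Metric.uniformContinuous_iff.1 huc ω hω0
  obtain ⟨k, hk⟩ := exists_nat_one_div_lt hδ
  have hε : (0 : ℝ) < 1 / (k + 1 : ℕ) := by positivity
  obtain ⟨φ, hφ, hφ1, hφs, hφ0⟩ := exists_lattice_partition hd hε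
  have hI : 0 ≤ ∫ x, |f x| := integral_nonneg fun x => abs_nonneg _
  have hc : ∀ c, N (φ c * f) ≤ C * (4 + A) * (B + ∫ x, |f x|) := fun c => by
    have hw : ∀ m, (0 : ℝ) ≤ (c m : ℕ) / (10 * d : ℕ) ∧ ((c m : ℕ) : ℝ) / (10 * d : ℕ) ≤ 1 :=
      fun m => ⟨by positivity, div_le_one_of_le₀ (by exact_mod_cast (c m).2.le) (by positivity)⟩
    have h1 := hN.le_of_isControlled hC k.succ_pos hw (hctrl _ k.succ_pos _ hw) hf
      (hf.mul_left (hφ c)) (fun x => by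
        rw [Pi.mul_apply, abs_mul]
        exact mul_le_of_le_one_left (abs_nonneg _) (hφ1 c x))
      (fun x hx => hφ0 c x (left_ne_zero_of_mul hx)) hR hfR hB.le hfB hω0.le fun x y hxy => by
        refine (hfδ ?_).le
        rw [dist_eq_norm]
        push_cast at hxy hε
        linarith
    rw [hωV, ← hA] at h1
    rw [mul_assoc]
    refine h1.trans (mul_le_mul_of_nonneg_left ?_ hC)
    nlinarith [mul_nonneg hA0 hB.le]
  have hsum : f = ∑ c, φ c * f := by
    rw [← Finset.sum_mul]
    funext x
    simp [hφs]
  calc N f = N (∑ c, φ c * f) := by rw [← hsum]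
    _ ≤ ∑ c, N (φ c * f) := hN.sum_le fun c _ => hf.mul_left (hφ c)
    _ ≤ ∑ _c, C * (4 + A) * (B + ∫ x, |f x|) := Finset.sum_le_sum fun c _ => hc c
    _ = _ := by
      rw [Finset.sum_const, nsmul_eq_mul, Finset.card_univ, mul_assoc, mul_assoc, mul_assoc]

end UpperBound

/-- **Invariant norms are dominated by `L^∞ + L¹`.** If `N` is a norm on
`C^∞_c(ℝ^{2n})` invariant under composition with compactly supported
volume-preserving diffeomorphisms, then `N(f) ≤ C (‖f‖_∞ + ‖f‖_{L¹})` for some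
constant `C > 0`. -/
theorem invariant_norm_upper_bound (n : ℕ) (hn : 1 ≤ n)
    (N : (EuclideanSpace ℝ (Fin (2 * n)) → ℝ) → ℝ)
    (hNonneg : ∀ f, ContDiff ℝ (⊤ : ℕ∞) f → HasCompactSupport f → 0 ≤ N f)
    (hDefinite : ∀ f, ContDiff ℝ (⊤ : ℕ∞) f → HasCompactSupport f →
      (N f = 0 ↔ f = fun _ => 0))
    (hHomog : ∀ (a : ℝ) f, ContDiff ℝ (⊤ : ℕ∞) f → HasCompactSupport f →
      N (fun x => a * f x) = |a| * N f)
    (hTriangle : ∀ f g, ContDiff ℝ (⊤ : ℕ∞) f → HasCompactSupport f →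
      ContDiff ℝ (⊤ : ℕ∞) g → HasCompactSupport g →
      N (fun x => f x + g x) ≤ N f + N g)
    (hInvariant : ∀ f Φ, ContDiff ℝ (⊤ : ℕ∞) f → HasCompactSupport f →
      IsCompSuppVolDiffeo (2 * n) Φ → N (f ∘ Φ) = N f) :
    ∃ C : ℝ, 0 < C ∧
      ∀ f, ContDiff ℝ (⊤ : ℕ∞) f → HasCompactSupport f →
        N f ≤ C * ((⨆ x, |f x|) + (∫ x, |f x|)) := by
  have hN : IsInvariantSeminorm N :=
    ⟨fun hf => hNonneg _ hf.1 hf.2, fun a _ hf => hHomog a _ hf.1 hf.2,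
      fun hf hg => hTriangle _ _ hf.1 hf.2 hg.1 hg.2,
      fun hf hΦ => hInvariant _ _ hf.1 hf.2 hΦ⟩
  have : Nontrivial (Fin (2 * n)) := Fin.nontrivial_iff_two_le.2 (by omega)
  obtain ⟨C, hC, h⟩ := hN.exists_le_sup_add_integral
  refine ⟨C + 1, by positivity, fun f hf hf' => ?_⟩
  obtain ⟨M, -, hM⟩ := IsTest.exists_bound ⟨hf, hf'⟩
  have hle : ∀ x, |f x| ≤ ⨆ x, |f x| := le_ciSup ⟨M, by rintro _ ⟨x, rfl⟩; exact hM x⟩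
  have hI : 0 ≤ ∫ x, |f x| := integral_nonneg fun x => abs_nonneg _
  have hB : 0 ≤ ⨆ x, |f x| := (abs_nonneg _).trans (hle 0)
  rcases hB.eq_or_lt with h0 | h0
  · have hf0 : f = fun _ => 0 := funext fun x => abs_nonpos_iff.1 (h0 ▸ hle x)
    rw [(hDefinite f hf hf').2 hf0]
    positivity
  · refine (h f ⟨hf, hf'⟩ _ h0 hle).trans ?_
    gcongr
    linarith
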